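/- Let f be a function that is analytic and injective on the open unit disk of ℂ, with f(0) = 0 and f'(0) = 1, and let (a_n) be its Taylor coefficients at 0, so that f(z) = Σ_{n≥1} a_n zⁿ for |z| < 1 (with a_1 = 1). Then |a_n| ≤ n for every n ≥ 1. -/

import Mathlib

namespace Bieberbach

open Finset

section Weights

theorem eq_of_forall_sum_pow_eq {n : ℕ} {c d : ℕ → ℝ}
    (h : ∀ x : ℝ, ∑ j ∈ range n, c j * x ^ j = ∑ j ∈ range n, d j * x ^ j)
    {j : ℕ} (hj : j < n) : c j = d j := by
  have key : (∑ j ∈ range n, Polynomial.C (c j) * Polynomial.X ^ j : Polynomial ℝ)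
      = ∑ j ∈ range n, Polynomial.C (d j) * Polynomial.X ^ j := by
    apply Polynomial.funext
    intro x
    simpa [Polynomial.eval_finsetSum] using h x
  have := congrArg (fun p => Polynomial.coeff p j) key
  simpa [Polynomial.finsetSum_coeff, Polynomial.coeff_C_mul, Polynomial.coeff_X_pow, hj] using this

/-- The matrix of the action of `!![a, b; c, d]` on binary forms of degree `N`. -/
noncomputable def symPow (N : ℕ) (a b c d : ℝ) (i j : ℕ) : ℝ :=
  ((Polynomial.C a * Polynomial.X + Polynomial.C b) ^ i *
    (Polynomial.C c * Polynomial.X + Polynomial.C d) ^ (N - i)).coeff j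

theorem symPow_sum (N : ℕ) (a b c d : ℝ) {i : ℕ} (hi : i ≤ N) (x : ℝ) :
    ∑ j ∈ range (N + 1), symPow N a b c d i j * x ^ j
      = (a * x + b) ^ i * (c * x + d) ^ (N - i) := by
  unfold symPow
  set P := ((Polynomial.C a * Polynomial.X + Polynomial.C b) ^ i *
    (Polynomial.C c * Polynomial.X + Polynomial.C d) ^ (N - i)) with hP
  have hd : P.natDegree < N + 1 := by
    have h1 : ((Polynomial.C a * Polynomial.X + Polynomial.C b) ^ i).natDegree ≤ i := by
      simpa using Polynomial.natDegree_pow_le_of_le i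
        (Polynomial.natDegree_linear_le (a := a) (b := b))
    have h2 : ((Polynomial.C c * Polynomial.X + Polynomial.C d) ^ (N - i)).natDegree ≤ N - i := by
      simpa using Polynomial.natDegree_pow_le_of_le (N - i)
        (Polynomial.natDegree_linear_le (a := c) (b := d))
    have : P.natDegree ≤ i + (N - i) := Polynomial.natDegree_mul_le_of_le h1 h2
    omega
  rw [← Polynomial.eval_eq_sum_range' hd x, hP]
  simp

theorem symPow_sum_hom (N : ℕ) (a b c d : ℝ) {i : ℕ} (hi : i ≤ N) (u v : ℝ) :
    ∑ j ∈ range (N + 1), symPow N a b c d i j * (u ^ j * v ^ (N - j))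
      = (a * u + b * v) ^ i * (c * u + d * v) ^ (N - i) := by
  have key : Set.EqOn (fun v : ℝ => ∑ j ∈ range (N + 1), symPow N a b c d i j * (u ^ j * v ^ (N - j)))
      (fun v => (a * u + b * v) ^ i * (c * u + d * v) ^ (N - i)) {0}ᶜ := by
    intro v hv
    have hv : v ≠ 0 := hv
    have h := symPow_sum N a b c d hi (u / v)
    have h1 : a * u + b * v = v * (a * (u / v) + b) := by field_simp
    have h2 : c * u + d * v = v * (c * (u / v) + d) := by field_simp
    simp only
    rw [h1, h2, mul_pow, mul_pow]
    calc _ = v ^ N * ∑ j ∈ range (N + 1), symPow N a b c d i j * (u / v) ^ j := by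
          rw [mul_sum]
          refine sum_congr rfl fun j hj => ?_
          have hj : j ≤ N := by simpa [Nat.lt_succ_iff] using hj
          obtain ⟨m, rfl⟩ := Nat.exists_eq_add_of_le hj
          rw [Nat.add_sub_cancel_left, div_pow, pow_add]
          field_simp
      _ = _ := by
          rw [h]
          obtain ⟨m, rfl⟩ := Nat.exists_eq_add_of_le hi
          rw [Nat.add_sub_cancel_left, pow_add]
          ring
  have := Continuous.ext_on (dense_compl_singleton (0 : ℝ)) (by fun_prop) (by fun_prop) key
  exact congrFun this v

theorem symPow_mul (N : ℕ) (a b c d a' b' c' d' : ℝ) {i j : ℕ} (hi : i ≤ N) (hj : j ≤ N) :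
    symPow N (a * a' + b * c') (a * b' + b * d') (c * a' + d * c') (c * b' + d * d') i j
      = ∑ k ∈ range (N + 1), symPow N a b c d i k * symPow N a' b' c' d' k j := by
  refine eq_of_forall_sum_pow_eq (n := N + 1)
    (d := fun j => ∑ k ∈ range (N + 1), symPow N a b c d i k * symPow N a' b' c' d' k j)
    (fun x => ?_) (Nat.lt_succ_of_le hj)
  rw [symPow_sum _ _ _ _ _ hi]
  simp only [sum_mul]
  rw [sum_comm]
  have : ∀ k ∈ range (N + 1), ∑ j ∈ range (N + 1),
      symPow N a b c d i k * symPow N a' b' c' d' k j * x ^ j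
      = symPow N a b c d i k * ((a' * x + b') ^ k * (c' * x + d') ^ (N - k)) := by
    intro k hk
    rw [← symPow_sum N a' b' c' d' (by simpa [Nat.lt_succ_iff] using hk), mul_sum]
    exact sum_congr rfl fun _ _ => by ring
  rw [sum_congr rfl this, symPow_sum_hom N a b c d hi]
  congr 2 <;> ring

theorem symPow_trace_comm (N : ℕ) (a b c d a' b' c' d' : ℝ) :
    ∑ i ∈ range (N + 1), symPow N (a * a' + b * c') (a * b' + b * d') (c * a' + d * c')
        (c * b' + d * d') i i
      = ∑ i ∈ range (N + 1), symPow N (a' * a + b' * c) (a' * b + b' * d) (c' * a + d' * c)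
        (c' * b + d' * d) i i := by
  have h : ∀ a b c d a' b' c' d' : ℝ, ∑ i ∈ range (N + 1), symPow N (a * a' + b * c')
      (a * b' + b * d') (c * a' + d * c') (c * b' + d * d') i i =
      ∑ i ∈ range (N + 1), ∑ k ∈ range (N + 1), symPow N a b c d i k * symPow N a' b' c' d' k i := by
    intro a b c d a' b' c' d'
    refine sum_congr rfl fun i hi => symPow_mul N _ _ _ _ _ _ _ _ ?_ ?_ <;>
      simpa [Nat.lt_succ_iff] using hi
  rw [h, h, sum_comm]
  exact sum_congr rfl fun _ _ => sum_congr rfl fun _ _ => mul_comm _ _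

theorem symPow_trace {N : ℕ} {a b c d l m : ℝ} (hb : b ≠ 0) (htr : l + m = a + d)
    (hdet : l * m = a * d - b * c) :
    ∑ i ∈ range (N + 1), symPow N a b c d i i = ∑ i ∈ range (N + 1), l ^ i * m ^ (N - i) := by
  set u := (a - l) / b with hu
  have hub : u * b = a - l := by rw [hu]; field_simp
  have h := symPow_trace_comm N 1 0 u 1 (a - b * u) b (c - d * u) d
  have e1 : 1 * (a - b * u) + 0 * (c - d * u) = l := by linarith
  have e2 : 1 * b + 0 * d = b := by ring
  have e3 : u * (a - b * u) + 1 * (c - d * u) = 0 := by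
    have hd : d = l + m - a := by linarith
    have : b * (u * (a - b * u) + 1 * (c - d * u)) = 0 := by
      have : b * (u * (a - b * u) + 1 * (c - d * u)) = (u * b) * (a - u * b) + b * c - d * (u * b) := by
        ring
      rw [this, hub]
      have : b * c = a * d - l * m := by linarith
      rw [this, hd]; ring
    exact (mul_eq_zero.mp this).resolve_left hb
  have e4 : u * b + 1 * d = m := by linarith
  have e5 : (a - b * u) * 1 + b * u = a := by ring
  have e6 : (a - b * u) * 0 + b * 1 = b := by ring
  have e7 : (c - d * u) * 1 + d * u = c := by ring
  have e8 : (c - d * u) * 0 + d * 1 = d := by ring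
  rw [e1, e2, e3, e4, e5, e6, e7, e8] at h
  rw [← h]
  refine sum_congr rfl fun i _ => ?_
  unfold symPow
  rw [Polynomial.C_0, zero_mul, zero_add, ← Polynomial.C_pow, Polynomial.coeff_mul_C]
  congr 1
  have := Polynomial.coeff_pow_of_natDegree_le (m := i)
    (Polynomial.natDegree_linear_le (a := l) (b := b))
  simpa using this

theorem symPow_transpose (N : ℕ) (a b c d : ℝ) {i j : ℕ} (hi : i ≤ N) (hj : j ≤ N) :
    N.choose i * symPow N a b c d i j = N.choose j * symPow N a c b d j i := by
  refine eq_of_forall_sum_pow_eq (n := N + 1) (c := fun j => N.choose i * symPow N a b c d i j)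
    (d := fun j => N.choose j * symPow N a c b d j i) (fun x => ?_) (Nat.lt_succ_of_le hj)
  refine eq_of_forall_sum_pow_eq (n := N + 1)
    (c := fun i => ∑ j ∈ range (N + 1), N.choose i * symPow N a b c d i j * x ^ j)
    (d := fun i => ∑ j ∈ range (N + 1), N.choose j * symPow N a c b d j i * x ^ j)
    (fun t => ?_) (Nat.lt_succ_of_le hi)
  have h1 : ∀ i ∈ range (N + 1), (∑ j ∈ range (N + 1), N.choose i * symPow N a b c d i j * x ^ j)
      * t ^ i = (t * (a * x + b)) ^ i * (c * x + d) ^ (N - i) * N.choose i := by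
    intro i hi
    have := symPow_sum N a b c d (i := i) (by simpa [Nat.lt_succ_iff] using hi) x
    rw [mul_pow, mul_assoc (t ^ i), ← this, sum_mul, mul_sum, sum_mul]
    exact sum_congr rfl fun _ _ => by ring
  rw [sum_congr rfl h1, ← add_pow]
  simp only [sum_mul]
  rw [sum_comm]
  have h2 : ∀ j ∈ range (N + 1), (∑ i ∈ range (N + 1), N.choose j * symPow N a c b d j i * x ^ j
      * t ^ i) = (x * (a * t + c)) ^ j * (b * t + d) ^ (N - j) * N.choose j := by
    intro j hj
    have := symPow_sum N a c b d (i := j) (by simpa [Nat.lt_succ_iff] using hj) t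
    rw [mul_pow, mul_assoc (x ^ j), ← this, mul_sum, sum_mul]
    exact sum_congr rfl fun _ _ => by ring
  rw [sum_congr rfl h2, ← add_pow]
  ring

theorem sum_choose_mul_pow (x l m : ℝ) (hs : l + m = 2 + x) (hp : l * m = 1) (N : ℕ) :
    ∑ j ∈ range (N + 1), ((N + 1 + j).choose (2 * j + 1) : ℝ) * x ^ j
      = ∑ i ∈ range (N + 1), l ^ i * m ^ (N - i) := by
  have ext : ∀ N M : ℕ, N ≤ M → ∑ j ∈ range (N + 1), ((N + 1 + j).choose (2 * j + 1) : ℝ) * x ^ j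
      = ∑ j ∈ range (M + 1), ((N + 1 + j).choose (2 * j + 1) : ℝ) * x ^ j := by
    intro N M h
    refine sum_subset (range_subset_range.2 (by omega)) fun j _ hj => ?_
    rw [Nat.choose_eq_zero_of_lt (by simp at hj; omega)]
    simp
  induction N using Nat.twoStepInduction with
  | zero => simp
  | one => simp [sum_range_succ]; linarith
  | more N ih1 ih2 =>
    have hR : ∑ i ∈ range (N + 2 + 1), l ^ i * m ^ (N + 2 - i)
        = (2 + x) * ∑ i ∈ range (N + 1 + 1), l ^ i * m ^ (N + 1 - i)
          - ∑ i ∈ range (N + 1), l ^ i * m ^ (N - i) := by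
      rw [← hs]
      have g : ∀ N, ∑ i ∈ range (N + 1 + 1), l ^ i * m ^ (N + 1 - i)
          = m * ∑ i ∈ range (N + 1), l ^ i * m ^ (N - i) + l ^ (N + 1) := by
        intro N
        rw [sum_range_succ, mul_sum]
        congr 1
        · refine sum_congr rfl fun i hi => ?_
          rw [Nat.succ_sub (by simp at hi; omega), pow_succ]; ring
        · simp
      have g1 := g N
      have g2 := g (N + 1)
      rw [g2, g1]
      linear_combination (-∑ i ∈ range (N + 1), l ^ i * m ^ (N - i)) * hp
    rw [hR, ← ih1, ← ih2, ext (N + 1) (N + 2) (by omega), ext N (N + 2) (by omega)]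
    have hx : x * ∑ j ∈ range (N + 2 + 1), ((N + 1 + 1 + j).choose (2 * j + 1) : ℝ) * x ^ j
        = ∑ j ∈ range (N + 2 + 1), (if j = 0 then 0 else ((N + 1 + j).choose (2 * j - 1) : ℝ))
          * x ^ j := by
      rw [sum_range_succ, Nat.choose_eq_zero_of_lt (by omega)]
      conv_rhs => rw [sum_range_succ']
      simp only [Nat.cast_zero, zero_mul, add_zero, if_true]
      rw [mul_sum]
      refine sum_congr rfl fun j _ => ?_
      rw [if_neg (by omega), show 2 * (j + 1) - 1 = 2 * j + 1 by omega,
        show N + 1 + (j + 1) = N + 1 + 1 + j by omega]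
      ring
    rw [add_mul, hx, mul_sum, ← sum_add_distrib, ← sum_sub_distrib]
    refine sum_congr rfl fun j _ => ?_
    rcases j with _ | j
    · simp; ring
    · have h : ((N + 2 + 1 + (j + 1)).choose (2 * (j + 1) + 1) : ℝ)
          + (N + 1 + (j + 1)).choose (2 * (j + 1) + 1)
          = 2 * (N + 1 + 1 + (j + 1)).choose (2 * (j + 1) + 1)
            + (N + 1 + (j + 1)).choose (2 * (j + 1) - 1) := by
        rw [show N + 2 + 1 + (j + 1) = N + j + 2 + 1 + 1 by omega,
          show N + 1 + (j + 1) = N + j + 2 by omega,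
          show N + 1 + 1 + (j + 1) = N + j + 2 + 1 by omega,
          show 2 * (j + 1) + 1 = 2 * j + 1 + 1 + 1 by omega,
          show 2 * (j + 1) - 1 = 2 * j + 1 by omega]
        rw [Nat.choose_succ_succ (N + j + 2 + 1), Nat.choose_succ_succ (N + j + 2) (2 * j + 1),
          Nat.choose_succ_succ (N + j + 2) (2 * j + 1 + 1)]
        push_cast; ring
      rw [if_neg (by omega)]
      linear_combination x ^ (j + 1) * h

/-- Coefficients of the polynomial `weight N k`. -/
noncomputable def weightCoeff (N k j : ℕ) : ℝ :=
  (-1) ^ (j + k) * (N + 1 + j).choose (2 * j + 1) * (2 * j).choose (j + k)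

/-- The nonnegative weights of de Branges' system, as polynomials in `s = exp (-t)`. -/
noncomputable def weight (N k : ℕ) (s : ℝ) : ℝ :=
  ∑ j ∈ range (N + 1), weightCoeff N k j * s ^ j

/-- The de Branges functions, for `1 ≤ k`. -/
noncomputable def deBranges (N k : ℕ) (s : ℝ) : ℝ :=
  ∑ j ∈ range (N + 1), (k / j : ℝ) * weightCoeff N k j * s ^ j

theorem weightCoeff_step (N k j : ℕ) :
    ((j : ℝ) - k) * weightCoeff N k j = -((j + k + 1) * weightCoeff N (k + 1) j) := by
  have h : ((j : ℝ) - k) * (2 * j).choose (j + k) = (j + k + 1) * (2 * j).choose (j + (k + 1)) := by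
    rcases le_or_gt k j with hk | hk
    · have := Nat.choose_succ_right_eq (2 * j) (j + k)
      have h2 : ((2 * j - (j + k) : ℕ) : ℝ) = j - k := by
        rw [Nat.cast_sub (by omega)]; push_cast; ring
      have h3 := congrArg (Nat.cast (R := ℝ)) this
      push_cast [h2] at h3
      rw [← add_assoc]; linarith
    · rw [Nat.choose_eq_zero_of_lt (by omega), Nat.choose_eq_zero_of_lt (by omega)]; simp
  unfold weightCoeff
  rw [← add_assoc, pow_succ]
  linear_combination (-1) ^ (j + k) * ((N + 1 + j).choose (2 * j + 1) : ℝ) * h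

theorem weight_eq_zero {N k : ℕ} (h : N < k) (s : ℝ) : weight N k s = 0 := by
  refine sum_eq_zero fun j hj => ?_
  simp only [mem_range] at hj
  rw [weightCoeff, Nat.choose_eq_zero_of_lt (show 2 * j < j + k by omega)]; simp

theorem deBranges_eq_zero {N k : ℕ} (h : N < k) (s : ℝ) : deBranges N k s = 0 := by
  refine sum_eq_zero fun j hj => ?_
  simp only [mem_range] at hj
  rw [weightCoeff, Nat.choose_eq_zero_of_lt (show 2 * j < j + k by omega)]; simp

theorem deBranges_sub (N : ℕ) {k : ℕ} (hk : 1 ≤ k) (s : ℝ) :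
    deBranges N k s - deBranges N (k + 1) s = weight N k s + weight N (k + 1) s := by
  unfold deBranges weight
  rw [← sum_sub_distrib, ← sum_add_distrib]
  refine sum_congr rfl fun j _ => ?_
  rcases Nat.eq_zero_or_pos j with rfl | hj
  · have : ∀ k, 1 ≤ k → weightCoeff N k 0 = 0 := by
      intro k hk
      rw [weightCoeff, Nat.choose_eq_zero_of_lt (show 2 * 0 < 0 + k by omega)]; simp
    rw [this k hk, this (k + 1) (by omega)]; simp
  · have h := weightCoeff_step N k j
    have hj' : (j : ℝ) ≠ 0 := by positivity
    push_cast
    field_simp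
    linear_combination (-s ^ j) * h

/-- `y ^ N` times the generating function of the weights. -/
theorem weight_eq_coeff (N k : ℕ) (s : ℝ) :
    weight N k s = (∑ j ∈ range (N + 1), Polynomial.C (((N + 1 + j).choose (2 * j + 1) : ℝ) * s ^ j)
      * ((Polynomial.X - Polynomial.C 1) ^ (2 * j) * Polynomial.X ^ (N - j))).coeff (N + k) := by
  rw [Polynomial.finsetSum_coeff]
  refine sum_congr rfl fun j hj => ?_
  simp only [mem_range] at hj
  rw [Polynomial.coeff_C_mul, Polynomial.coeff_mul_X_pow', if_pos (by omega),
    sub_eq_add_neg, ← Polynomial.C_neg, Polynomial.coeff_X_add_C_pow, show N + k - (N - j) = j + k by omega, weightCoeff]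
  rcases le_or_gt k j with hk | hk
  · obtain ⟨m, rfl⟩ := Nat.exists_eq_add_of_le hk
    rw [show 2 * (k + m) - (k + m + k) = m by omega, show k + m + k = 2 * k + m by omega, pow_add,
      pow_mul]
    simp; ring
  · rw [Nat.choose_eq_zero_of_lt (show 2 * j < j + k by omega)]; simp

theorem exists_add_mul_eq {x : ℝ} (hx : 0 ≤ x) : ∃ l m : ℝ, l + m = 2 + x ∧ l * m = 1 := by
  refine ⟨((2 + x) + √((2 + x) ^ 2 - 4)) / 2, ((2 + x) - √((2 + x) ^ 2 - 4)) / 2, by ring, ?_⟩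
  have : √((2 + x) ^ 2 - 4) ^ 2 = (2 + x) ^ 2 - 4 := Real.sq_sqrt (by nlinarith)
  linear_combination (-1 / 4 : ℝ) * this

theorem genFun_eval (N : ℕ) (s : ℝ) {y : ℝ} (hy : y ≠ 0) {l m : ℝ}
    (hs : l + m = 2 + s * (y - 1) ^ 2 / y) (hp : l * m = 1) :
    (∑ j ∈ range (N + 1), Polynomial.C (((N + 1 + j).choose (2 * j + 1) : ℝ) * s ^ j)
      * ((Polynomial.X - Polynomial.C 1) ^ (2 * j) * Polynomial.X ^ (N - j))).eval y
    = y ^ N * ∑ i ∈ range (N + 1), l ^ i * m ^ (N - i) := by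
  rw [← sum_choose_mul_pow _ l m hs hp, mul_sum, Polynomial.eval_finsetSum]
  refine sum_congr rfl fun j hj => ?_
  simp only [mem_range] at hj
  simp only [Polynomial.eval_mul, Polynomial.eval_C, Polynomial.eval_pow, Polynomial.eval_sub,
    Polynomial.eval_X]
  obtain ⟨m, rfl⟩ := Nat.exists_eq_add_of_le (Nat.lt_succ_iff.mp hj)
  rw [Nat.add_sub_cancel_left, pow_add, div_pow, mul_pow, pow_mul]
  field_simp

theorem weight_one (N k : ℕ) : weight N k 1 = if k ≤ N ∧ Even (N + k) then 1 else 0 := by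
  rw [weight_eq_coeff]
  have key : (∑ j ∈ range (N + 1), Polynomial.C (((N + 1 + j).choose (2 * j + 1) : ℝ) * 1 ^ j)
      * ((Polynomial.X - Polynomial.C 1) ^ (2 * j) * Polynomial.X ^ (N - j)))
      = ∑ i ∈ range (N + 1), Polynomial.X ^ (2 * i) := by
    refine Polynomial.eq_of_infinite_eval_eq _ _ ((Set.Ioi_infinite (0 : ℝ)).mono ?_)
    intro y hy
    have hy : (0 : ℝ) < y := hy
    have := genFun_eval N 1 hy.ne' (l := y) (m := y⁻¹) (by field_simp; ring) (by field_simp)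
    simp only [Set.mem_ofPred_eq]
    rw [this, Polynomial.eval_finsetSum, mul_sum]
    refine sum_congr rfl fun i hi => ?_
    simp only [mem_range] at hi
    obtain ⟨m, rfl⟩ := Nat.exists_eq_add_of_le (Nat.lt_succ_iff.mp hi)
    rw [Nat.add_sub_cancel_left, pow_add, inv_pow]
    simp only [Polynomial.eval_pow, Polynomial.eval_X]
    field_simp; ring
  rw [key, Polynomial.finsetSum_coeff]
  simp only [Polynomial.coeff_X_pow]
  split_ifs with h
  · obtain ⟨h1, r, hr⟩ := h
    rw [sum_eq_single r]
    · rw [if_pos (by omega)]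
    · intro b _ hb; rw [if_neg (by omega)]
    · intro hr'; simp at hr'; omega
  · refine sum_eq_zero fun i hi => if_neg fun h' => h ?_
    simp only [mem_range] at hi
    exact ⟨by omega, i, by omega⟩

theorem weight_nonneg (N k : ℕ) {s : ℝ} (h0 : 0 < s) (h1 : s ≤ 1) : 0 ≤ weight N k s := by
  rcases h1.eq_or_lt with rfl | h1
  · rw [weight_one]; split_ifs <;> norm_num
  set p := √(1 - s) with hp
  set q := √s with hq
  have hp2 : p ^ 2 = 1 - s := Real.sq_sqrt (by linarith)
  have hq2 : q ^ 2 = s := Real.sq_sqrt h0.le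
  have hp0 : 0 < p := Real.sqrt_pos.2 (by linarith)
  have hq0 : 0 < q := Real.sqrt_pos.2 h0
  set w : ℕ → ℕ → ℝ := fun i j => symPow N p q (-q) p i j ^ 2 * (N.choose i / N.choose j)
  have hw : ∀ i j, 0 ≤ w i j := fun i j => by positivity
  have key : (∑ j ∈ range (N + 1), Polynomial.C (((N + 1 + j).choose (2 * j + 1) : ℝ) * s ^ j)
      * ((Polynomial.X - Polynomial.C 1) ^ (2 * j) * Polynomial.X ^ (N - j)))
      = ∑ i ∈ range (N + 1), ∑ j ∈ range (N + 1), Polynomial.C (w i j)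
        * Polynomial.X ^ (N + i - j) := by
    refine Polynomial.eq_of_infinite_eval_eq _ _ ((Set.Ioi_infinite (1 : ℝ)).mono ?_)
    intro y hy
    have hy : (1 : ℝ) < y := hy
    have hy0 : 0 < y := by linarith
    obtain ⟨l, m, hs, hlm⟩ := exists_add_mul_eq (x := s * (y - 1) ^ 2 / y) (by positivity)
    simp only [Set.mem_ofPred_eq]
    rw [genFun_eval N s hy0.ne' hs hlm,
      ← symPow_trace (N := N) (a := p * p + q * y * q) (b := p * (-q) + q * y * p)
        (c := -q / y * p + p * q) (d := -q / y * (-q) + p * p)]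
    · simp only [Polynomial.eval_finsetSum, mul_sum]
      refine sum_congr rfl fun i hi => ?_
      have hi : i ≤ N := by simpa [Nat.lt_succ_iff] using hi
      rw [symPow_mul N p (q * y) (-q / y) p p (-q) q p hi hi, mul_sum]
      refine sum_congr rfl fun j hj => ?_
      have hj : j ≤ N := by simpa [Nat.lt_succ_iff] using hj
      have e1 : symPow N p (q * y) (-q / y) p i j * y ^ j = y ^ i * symPow N p q (-q) p i j := by
        refine eq_of_forall_sum_pow_eq (n := N + 1)
          (c := fun j => symPow N p (q * y) (-q / y) p i j * y ^ j)
          (d := fun j => y ^ i * symPow N p q (-q) p i j) (fun x => ?_) (Nat.lt_succ_of_le hj)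
        have a1 := symPow_sum N p (q * y) (-q / y) p hi (y * x)
        have a2 := symPow_sum N p q (-q) p hi x
        have e : p * (y * x) + q * y = y * (p * x + q) := by ring
        have e' : -q / y * (y * x) + p = -q * x + p := by field_simp
        rw [e, e', mul_pow, mul_assoc, ← a2] at a1
        simp only [mul_assoc, ← mul_sum]
        rw [← a1]
        exact sum_congr rfl fun _ _ => by rw [mul_pow]
      have e2 := symPow_transpose N p (-q) q p hj hi
      have hc : (N.choose j : ℝ) ≠ 0 := by exact_mod_cast (Nat.choose_pos hj).ne'
      have e3 : symPow N p (-q) q p j i = N.choose i / N.choose j * symPow N p q (-q) p i j := by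
        field_simp; linarith
      simp only [Polynomial.eval_mul, Polynomial.eval_C, Polynomial.eval_pow, Polynomial.eval_X, w]
      rw [e3]
      obtain ⟨r, rfl⟩ := Nat.exists_eq_add_of_le hj
      rw [show j + r + i - j = r + i by omega, pow_add, pow_add]
      linear_combination (y ^ r * ((j + r).choose i / (j + r).choose j)
        * symPow (j + r) p q (-q) p i j) * e1
    · have : p * (-q) + q * y * p = p * q * (y - 1) := by ring
      rw [this]
      have : 0 < y - 1 := by linarith
      positivity
    · rw [hs]
      field_simp
      linear_combination (-(y - 1) ^ 2 ) * hq2 - (2 * y) * hp2 - 2 * y * hq2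
    · rw [hlm]
      field_simp
      have hpq : p ^ 2 + q ^ 2 = 1 := by linarith
      linear_combination (-y * (p ^ 2 + q ^ 2 + 1)) * hpq
  rw [weight_eq_coeff, key]
  simp only [Polynomial.finsetSum_coeff, Polynomial.coeff_C_mul, Polynomial.coeff_X_pow]
  refine sum_nonneg fun i _ => sum_nonneg fun j _ => mul_nonneg (hw i j) ?_
  split_ifs <;> norm_num

theorem deBranges_one (N : ℕ) {k : ℕ} (h1 : 1 ≤ k) (hk : k ≤ N + 1) :
    deBranges N k 1 = N + 1 - k := by
  induction hk using Nat.decreasingInduction with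
  | self => rw [deBranges_eq_zero (by omega)]; push_cast; ring
  | of_succ k hk ih =>
    have := deBranges_sub N h1 1
    rw [ih (by omega), weight_one, weight_one] at this
    have e : (if k ≤ N ∧ Even (N + k) then (1 : ℝ) else 0)
        + (if k + 1 ≤ N ∧ Even (N + (k + 1)) then 1 else 0) = 1 := by
      rcases Nat.even_or_odd (N + k) with he | he
      · rw [if_pos ⟨by omega, he⟩, if_neg]
        · norm_num
        · rintro ⟨-, h⟩; rw [Nat.even_iff] at h he; omega
      · have : k ≠ N := by rintro rfl; rw [Nat.odd_iff] at he; omega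
        rw [if_neg, if_pos]
        · norm_num
        · rw [Nat.odd_iff] at he; exact ⟨by omega, by rw [Nat.even_iff]; omega⟩
        · rintro ⟨-, h⟩; rw [Nat.even_iff] at h; rw [Nat.odd_iff] at he; omega
    rw [e] at this
    push_cast at this
    linarith

theorem deBranges_nonneg (N : ℕ) {k : ℕ} (hk : 1 ≤ k) {s : ℝ} (h0 : 0 < s) (h1 : s ≤ 1) :
    0 ≤ deBranges N k s := by
  rcases le_or_gt k (N + 1) with hkN | hkN
  · induction hkN using Nat.decreasingInduction with
    | self => rw [deBranges_eq_zero (by omega)]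
    | of_succ k _ ih =>
      have := deBranges_sub N hk s
      have := ih (by omega)
      have := weight_nonneg N k h0 h1
      have := weight_nonneg N (k + 1) h0 h1
      linarith
  · rw [deBranges_eq_zero (by omega)]

/-- Second order expansion of `deBranges` along `s ↦ s * exp (-δ)`. -/
theorem exists_deBranges_expansion (N : ℕ) : ∃ K : ℝ, 0 ≤ K ∧ ∀ k : ℕ, 1 ≤ k → k ≤ N →
    ∀ s δ : ℝ, 0 ≤ s → s ≤ 1 → 0 ≤ δ →
    |deBranges N k s - deBranges N k (s * Real.exp (-δ))
      - δ * (k * weight N k (s * Real.exp (-δ)))| ≤ K * δ ^ 2 := by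
  refine ⟨∑ k ∈ range (N + 1), ∑ j ∈ range (N + 1), |(k / j : ℝ) * weightCoeff N k j| * j ^ 2,
    by positivity, fun k hk hkN s δ hs0 hs1 hδ => ?_⟩
  have hle : ∑ j ∈ range (N + 1), |(k / j : ℝ) * weightCoeff N k j| * (j : ℝ) ^ 2
      ≤ ∑ k ∈ range (N + 1), ∑ j ∈ range (N + 1), |(k / j : ℝ) * weightCoeff N k j| * j ^ 2 :=
    single_le_sum (f := fun k : ℕ => ∑ j ∈ range (N + 1),
      |(k / j : ℝ) * weightCoeff N k j| * (j : ℝ) ^ 2) (fun _ _ => by positivity)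
      (mem_range.2 (by omega))
  refine le_trans ?_ (mul_le_mul_of_nonneg_right hle (sq_nonneg δ))
  unfold deBranges weight
  rw [mul_sum, mul_sum, ← sum_sub_distrib, ← sum_sub_distrib, sum_mul]
  refine (abs_sum_le_sum_abs _ _).trans (sum_le_sum fun j _ => ?_)
  have hrw : (k / j : ℝ) * weightCoeff N k j * s ^ j
      - (k / j : ℝ) * weightCoeff N k j * (s * Real.exp (-δ)) ^ j
      - δ * (k * (weightCoeff N k j * (s * Real.exp (-δ)) ^ j))
      = (k / j : ℝ) * weightCoeff N k j * (s ^ j * (1 - (1 + j * δ) * Real.exp (-(j * δ)))) := by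
    have he : Real.exp (-(j * δ)) = Real.exp (-δ) ^ j := by
      rw [← Real.exp_nat_mul]; congr 1; ring
    rw [he, mul_pow]
    rcases Nat.eq_zero_or_pos j with rfl | hj
    · rw [weightCoeff, Nat.choose_eq_zero_of_lt (show 2 * 0 < 0 + k by omega)]; simp
    · have hj' : (j : ℝ) ≠ 0 := by positivity
      field_simp
      ring
  rw [hrw, abs_mul, mul_assoc]
  refine mul_le_mul_of_nonneg_left ?_ (abs_nonneg _)
  have hx : (0 : ℝ) ≤ j * δ := by positivity
  rw [← mul_pow]
  generalize (j : ℝ) * δ = x at hx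
  have h1 : 1 - x ≤ Real.exp (-x) := by linarith [Real.add_one_le_exp (-x)]
  have h2 : (1 + x) * Real.exp (-x) ≤ 1 := by
    calc _ ≤ Real.exp x * Real.exp (-x) := by gcongr; linarith [Real.add_one_le_exp x]
      _ = 1 := by rw [← Real.exp_add]; simp
  have h3 : 1 - (1 + x) * Real.exp (-x) ≤ x ^ 2 := by nlinarith
  rw [abs_of_nonneg (mul_nonneg (pow_nonneg hs0 j) (by linarith))]
  calc _ ≤ 1 * (1 - (1 + x) * Real.exp (-x)) :=
        mul_le_mul_of_nonneg_right (pow_le_one₀ hs0 hs1) (by linarith)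
    _ ≤ _ := by linarith

end Weights

end Bieberbach

namespace Bieberbach

open Finset

section LebedevMilin

theorem exponent_identity (a : ℕ → ℝ) (N : ℕ) :
    ∑ k ∈ range N, ((∑ j ∈ range (k + 1), ((j : ℝ) + 1) ^ 2 * a j) - ((k : ℝ) + 1)) / ((k + 1) * (k + 2))
      = (∑ k ∈ range (N + 1), (((k : ℝ) + 1) * a k - 1 / (k + 1))) + 1
        - (∑ j ∈ range (N + 1), ((j : ℝ) + 1) ^ 2 * a j) / (N + 1) := by
  induction N with
  | zero => simp
  | succ N ih =>
    rw [sum_range_succ, ih, sum_range_succ _ (N + 1), sum_range_succ _ (N + 1)]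
    push_cast
    have h1 : (N : ℝ) + 1 ≠ 0 := by positivity
    have h2 : (N : ℝ) + 2 ≠ 0 := by positivity
    have h3 : (N : ℝ) + 1 + 1 ≠ 0 := by positivity
    field_simp
    ring

theorem exponent_identity_mul (a : ℕ → ℝ) (N : ℕ) :
    ((N : ℝ) + 1) * ∑ k ∈ range N, ((∑ j ∈ range (k + 1), ((j : ℝ) + 1) ^ 2 * a j) - ((k : ℝ) + 1))
        / ((k + 1) * (k + 2))
      = ∑ k ∈ range N, ((N : ℝ) - k) * (((k : ℝ) + 1) * a k - 1 / (k + 1)) := by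
  induction N with
  | zero => simp
  | succ N ih =>
    have e : ∑ k ∈ range (N + 1), (((N + 1 : ℕ) : ℝ) - k) * (((k : ℝ) + 1) * a k - 1 / (k + 1))
        = ∑ k ∈ range N, ((N : ℝ) - k) * (((k : ℝ) + 1) * a k - 1 / (k + 1))
          + ∑ k ∈ range (N + 1), (((k : ℝ) + 1) * a k - 1 / (k + 1)) := by
      have : ∑ k ∈ range N, ((N : ℝ) - k) * (((k : ℝ) + 1) * a k - 1 / (k + 1))
          = ∑ k ∈ range (N + 1), ((N : ℝ) - k) * (((k : ℝ) + 1) * a k - 1 / (k + 1)) := by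
        rw [sum_range_succ]; simp
      rw [this, ← sum_add_distrib]
      refine sum_congr rfl fun k _ => ?_
      push_cast; ring
    rw [e, ← ih, sum_range_succ]
    have := exponent_identity a N
    have h1 : (N : ℝ) + 1 ≠ 0 := by positivity
    have h2 : (N : ℝ) + 2 ≠ 0 := by positivity
    generalize ∑ k ∈ range N, ((∑ j ∈ range (k + 1), ((j : ℝ) + 1) ^ 2 * a j) - ((k : ℝ) + 1))
        / ((k + 1) * (k + 2)) = E at *
    have h3 : ∑ k ∈ range (N + 1), (((k : ℝ) + 1) * a k - 1 / (k + 1)) = E - 1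
        + (∑ j ∈ range (N + 1), ((j : ℝ) + 1) ^ 2 * a j) / (N + 1) := by linarith
    rw [h3]
    push_cast
    field_simp
    ring

theorem lebedev_milin (α β : ℕ → ℂ) (N : ℕ) (h0 : β 0 = 1)
    (hβ : ∀ k : ℕ, ((k : ℂ) + 1) * β (k + 1) = ∑ j ∈ range (k + 1), ((j : ℂ) + 1) * α j * β (k - j))
    (h : ∑ k ∈ range N, ((N : ℝ) - k) * (((k : ℝ) + 1) * ‖α k‖ ^ 2 - 1 / (k + 1)) ≤ 0) :
    ∑ k ∈ range (N + 1), ‖β k‖ ^ 2 ≤ N + 1 := by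
  have step : ∀ k : ℕ, ((k : ℝ) + 1) ^ 2 * ‖β (k + 1)‖ ^ 2
      ≤ (∑ j ∈ range (k + 1), ((j : ℝ) + 1) ^ 2 * ‖α j‖ ^ 2) * ∑ j ∈ range (k + 1), ‖β j‖ ^ 2 := by
    intro k
    have h1 : ((k : ℝ) + 1) * ‖β (k + 1)‖
        ≤ ∑ j ∈ range (k + 1), (((j : ℝ) + 1) * ‖α j‖) * ‖β (k - j)‖ := by
      have := congrArg norm (hβ k)
      rw [norm_mul, show ‖(k : ℂ) + 1‖ = (k : ℝ) + 1 by
        rw [← Nat.cast_succ, Complex.norm_natCast]; push_cast; ring] at this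
      rw [this]
      refine (norm_sum_le _ _).trans (sum_le_sum fun j _ => ?_)
      rw [norm_mul, norm_mul, ← Nat.cast_succ, Complex.norm_natCast]; push_cast; rfl
    have h2 := sum_mul_sq_le_sq_mul_sq (range (k + 1)) (fun j => ((j : ℝ) + 1) * ‖α j‖)
      (fun j => ‖β (k - j)‖)
    have h3 : ∑ j ∈ range (k + 1), ‖β (k - j)‖ ^ 2 = ∑ j ∈ range (k + 1), ‖β j‖ ^ 2 := by
      have := sum_range_reflect (fun j => ‖β j‖ ^ 2) (k + 1)
      simpa using this
    rw [h3] at h2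
    simp only [mul_pow] at h2
    rw [← mul_pow]
    exact (pow_le_pow_left₀ (by positivity) h1 2).trans h2
  have main : ∀ n : ℕ, ∑ k ∈ range (n + 1), ‖β k‖ ^ 2 ≤ (n + 1) * Real.exp (∑ k ∈ range n,
      ((∑ j ∈ range (k + 1), ((j : ℝ) + 1) ^ 2 * ‖α j‖ ^ 2) - (k + 1)) / ((k + 1) * (k + 2))) := by
    intro n
    induction n with
    | zero => simp [h0]
    | succ n ih =>
      rw [sum_range_succ, sum_range_succ (n := n) (f := fun k => _ / _), Real.exp_add]
      have hs := step n
      set A := ∑ j ∈ range (n + 1), ((j : ℝ) + 1) ^ 2 * ‖α j‖ ^ 2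
      set B := ∑ j ∈ range (n + 1), ‖β j‖ ^ 2
      have hA : 0 ≤ A := by positivity
      have hB : 0 ≤ B := by positivity
      have hn : (0 : ℝ) < n + 1 := by positivity
      have hn2 : (0 : ℝ) < n + 2 := by positivity
      have hx := Real.add_one_le_exp ((A - (n + 1)) / (((n : ℝ) + 1) * (n + 2)))
      set X := Real.exp ((A - (n + 1)) / (((n : ℝ) + 1) * (n + 2)))
      set E := Real.exp (∑ k ∈ range n,
        ((∑ j ∈ range (k + 1), ((j : ℝ) + 1) ^ 2 * ‖α j‖ ^ 2) - (k + 1)) / ((k + 1) * (k + 2)))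
      have e1 : ‖β (n + 1)‖ ^ 2 ≤ A * B / (n + 1) ^ 2 := by
        rw [le_div_iff₀ (by positivity)]; linarith
      calc B + ‖β (n + 1)‖ ^ 2 ≤ B + A * B / (n + 1) ^ 2 := by linarith
        _ = B * ((n + 2) / (n + 1)) * ((A - (n + 1)) / (((n : ℝ) + 1) * (n + 2)) + 1) := by
            field_simp; ring
        _ ≤ B * ((n + 2) / (n + 1)) * X := by gcongr
        _ ≤ ((n + 1) * E) * ((n + 2) / (n + 1)) * X := by gcongr
        _ = _ := by push_cast; field_simp; ring
  refine (main N).trans ?_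
  have hid := exponent_identity_mul (fun k => ‖α k‖ ^ 2) N
  have hE : ∑ k ∈ range N, ((∑ j ∈ range (k + 1), ((j : ℝ) + 1) ^ 2 * ‖α j‖ ^ 2) - (k + 1))
      / (((k : ℝ) + 1) * (k + 2)) ≤ 0 := by
    by_contra hc
    push Not at hc
    have : (0 : ℝ) < N + 1 := by positivity
    have := mul_pos this hc
    linarith
  have := Real.exp_le_one_iff.2 hE
  have hN : (0 : ℝ) ≤ N + 1 := by positivity
  nlinarith

theorem norm_convolution_self_le (β : ℕ → ℂ) (N : ℕ) :
    ‖∑ j ∈ range (N + 1), β j * β (N - j)‖ ≤ ∑ j ∈ range (N + 1), ‖β j‖ ^ 2 := by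
  have h3 : ∑ j ∈ range (N + 1), ‖β (N - j)‖ ^ 2 = ∑ j ∈ range (N + 1), ‖β j‖ ^ 2 := by
    have := sum_range_reflect (fun j => ‖β j‖ ^ 2) (N + 1)
    simpa using this
  calc _ ≤ ∑ j ∈ range (N + 1), (‖β j‖ ^ 2 + ‖β (N - j)‖ ^ 2) / 2 := by
        refine (norm_sum_le _ _).trans (sum_le_sum fun j _ => ?_)
        rw [norm_mul]
        nlinarith [sq_nonneg (‖β j‖ - ‖β (N - j)‖)]
    _ = _ := by rw [← sum_div, sum_add_distrib, h3]; ring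

end LebedevMilin

end Bieberbach

namespace Bieberbach

open Finset Metric Filter Topology

section TaylorCoeff

/-- The `n`-th Taylor coefficient of `f` at the origin. -/
noncomputable def taylorCoeff (f : ℂ → ℂ) (n : ℕ) : ℂ := iteratedDeriv n f 0 / n.factorial

theorem taylorCoeff_congr {f g : ℂ → ℂ} (h : f =ᶠ[𝓝 0] g) (n : ℕ) :
    taylorCoeff f n = taylorCoeff g n := by
  rw [taylorCoeff, taylorCoeff, h.iteratedDeriv_eq]

@[simp] theorem taylorCoeff_zero (f : ℂ → ℂ) : taylorCoeff f 0 = f 0 := by simp [taylorCoeff]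

theorem taylorCoeff_one (f : ℂ → ℂ) : taylorCoeff f 1 = deriv f 0 := by simp [taylorCoeff]

theorem taylorCoeff_deriv (f : ℂ → ℂ) (n : ℕ) :
    taylorCoeff (deriv f) n = (n + 1) * taylorCoeff f (n + 1) := by
  rw [taylorCoeff, taylorCoeff, ← iteratedDeriv_succ', Nat.factorial_succ]
  have : ((n.factorial : ℕ) : ℂ) ≠ 0 := by exact_mod_cast n.factorial_ne_zero
  have : (n : ℂ) + 1 ≠ 0 := by exact_mod_cast n.succ_ne_zero
  push_cast
  field_simp

theorem taylorCoeff_add {f g : ℂ → ℂ} (hf : AnalyticAt ℂ f 0) (hg : AnalyticAt ℂ g 0) (n : ℕ) :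
    taylorCoeff (fun z => f z + g z) n = taylorCoeff f n + taylorCoeff g n := by
  have := iteratedDeriv_add (n := n) (x := (0 : ℂ)) (f := f) (g := g) hf.contDiffAt hg.contDiffAt
  rw [taylorCoeff, taylorCoeff, taylorCoeff, ← add_div, ← this]; rfl

theorem taylorCoeff_sub {f g : ℂ → ℂ} (hf : AnalyticAt ℂ f 0) (hg : AnalyticAt ℂ g 0) (n : ℕ) :
    taylorCoeff (fun z => f z - g z) n = taylorCoeff f n - taylorCoeff g n := by
  have := iteratedDeriv_sub (n := n) (x := (0 : ℂ)) (f := f) (g := g) hf.contDiffAt hg.contDiffAt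
  rw [taylorCoeff, taylorCoeff, taylorCoeff, ← sub_div, ← this]; rfl

theorem taylorCoeff_const (c : ℂ) (n : ℕ) :
    taylorCoeff (fun _ => c) n = if n = 0 then c else 0 := by
  split_ifs with h
  · simp [taylorCoeff, h]
  · simp [taylorCoeff, iteratedDeriv_const, h]

theorem taylorCoeff_mul {f g : ℂ → ℂ} (hf : AnalyticAt ℂ f 0) (hg : AnalyticAt ℂ g 0) (n : ℕ) :
    taylorCoeff (fun z => f z * g z) n
      = ∑ j ∈ range (n + 1), taylorCoeff f j * taylorCoeff g (n - j) := by
  have := iteratedDeriv_mul (n := n) (x := (0 : ℂ)) (f := f) (g := g) hf.contDiffAt hg.contDiffAt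
  have e : iteratedDeriv n (fun z => f z * g z) 0 = _ := this
  rw [taylorCoeff, e, sum_div]
  refine sum_congr rfl fun j hj => ?_
  have hj : j ≤ n := by simpa [Nat.lt_succ_iff] using hj
  rw [taylorCoeff, taylorCoeff, Nat.cast_choose ℂ hj]
  have h1 : ((n.factorial : ℕ) : ℂ) ≠ 0 := by exact_mod_cast n.factorial_ne_zero
  have h2 : ((j.factorial : ℕ) : ℂ) ≠ 0 := by exact_mod_cast j.factorial_ne_zero
  have h3 : (((n - j).factorial : ℕ) : ℂ) ≠ 0 := by exact_mod_cast (n - j).factorial_ne_zero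
  field_simp

theorem taylorCoeff_const_mul {f : ℂ → ℂ} (hf : AnalyticAt ℂ f 0) (c : ℂ) (n : ℕ) :
    taylorCoeff (fun z => c * f z) n = c * taylorCoeff f n := by
  rw [taylorCoeff_mul analyticAt_const hf]
  rw [sum_eq_single 0]
  · simp
  · intro j _ hj; simp [taylorCoeff_const, hj]
  · simp

theorem taylorCoeff_id_mul {f : ℂ → ℂ} (hf : AnalyticAt ℂ f 0) (n : ℕ) :
    taylorCoeff (fun z => z * f z) (n + 1) = taylorCoeff f n := by
  have hid : AnalyticAt ℂ (fun z : ℂ => z) 0 := analyticAt_id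
  rw [taylorCoeff_mul hid hf, sum_eq_single 1]
  · rw [taylorCoeff_one, deriv_id'']; simp
  · intro j _ hj
    rcases j with _ | _ | j
    · simp
    · exact absurd rfl hj
    · have : taylorCoeff (fun z => z) (j + 2) = 0 := by
        have := taylorCoeff_deriv (fun z => z) (j + 1)
        rw [deriv_id'', taylorCoeff_const, if_neg (by omega)] at this
        have h : ((j + 1 : ℕ) : ℂ) + 1 ≠ 0 := by exact_mod_cast (j + 1).succ_ne_zero
        exact (mul_eq_zero.mp this.symm).resolve_left h
      rw [this, zero_mul]
  · simp

theorem norm_taylorCoeff_le {f : ℂ → ℂ} {R C : ℝ} (hR : 0 < R)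
    (hf : DifferentiableOn ℂ f (closedBall 0 R)) (hC : ∀ z ∈ sphere (0 : ℂ) R, ‖f z‖ ≤ C) (n : ℕ) :
    ‖taylorCoeff f n‖ ≤ C / R ^ n := by
  have := Complex.norm_iteratedDeriv_le_of_forall_mem_sphere_norm_le n hR
    (hf.mono (closure_ball_subset_closedBall)).diffContOnCl hC
  rw [taylorCoeff, norm_div, Complex.norm_natCast]
  have hn : (0 : ℝ) < n.factorial := by exact_mod_cast n.factorial_pos
  rw [div_le_iff₀ hn]
  calc _ ≤ _ := this
    _ = _ := by ring

theorem taylorCoeff_eq_of_hasSum {f : ℂ → ℂ} {a : ℕ → ℂ} {R : ℝ} (hR : 0 < R)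
    (h : ∀ z ∈ ball (0 : ℂ) R, HasSum (fun n => a n * z ^ n) (f z)) (n : ℕ) :
    taylorCoeff f n = a n := by
  have h1 : HasFPowerSeriesAt f (FormalMultilinearSeries.ofScalars ℂ a) 0 := by
    rw [hasFPowerSeriesAt_iff]
    filter_upwards [ball_mem_nhds (0 : ℂ) hR] with z hz
    rw [zero_add]
    refine (congrArg (fun u => HasSum u (f z)) (funext fun n => ?_)).mp (h z hz)
    simp [FormalMultilinearSeries.coeff_ofScalars, mul_comm]
  have h2 := h1.analyticAt.hasFPowerSeriesAt
  have h3 := h1.eq_formalMultilinearSeries h2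
  have h4 := congrArg (fun p => FormalMultilinearSeries.coeff p n) h3
  simp only [FormalMultilinearSeries.coeff_ofScalars] at h4
  exact h4.symm

/-- The Milin inequality for `log (F z / z)` yields the coefficient bound for `F`. -/
theorem norm_taylorCoeff_le_of_milin {F G : ℂ → ℂ} {R : ℝ} (hR : 0 < R)
    (hG : DifferentiableOn ℂ G (ball 0 R)) (hG0 : G 0 = 0)
    (hF : ∀ z ∈ ball (0 : ℂ) R, F z = z * Complex.exp (G z)) (N : ℕ)
    (h : ∑ k ∈ range N, ((N : ℝ) - k) * (((k : ℝ) + 1) * ‖taylorCoeff G (k + 1)‖ ^ 2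
      - 4 / (k + 1)) ≤ 0) :
    ‖taylorCoeff F (N + 1)‖ ≤ N + 1 := by
  have hGa : ∀ z ∈ ball (0 : ℂ) R, AnalyticAt ℂ G z := fun z hz =>
    hG.analyticAt (isOpen_ball.mem_nhds hz)
  have h0 : (0 : ℂ) ∈ ball (0 : ℂ) R := mem_ball_self hR
  set D : ℂ → ℂ := fun z => Complex.exp (G z / 2) with hD
  have hDa : AnalyticAt ℂ D 0 := ((hGa 0 h0).div_const).cexp
  have hFD : F =ᶠ[𝓝 0] fun z => z * (D z * D z) := by
    filter_upwards [ball_mem_nhds (0 : ℂ) hR] with z hz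
    rw [hF z hz, hD, ← Complex.exp_add, add_halves]
  rw [taylorCoeff_congr hFD, taylorCoeff_id_mul (f := fun z => D z * D z) (hDa.mul hDa), taylorCoeff_mul hDa hDa]
  refine (norm_convolution_self_le _ N).trans
    (lebedev_milin (fun k => taylorCoeff G (k + 1) / 2) _ N ?_ ?_ ?_)
  · simp [hD, hG0]
  · intro k
    have hd : deriv D =ᶠ[𝓝 0] fun z => (1 / 2 * deriv G z) * D z := by
      filter_upwards [ball_mem_nhds (0 : ℂ) hR] with z hz
      have := (((hGa z hz).differentiableAt.hasDerivAt).div_const 2).cexp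
      rw [this.deriv, hD]; ring
    have hdG := (hGa 0 h0).deriv
    rw [← taylorCoeff_deriv, taylorCoeff_congr hd,
      taylorCoeff_mul (f := fun z => 1 / 2 * deriv G z) (analyticAt_const.mul hdG) hDa]
    refine sum_congr rfl fun j _ => ?_
    rw [taylorCoeff_const_mul hdG, taylorCoeff_deriv]
    ring
  · refine le_trans (le_of_eq ?_) (mul_nonpos_of_nonneg_of_nonpos (by norm_num : (0 : ℝ) ≤ 1 / 4) h)
    rw [mul_sum]
    refine sum_congr rfl fun k _ => ?_
    rw [norm_div]
    simp only [Complex.norm_ofNat]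
    ring

end TaylorCoeff

end Bieberbach

namespace Bieberbach

open Finset Metric Filter Topology ComplexConjugate

section Kernel

theorem circleAverage_inv_pow_mul {u : ℂ → ℂ} {r : ℝ} (hr : 0 < r)
    (hu : DiffContOnCl ℂ u (ball 0 r)) (m : ℕ) :
    Real.circleAverage (fun z => (z ^ m)⁻¹ * u z) 0 r = taylorCoeff u m := by
  rw [Real.circleAverage_eq_circleIntegral hr.ne']
  have h := hu.circleIntegral_one_div_sub_center_pow_smul hr m
  have e : ∀ z : ℂ, (z - 0)⁻¹ • ((z ^ m)⁻¹ * u z) = (1 / (z - 0) ^ (m + 1)) • u z := by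
    intro z
    simp only [smul_eq_mul, sub_zero, pow_succ, one_div, mul_inv]
    ring
  rw [funext e, h, taylorCoeff, smul_eq_mul, smul_eq_mul]
  have := Complex.two_pi_I_ne_zero
  have : (m.factorial : ℂ) ≠ 0 := by exact_mod_cast m.factorial_ne_zero
  field_simp

theorem circleAverage_pow_mul {u : ℂ → ℂ} {r : ℝ} (hr : 0 < r)
    (hu : DiffContOnCl ℂ u (ball 0 r)) (m : ℕ) :
    Real.circleAverage (fun z => z ^ (m + 1) * u z) 0 r = 0 := by
  have : DiffContOnCl ℂ (fun z => z ^ (m + 1) * u z) (ball 0 |r|) := by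
    rw [abs_of_pos hr]
    exact (Differentiable.diffContOnCl (f := fun z : ℂ => z ^ (m + 1)) (by fun_prop)).smul hu
  rw [this.circleAverage]
  simp

theorem nonpos_of_kernel_nonpos (N : ℕ) (A : ℝ) (l : ℕ → ℂ) {u : ℂ → ℂ} {δ : ℝ}
    (hu : DifferentiableOn ℂ u (ball 0 1)) (hre : ∀ z ∈ ball (0 : ℂ) 1, 0 ≤ (u z).re)
    (hu0 : u 0 = δ)
    (hl : ∀ κ : ℂ, ‖κ‖ = 1 → A + (l 0 + 2 * ∑ m ∈ range N, κ ^ (m + 1) * l (m + 1)).re ≤ 0) :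
    δ * A + (∑ m ∈ range (N + 1), taylorCoeff u m * l m).re ≤ 0 := by
  set Q : ℝ → ℝ := fun r => δ * A + (δ * l 0
    + ∑ m ∈ range N, r ^ (m + 1) * (taylorCoeff u (m + 1) * l (m + 1))).re with hQ
  have hQc : Continuous Q := by
    refine continuous_const.add (Complex.continuous_re.comp (continuous_const.add
      (continuous_finsetSum _ fun m _ => ?_)))
    exact ((Complex.continuous_ofReal.pow _).mul continuous_const)
  have hQ1 : Q 1 = δ * A + (∑ m ∈ range (N + 1), taylorCoeff u m * l m).re := by
    rw [hQ, sum_range_succ']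
    simp [hu0, add_comm]
  rw [← hQ1]
  have key : ∀ r ∈ Set.Ioo (0 : ℝ) 1, Q r ≤ 0 := by
    rintro r ⟨hr0, hr1⟩
    have hsub : closedBall (0 : ℂ) r ⊆ ball 0 1 := closedBall_subset_ball hr1
    have hud : DiffContOnCl ℂ u (ball 0 r) :=
      (hu.mono (closure_ball_subset_closedBall.trans hsub)).diffContOnCl
    have huc : ContinuousOn u (sphere 0 r) :=
      hu.continuousOn.mono (sphere_subset_closedBall.trans hsub)
    have hz0 : ∀ z ∈ sphere (0 : ℂ) r, z ≠ 0 := by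
      rintro z hz rfl; simp at hz; exact hr0.ne hz
    set T : ℂ → ℂ := fun z => (A + (l 0).re) * u z + ∑ m ∈ range N,
      ((r ^ (m + 1) * l (m + 1)) * ((z ^ (m + 1))⁻¹ * u z)
        + ((r ^ (m + 1))⁻¹ * conj (l (m + 1))) * (z ^ (m + 1) * u z)) with hT
    have hI1 : ∀ m : ℕ, CircleIntegrable (fun z => (z ^ m)⁻¹ * u z) 0 r := fun m =>
      ContinuousOn.circleIntegrable hr0.le
        (((continuous_id.pow m).continuousOn.inv₀ fun z hz => pow_ne_zero m (hz0 z hz)).mul huc)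
    have hI2 : ∀ m : ℕ, CircleIntegrable (fun z => z ^ m * u z) 0 r := fun m =>
      ContinuousOn.circleIntegrable hr0.le ((continuous_id.pow m).continuousOn.mul huc)
    have hI3 : CircleIntegrable u 0 r := ContinuousOn.circleIntegrable hr0.le huc
    have hcm : ∀ (c : ℂ) (v : ℂ → ℂ), CircleIntegrable v 0 r →
        CircleIntegrable (fun z => c * v z) 0 r := fun c v hv => hv.const_mul c
    have hI4 : ∀ m : ℕ, CircleIntegrable (fun z => (r ^ (m + 1) * l (m + 1)) * ((z ^ (m + 1))⁻¹ * u z)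
        + ((r ^ (m + 1))⁻¹ * conj (l (m + 1))) * (z ^ (m + 1) * u z)) 0 r := fun m =>
      (hcm _ _ (hI1 (m + 1))).add (hcm _ _ (hI2 (m + 1)))
    have hIT : CircleIntegrable T 0 r :=
      (hcm _ _ hI3).add (CircleIntegrable.fun_sum _ fun m _ => hI4 m)
    have hu0' : Real.circleAverage u 0 r = δ := by
      rw [← hu0]; exact DiffContOnCl.circleAverage (by rwa [abs_of_pos hr0])
    have havg : Real.circleAverage T 0 r = (A + (l 0).re) * δ + ∑ m ∈ range N,
        (r ^ (m + 1) * l (m + 1)) * taylorCoeff u (m + 1) := by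
      have e1 : ∀ (c : ℂ) (v : ℂ → ℂ), Real.circleAverage (fun z => c * v z) 0 r
          = c * Real.circleAverage v 0 r := fun c v => Real.circleAverage_fun_smul (a := c)
      rw [hT, Real.circleAverage_fun_add (hcm _ _ hI3) (CircleIntegrable.fun_sum _ fun m _ => hI4 m),
        Real.circleAverage_fun_sum fun m _ => hI4 m, e1, hu0']
      congr 1
      refine sum_congr rfl fun m _ => ?_
      rw [Real.circleAverage_fun_add (hcm _ _ (hI1 (m + 1))) (hcm _ _ (hI2 (m + 1))), e1, e1,
        circleAverage_inv_pow_mul hr0 hud, circleAverage_pow_mul hr0 hud, mul_zero, add_zero]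
    have hre' : Q r = Real.circleAverage (fun z => (T z).re) 0 r := by
      have := ContinuousLinearMap.circleAverage_comp_comm Complex.reCLM hIT
      have h2 : Real.circleAverage (fun z => (T z).re) 0 r = (Real.circleAverage T 0 r).re := this
      rw [h2, havg, hQ]
      simp only [Complex.add_re, Complex.mul_re, Complex.ofReal_re, Complex.ofReal_im, Complex.add_im]
      have : ∀ m, (r : ℂ) ^ (m + 1) * (taylorCoeff u (m + 1) * l (m + 1))
        = r ^ (m + 1) * l (m + 1) * taylorCoeff u (m + 1) := fun m => by ring
      simp only [this]
      ring
    have hneg : ∀ z ∈ sphere (0 : ℂ) |r|, (T z).re ≤ 0 := by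
      intro z hz
      rw [abs_of_pos hr0] at hz
      have hz0' := hz0 z hz
      have hzr : ‖z‖ = r := by simpa using hz
      have hr0' : (r : ℂ) ≠ 0 := by exact_mod_cast hr0.ne'
      have hκ : ‖(r : ℂ) / z‖ = 1 := by
        rw [norm_div, hzr, Complex.norm_real, Real.norm_of_nonneg hr0.le, div_self hr0.ne']
      have hc : conj ((r : ℂ) / z) = z / r := by
        rw [← Complex.inv_eq_conj hκ, inv_div]
      have hTz : T z = ((A + (l 0 + 2 * ∑ m ∈ range N, ((r : ℂ) / z) ^ (m + 1) * l (m + 1)).re : ℝ) : ℂ)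
          * u z := by
        have e2 : ∀ m : ℕ, (r ^ (m + 1) * l (m + 1)) * ((z ^ (m + 1))⁻¹ * u z)
            + ((r ^ (m + 1))⁻¹ * conj (l (m + 1))) * (z ^ (m + 1) * u z)
            = ((2 * (((r : ℂ) / z) ^ (m + 1) * l (m + 1)).re : ℝ) : ℂ) * u z := by
          intro m
          have := Complex.add_conj (((r : ℂ) / z) ^ (m + 1) * l (m + 1))
          rw [← this, map_mul, map_pow, hc, div_pow, div_pow]
          push_cast
          ring
        rw [hT]
        simp only [e2]
        rw [← sum_mul, ← add_mul, ← Complex.ofReal_sum, ← mul_sum, Complex.add_re,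
          show (2 : ℂ) = ((2 : ℝ) : ℂ) by norm_num, Complex.re_ofReal_mul, Complex.re_sum]
        push_cast
        ring
      rw [hTz, Complex.re_ofReal_mul]
      exact mul_nonpos_of_nonpos_of_nonneg (hl _ hκ) (hre z (hsub (sphere_subset_closedBall hz)))
    rw [hre']
    have := Real.circleAverage_mono (f₁ := fun z => (T z).re) (f₂ := fun _ => (0 : ℝ)) (c := 0) (R := r)
      ⟨Complex.reCLM.integrable_comp hIT.1, Complex.reCLM.integrable_comp hIT.2⟩ (circleIntegrable_const _ _ _) hneg
    rwa [Real.circleAverage_const] at this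
  have hcl : closure (Set.Ioo (0 : ℝ) 1) ⊆ {r | Q r ≤ 0} :=
    closure_minimal key (isClosed_le hQc continuous_const)
  rw [closure_Ioo (by norm_num)] at hcl
  exact hcl ⟨by norm_num, le_refl _⟩

end Kernel

end Bieberbach

namespace Bieberbach

open Finset Metric Filter Topology ComplexConjugate

section Loewner

theorem sum_weights_telescope {σ τ φ : ℕ → ℝ} (hφ : φ 0 = 1)
    (hst : ∀ k, τ (k + 1) - τ (k + 2) = σ (k + 1) + σ (k + 2)) (n : ℕ) :
    ∑ k ∈ range n, (σ (k + 1) * (2 * φ (k + 1) + 2 * φ k - 4) - 2 * τ (k + 1) * (φ (k + 1) - φ k))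
      = -2 * (τ (n + 1) + σ (n + 1)) * (φ n - 1) := by
  induction n with
  | zero => simp [hφ]
  | succ n ih =>
    rw [sum_range_succ, ih]
    have : τ (n + 1) = τ (n + 2) + σ (n + 1) + σ (n + 2) := by linarith [hst n]
    rw [this]
    ring

theorem sum_range_ite_le (f : ℕ → ℂ) {n N : ℕ} (h : n ≤ N) :
    ∑ m ∈ range N, (if m < n then f m else 0) = ∑ m ∈ range n, f m := by
  rw [← sum_filter]
  congr 1
  ext m
  simp only [mem_filter, mem_range]
  omega

theorem loewner_kernel_nonpos (N : ℕ) {σ τ : ℕ → ℝ} {e : ℕ → ℂ} (hσ : ∀ k, 0 ≤ σ (k + 1))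
    (hst : ∀ k, τ (k + 1) - τ (k + 2) = σ (k + 1) + σ (k + 2)) (hσN : σ (N + 1) = 0)
    (hτN : τ (N + 1) = 0) (he : e 0 = 1) {κ : ℂ} (hκ : ‖κ‖ = 1) :
    ∑ k ∈ range N, (σ (k + 1) * (‖e (k + 1)‖ ^ 2 - 4) - 2 * τ (k + 1) *
      (conj (e (k + 1)) * (e (k + 1) + 2 * ∑ m ∈ range (k + 1), κ ^ (m + 1) * e (k - m))).re)
      ≤ 0 := by
  set P : ℕ → ℂ := fun n => ∑ m ∈ range (n + 1), κ ^ m * e (n - m) with hP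
  have hPs : ∀ n, P (n + 1) = e (n + 1) + κ * P n := by
    intro n
    simp only [hP]
    rw [sum_range_succ', mul_sum, add_comm]
    congr 1
    · simp
    · refine sum_congr rfl fun m _ => ?_
      rw [Nat.add_sub_add_right]
      ring
  have hφ : ‖P 0‖ ^ 2 = 1 := by simp [hP, he]
  have h := sum_weights_telescope (φ := fun n => ‖P n‖ ^ 2) hφ hst N
  rw [hσN, hτN] at h
  refine (sum_le_sum fun k _ => ?_).trans (h.le.trans (by simp))
  have hk : ‖κ * P k‖ ^ 2 = ‖P k‖ ^ 2 := by rw [norm_mul, hκ, one_mul]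
  have h1 : ∑ m ∈ range (k + 1), κ ^ (m + 1) * e (k - m) = κ * P k := by
    simp only [hP]
    rw [mul_sum]
    exact sum_congr rfl fun m _ => by ring
  have h2 : e (k + 1) = P (k + 1) - κ * P k := by rw [hPs]; ring
  rw [h1, h2]
  simp only [← hk]
  generalize κ * P k = b
  generalize P (k + 1) = a
  have e1 : (conj (a - b) * (a - b + 2 * b)).re = ‖a‖ ^ 2 - ‖b‖ ^ 2 := by
    rw [← Complex.normSq_eq_norm_sq, ← Complex.normSq_eq_norm_sq, Complex.normSq_apply,
      Complex.normSq_apply]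
    simp
    ring
  have e2 : ‖a - b‖ ^ 2 ≤ 2 * ‖a‖ ^ 2 + 2 * ‖b‖ ^ 2 := by
    nlinarith [norm_sub_le a b, norm_nonneg (a - b), sq_nonneg (‖a‖ - ‖b‖)]
  rw [e1]
  nlinarith [mul_le_mul_of_nonneg_left e2 (hσ k)]

/-- The inequality behind the monotonicity of the de Branges functional along a Loewner step. -/
theorem loewner_step_nonpos (N : ℕ) {σ τ : ℕ → ℝ} {e : ℕ → ℂ} (hσ : ∀ k, 0 ≤ σ (k + 1))
    (hst : ∀ k, τ (k + 1) - τ (k + 2) = σ (k + 1) + σ (k + 2)) (hσN : σ (N + 1) = 0)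
    (hτN : τ (N + 1) = 0) (he : e 0 = 1) {u : ℂ → ℂ} {δ : ℝ}
    (hu : DifferentiableOn ℂ u (ball 0 1)) (hre : ∀ z ∈ ball (0 : ℂ) 1, 0 ≤ (u z).re)
    (hu0 : u 0 = δ) :
    ∑ k ∈ range N, (δ * (σ (k + 1) * (‖e (k + 1)‖ ^ 2 - 4)) - 2 * τ (k + 1) *
      (conj (e (k + 1)) * ∑ m ∈ range (k + 2), taylorCoeff u m * e (k + 1 - m)).re) ≤ 0 := by
  set l : ℕ → ℂ := fun m => ∑ k ∈ range N, ((-2 * τ (k + 1) : ℝ) : ℂ) * conj (e (k + 1)) *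
    (if m < k + 2 then e (k + 1 - m) else 0) with hl
  have hre_mul : ∀ (c : ℝ) (a b : ℂ), ((c : ℂ) * a * b).re = c * (a * b).re := fun c a b => by
    rw [mul_assoc, Complex.re_ofReal_mul]
  have hsum : ∀ c : ℕ → ℂ, ∑ m ∈ range (N + 1), c m * l m = ∑ k ∈ range N,
      ((-2 * τ (k + 1) : ℝ) : ℂ) * conj (e (k + 1)) * ∑ m ∈ range (k + 2), c m * e (k + 1 - m) := by
    intro c
    simp only [hl, mul_sum]
    rw [sum_comm]
    refine sum_congr rfl fun k hk => ?_
    rw [← sum_range_ite_le _ (show k + 2 ≤ N + 1 by have := mem_range.1 hk; omega)]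
    refine sum_congr rfl fun m _ => ?_
    split_ifs <;> ring
  have key := nonpos_of_kernel_nonpos N (∑ k ∈ range N, σ (k + 1) * (‖e (k + 1)‖ ^ 2 - 4)) l hu hre
    hu0 (fun κ hκ => by
      have h := loewner_kernel_nonpos N hσ hst hσN hτN he hκ
      have h0 : l 0 + 2 * ∑ m ∈ range N, κ ^ (m + 1) * l (m + 1)
          = ∑ m ∈ range (N + 1), (if m = 0 then 1 else 2 * κ ^ m) * l m := by
        rw [sum_range_succ', mul_sum, add_comm]
        congr 1
        · exact sum_congr rfl fun m _ => by simp; ring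
        · simp
      rw [h0, hsum, Complex.re_sum, ← sum_add_distrib]
      refine le_of_eq_of_le (sum_congr rfl fun k _ => ?_) h
      have : ∑ m ∈ range (k + 2), (if m = 0 then 1 else 2 * κ ^ m) * e (k + 1 - m)
          = e (k + 1) + 2 * ∑ m ∈ range (k + 1), κ ^ (m + 1) * e (k - m) := by
        rw [sum_range_succ', mul_sum, add_comm]
        congr 1
        · simp
        · refine sum_congr rfl fun m _ => ?_
          rw [Nat.add_sub_add_right, if_neg m.succ_ne_zero]
          ring
      rw [this, hre_mul]
      ring)
  rw [hsum, Complex.re_sum, mul_sum, ← sum_add_distrib] at key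
  refine le_of_eq_of_le (sum_congr rfl fun k _ => ?_) key
  rw [hre_mul]
  ring

end Loewner

end Bieberbach

namespace Bieberbach

open Finset Metric Filter Topology ComplexConjugate

section LoewnerStep

/-- The de Branges functional. -/
noncomputable def functional (N : ℕ) (s : ℝ) (G : ℂ → ℂ) : ℝ :=
  ∑ k ∈ range N, (((k : ℝ) + 1) * ‖taylorCoeff G (k + 1)‖ ^ 2 - 4 / (k + 1)) *
    deBranges N (k + 1) s

theorem norm_deriv_le_of_norm_le {f : ℂ → ℂ} {r R C : ℝ} (hf : DifferentiableOn ℂ f (closedBall 0 R))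
    (hC : ∀ z ∈ closedBall (0 : ℂ) R, ‖f z‖ ≤ C) (hrR : r < R) {z : ℂ}
    (hz : z ∈ closedBall (0 : ℂ) r) : ‖deriv f z‖ ≤ C / (R - r) := by
  have hsub : closedBall z (R - r) ⊆ closedBall 0 R :=
    closedBall_subset_closedBall' (by have := mem_closedBall.1 hz; linarith)
  exact Complex.norm_deriv_le_of_forall_mem_sphere_norm_le (sub_pos.2 hrR)
    (hf.mono (closure_ball_subset_closedBall.trans hsub)).diffContOnCl
    fun w hw => hC w (hsub (sphere_subset_closedBall hw))

theorem norm_sub_linearization_le {f : ℂ → ℂ} {C : ℝ} (hf : DifferentiableOn ℂ f (ball 0 1))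
    (hC : ∀ z ∈ closedBall (0 : ℂ) (3 / 4), ‖f z‖ ≤ C) {z w : ℂ}
    (hz : z ∈ closedBall (0 : ℂ) (1 / 2)) (hw : w ∈ closedBall (0 : ℂ) (1 / 2)) :
    ‖f w - f z - (w - z) * deriv f z‖ ≤ 64 * C * ‖w - z‖ ^ 2 := by
  have hC0 : 0 ≤ C := (norm_nonneg _).trans (hC 0 (by simp; norm_num))
  have hdf : ∀ {r : ℝ}, r < 1 → DifferentiableOn ℂ f (closedBall 0 r) := fun hr =>
    hf.mono (closedBall_subset_ball hr)
  have hf' : DifferentiableOn ℂ (deriv f) (ball 0 1) := hf.deriv isOpen_ball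
  have h1 : ∀ z ∈ closedBall (0 : ℂ) (5 / 8), ‖deriv f z‖ ≤ 8 * C := fun z hz => by
    have := norm_deriv_le_of_norm_le (hdf (by norm_num)) hC (by norm_num) hz
    norm_num at this ⊢; linarith
  have h2 : ∀ z ∈ closedBall (0 : ℂ) (1 / 2), ‖deriv (deriv f) z‖ ≤ 64 * C := fun z hz => by
    have := norm_deriv_le_of_norm_le (hf'.mono (closedBall_subset_ball (by norm_num))) h1
      (by norm_num) hz
    norm_num at this ⊢; linarith
  have hmem : ∀ x ∈ closedBall (0 : ℂ) (1 / 2), ball (0 : ℂ) 1 ∈ 𝓝 x := fun x hx =>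
    isOpen_ball.mem_nhds (closedBall_subset_ball (by norm_num) hx)
  have h3 : ∀ x ∈ closedBall (0 : ℂ) (1 / 2), ‖deriv f x - deriv f z‖ ≤ 64 * C * ‖x - z‖ :=
    fun x hx => (convex_closedBall _ _).norm_image_sub_le_of_norm_deriv_le
      (fun y hy => (hf'.differentiableAt (hmem y hy))) h2 hz hx
  have h4 := ((convex_closedBall (0 : ℂ) (1 / 2)).inter
      (convex_closedBall z ‖w - z‖)).norm_image_sub_le_of_norm_hasDerivWithin_le
    (f := fun x => f x - x * deriv f z) (f' := fun x => deriv f x - 1 * deriv f z)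
    (C := 64 * C * ‖w - z‖) (x := z) (y := w)
    (fun x hx => ((hf.differentiableAt (hmem x hx.1)).hasDerivAt.sub
      ((hasDerivAt_id x).mul_const _)).hasDerivWithinAt)
    (fun x hx => by
      rw [one_mul]
      refine (h3 x hx.1).trans ?_
      have := mem_closedBall_iff_norm.1 hx.2
      gcongr)
    ⟨hz, by simp⟩ ⟨hw, by simp [dist_eq_norm]⟩
  calc _ = ‖f w - w * deriv f z - (f z - z * deriv f z)‖ := by congr 1; ring
    _ ≤ _ := h4
    _ = _ := by ring

theorem norm_le_of_re_nonneg {u : ℂ → ℂ} {δ : ℝ} (hu : DifferentiableOn ℂ u (ball 0 1))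
    (hre : ∀ z ∈ ball (0 : ℂ) 1, 0 ≤ (u z).re) (hδ : 0 ≤ δ) (hu0 : u 0 = δ) {z : ℂ}
    (hz : z ∈ closedBall (0 : ℂ) (1 / 2)) : ‖u z‖ ≤ 3 * δ := by
  have hz1 : z ∈ ball (0 : ℂ) 1 := closedBall_subset_ball (by norm_num) hz
  have hz2 : ‖z‖ ≤ 1 / 2 := by simpa using hz
  refine le_of_forall_pos_le_add fun ε hε => ?_
  have h := Complex.borelCaratheodory_zero (f := fun z => δ - u z) (M := δ + ε / 2) (R := 1) (z := z)
    (by positivity) (hu.const_sub _) (fun x hx => by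
      have := hre x hx
      simp only [Set.mem_ofPred_eq, Complex.sub_re, Complex.ofReal_re]; linarith)
    one_pos hz1 (by simp [hu0])
  have h2 : 2 * (δ + ε / 2) * ‖z‖ / (1 - ‖z‖) ≤ 2 * (δ + ε / 2) := by
    rw [div_le_iff₀ (by linarith)]
    gcongr
    linarith
  have h3 := norm_sub_norm_le (u z) δ
  rw [norm_sub_rev, Complex.norm_real, Real.norm_of_nonneg hδ] at h3
  linarith

theorem norm_linearization_remainder_le {G₁ G₂ u : ℂ → ℂ} {M δ : ℝ} (hM : 0 < M)
    (hG₂ : DifferentiableOn ℂ G₂ (ball 0 1)) (hG₂0 : G₂ 0 = 0)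
    (hG₂M : ∀ z ∈ ball (0 : ℂ) 1, (G₂ z).re ≤ M)
    (hu : DifferentiableOn ℂ u (ball 0 1)) (hre : ∀ z ∈ ball (0 : ℂ) 1, 0 ≤ (u z).re)
    (hδ : 0 ≤ δ) (hδ1 : δ ≤ 1 / 3) (hu0 : u 0 = δ)
    (h12 : ∀ z ∈ ball (0 : ℂ) 1, G₁ z = G₂ (z * Complex.exp (-u z)) - u z + δ) {z : ℂ}
    (hz : z ∈ closedBall (0 : ℂ) (1 / 2)) :
    ‖G₁ z - (G₂ z - z * (u z * deriv G₂ z) - u z + δ)‖ ≤ 4000 * M * δ ^ 2 := by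
  have hz1 : z ∈ ball (0 : ℂ) 1 := closedBall_subset_ball (by norm_num) hz
  have hz2 : ‖z‖ ≤ 1 / 2 := by simpa using hz
  have hC : ∀ z ∈ closedBall (0 : ℂ) (3 / 4), ‖G₂ z‖ ≤ 6 * M := by
    intro z hz
    have hz2 : ‖z‖ ≤ 3 / 4 := by simpa using hz
    refine (Complex.borelCaratheodory_zero hM hG₂ hG₂M one_pos
      (closedBall_subset_ball (by norm_num) hz) hG₂0).trans ?_
    rw [div_le_iff₀ (by linarith)]
    nlinarith
  have hun := norm_le_of_re_nonneg hu hre hδ hu0 hz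
  have hu1 : ‖-u z‖ ≤ 1 := by rw [norm_neg]; linarith
  set w := z * Complex.exp (-u z) with hw
  have hwz : ‖w - z‖ ≤ 3 * δ := by
    have : w - z = z * (Complex.exp (-u z) - 1) := by rw [hw]; ring
    rw [this, norm_mul]
    have := Complex.norm_exp_sub_one_le hu1
    rw [norm_neg] at this
    calc ‖z‖ * ‖Complex.exp (-u z) - 1‖ ≤ 1 / 2 * (2 * ‖u z‖) := by gcongr
      _ ≤ _ := by linarith
  have hwm : w ∈ closedBall (0 : ℂ) (1 / 2) := by
    rw [mem_closedBall_zero_iff, hw, norm_mul, Complex.norm_exp, Complex.neg_re]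
    have : Real.exp (-(u z).re) ≤ 1 := Real.exp_le_one_iff.2 (by have := hre z hz1; linarith)
    nlinarith [norm_nonneg z]
  have h1 := norm_sub_linearization_le hG₂ hC hz hwm
  have h2 : ‖(w - z + z * u z) * deriv G₂ z‖ ≤ 9 * δ ^ 2 * (24 * M) := by
    rw [norm_mul]
    have e1 : w - z + z * u z = z * (Complex.exp (-u z) - 1 - -u z) := by rw [hw]; ring
    have e2 := Complex.norm_exp_sub_one_sub_id_le hu1
    rw [norm_neg] at e2
    have e3 : ‖deriv G₂ z‖ ≤ 24 * M := by
      have := norm_deriv_le_of_norm_le (hG₂.mono (closedBall_subset_ball (by norm_num))) hC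
        (by norm_num) hz
      norm_num at this ⊢; linarith
    have e4 : ‖w - z + z * u z‖ ≤ 9 * δ ^ 2 := by
      rw [e1, norm_mul]
      calc ‖z‖ * ‖Complex.exp (-u z) - 1 - -u z‖ ≤ 1 * (3 * δ) ^ 2 := by
            gcongr
            · linarith
            · exact e2.trans (by gcongr)
        _ = _ := by ring
    gcongr
  rw [h12 z hz1]
  have e : G₂ w - u z + δ - (G₂ z - z * (u z * deriv G₂ z) - u z + δ)
      = (G₂ w - G₂ z - (w - z) * deriv G₂ z) + (w - z + z * u z) * deriv G₂ z := by ring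
  rw [e]
  refine (norm_add_le _ _).trans ((add_le_add h1 h2).trans ?_)
  have : ‖w - z‖ ^ 2 ≤ (3 * δ) ^ 2 := by gcongr
  nlinarith [mul_le_mul_of_nonneg_left this hM.le, mul_nonneg hM.le (sq_nonneg δ)]

set_option maxHeartbeats 400000 in
theorem functional_term_le {B n δ t t' w : ℝ} {C D r : ℂ} (hB : 1 ≤ B) (hn : 1 ≤ n) (hnB : n ≤ B)
    (hδ : 0 ≤ δ) (hδ1 : δ ≤ 1) (hC : ‖C‖ ≤ B) (hD : ‖D‖ ≤ B * δ) (hr : ‖r‖ ≤ B * δ ^ 2)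
    (ht : |t| ≤ B) (hw : |w| ≤ B) (htt : |t - t' - δ * (n * w)| ≤ B * δ ^ 2) :
    (n * ‖C - D + r‖ ^ 2 - 4 / n) * t ≤ (n * ‖C‖ ^ 2 - 4 / n) * t'
      + (δ * (w * (‖n * C‖ ^ 2 - 4)) - 2 * t' * (conj (n * C) * D).re) + 20 * B ^ 5 * δ ^ 2 := by
  have hn0 : 0 < n := by linarith
  have hB0 : 0 < B := by linarith
  set ρ := (conj C * D).re with hρ
  set q := ‖C - D + r‖ ^ 2 - ‖C‖ ^ 2 + 2 * ρ with hq
  set p := t - t' - δ * (n * w) with hp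
  have hρb : |ρ| ≤ B ^ 2 * δ := by
    refine (Complex.abs_re_le_norm _).trans ?_
    rw [norm_mul, Complex.norm_conj]
    calc ‖C‖ * ‖D‖ ≤ B * (B * δ) := by gcongr
      _ = _ := by ring
  have hqe : q = ‖D‖ ^ 2 + 2 * (conj (C - D) * r).re + ‖r‖ ^ 2 := by
    rw [hq, hρ]
    simp only [← Complex.normSq_eq_norm_sq, Complex.normSq_apply]
    simp
    ring
  have hδ2 : δ ^ 2 ≤ δ := by nlinarith
  have hqb : |q| ≤ 6 * B ^ 2 * δ ^ 2 := by
    have h1 : ‖D‖ ^ 2 ≤ B ^ 2 * δ ^ 2 := by rw [← mul_pow]; gcongr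
    have h2 : ‖r‖ ^ 2 ≤ B ^ 2 * δ ^ 2 := by
      have : ‖r‖ ≤ B * δ := hr.trans (by gcongr)
      rw [← mul_pow]
      gcongr
    have h3 : |(conj (C - D) * r).re| ≤ 2 * (B ^ 2 * δ ^ 2) := by
      rw [show 2 * (B ^ 2 * δ ^ 2) = (2 * B) * (B * δ ^ 2) by ring]
      refine (Complex.abs_re_le_norm _).trans ?_
      rw [norm_mul, Complex.norm_conj]
      have : ‖C - D‖ ≤ 2 * B := by
        have : B * δ ≤ B := mul_le_of_le_one_right hB0.le hδ1
        linarith [norm_sub_le C D]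
      gcongr
    have h4 := abs_le.1 h3
    rw [hqe, abs_le]
    have := sq_nonneg ‖D‖
    have := sq_nonneg ‖r‖
    have : 0 ≤ B ^ 2 * δ ^ 2 := by positivity
    constructor <;> linarith
  have hnC : ‖(n : ℂ) * C‖ ^ 2 = n ^ 2 * ‖C‖ ^ 2 := by
    rw [norm_mul, Complex.norm_real, mul_pow, Real.norm_of_nonneg hn0.le]
  have hnρ : (conj (n * C) * D).re = n * ρ := by
    rw [map_mul, Complex.conj_ofReal, mul_assoc, Complex.re_ofReal_mul]
  have h1 : ‖C - D + r‖ ^ 2 = ‖C‖ ^ 2 - 2 * ρ + q := by rw [hq]; ring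
  have h2 : t = t' + δ * (n * w) + p := by rw [hp]; ring
  have hB1 : 1 ≤ B ^ 2 := one_le_pow₀ hB
  have b1 : |(n * ‖C‖ ^ 2 - 4 / n) * p| ≤ 5 * B ^ 3 * (B * δ ^ 2) := by
    rw [abs_mul]
    have e1 : |n * ‖C‖ ^ 2 - 4 / n| ≤ 5 * B ^ 3 := by
      have a1 : n * ‖C‖ ^ 2 ≤ B ^ 3 := by
        rw [pow_succ' B 2]
        gcongr
      have a2 : 4 / n ≤ 4 := by rw [div_le_iff₀ hn0]; linarith
      have a3 : 0 < 4 / n := by positivity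
      have a4 : 0 ≤ n * ‖C‖ ^ 2 := by positivity
      have a5 : 1 ≤ B ^ 3 := one_le_pow₀ hB
      rw [abs_le]; constructor <;> linarith
    gcongr
  have b2 : |2 * n * ρ * (δ * (n * w) + p)| ≤ 2 * B * (B ^ 2 * δ) * (δ * (B * B) + B * δ) := by
    rw [abs_mul, abs_mul, abs_of_pos (show 0 < 2 * n by linarith)]
    have e2 : |δ * (n * w) + p| ≤ δ * (B * B) + B * δ := by
      refine (abs_add_le _ _).trans (add_le_add ?_ (htt.trans (by gcongr)))
      rw [abs_mul, abs_mul, abs_of_nonneg hδ, abs_of_pos hn0]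
      gcongr
    gcongr
  have b3 : |n * q * t| ≤ B * (6 * B ^ 2 * δ ^ 2) * B := by
    rw [abs_mul, abs_mul, abs_of_pos hn0]
    gcongr
  have key : (n * ‖C - D + r‖ ^ 2 - 4 / n) * t = (n * ‖C‖ ^ 2 - 4 / n) * t'
      + (δ * (w * (‖n * C‖ ^ 2 - 4)) - 2 * t' * (conj (n * C) * D).re)
      + ((n * ‖C‖ ^ 2 - 4 / n) * p - 2 * n * ρ * (δ * (n * w) + p) + n * q * t) := by
    rw [hnC, hnρ, h1]
    have : (n * (‖C‖ ^ 2 - 2 * ρ + q) - 4 / n) * t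
        = (n * ‖C‖ ^ 2 - 4 / n) * t - 2 * n * ρ * t + n * q * t := by ring
    rw [this]
    nth_rw 1 2 [h2]
    field_simp
    ring
  rw [key]
  have c1 := (le_abs_self _).trans b1
  have c2 := (neg_le_abs _).trans b2
  have c3 := (le_abs_self _).trans b3
  have d1 : B ^ 4 * δ ^ 2 ≤ B ^ 5 * δ ^ 2 := by
    have : B ^ 4 ≤ B ^ 5 := pow_le_pow_right₀ hB (by norm_num)
    gcongr
  have f1 : 5 * B ^ 3 * (B * δ ^ 2) = 5 * (B ^ 4 * δ ^ 2) := by ring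
  have f2 : 2 * B * (B ^ 2 * δ) * (δ * (B * B) + B * δ)
      = 2 * (B ^ 5 * δ ^ 2) + 2 * (B ^ 4 * δ ^ 2) := by ring
  have f3 : B * (6 * B ^ 2 * δ ^ 2) * B = 6 * (B ^ 4 * δ ^ 2) := by ring
  have f4 : 0 ≤ B ^ 5 * δ ^ 2 := by positivity
  linarith

end LoewnerStep

end Bieberbach

namespace Bieberbach

open Finset Metric Filter Topology ComplexConjugate

section LoewnerMonotone

theorem exists_abs_le_of_continuous (N : ℕ) {p : ℕ → ℝ → ℝ} (hp : ∀ k, Continuous (p k)) :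
    ∃ B : ℝ, 0 ≤ B ∧ ∀ k < N, ∀ s : ℝ, 0 ≤ s → s ≤ 1 → |p k s| ≤ B := by
  have h : ∀ k, ∃ B : ℝ, ∀ s ∈ Set.Icc (0 : ℝ) 1, ‖p k s‖ ≤ B := fun k =>
    isCompact_Icc.exists_bound_of_continuousOn (hp k).continuousOn
  choose B hB using h
  have hB0 : ∀ k, 0 ≤ B k := fun k => (norm_nonneg _).trans (hB k 0 (by simp))
  refine ⟨∑ k ∈ range N, B k, sum_nonneg fun k _ => hB0 k, fun k hk s h0 h1 => ?_⟩
  exact (hB k s ⟨h0, h1⟩).trans (single_le_sum (fun k _ => hB0 k) (mem_range.2 hk))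

theorem continuous_weight (N k : ℕ) : Continuous (weight N k) := by
  unfold weight; fun_prop

theorem continuous_deBranges (N k : ℕ) : Continuous (deBranges N k) := by
  unfold deBranges; fun_prop

theorem functional_zero_le (N : ℕ) {s : ℝ} (h0 : 0 < s) (h1 : s ≤ 1) {G : ℂ → ℂ}
    (hG : ∀ k, taylorCoeff G (k + 1) = 0) : functional N s G ≤ 0 := by
  refine sum_nonpos fun k _ => ?_
  rw [hG]
  have := deBranges_nonneg N (Nat.le_add_left 1 k) h0 h1
  have h2 : (0 : ℝ) < 4 / (k + 1) := by positivity
  simp only [norm_zero]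
  nlinarith

theorem functional_one (N : ℕ) (G : ℂ → ℂ) :
    functional N 1 G = ∑ k ∈ range N, ((N : ℝ) - k) * (((k : ℝ) + 1) * ‖taylorCoeff G (k + 1)‖ ^ 2
      - 4 / (k + 1)) := by
  refine sum_congr rfl fun k hk => ?_
  rw [deBranges_one N (by omega) (by have := mem_range.1 hk; omega)]
  push_cast
  ring

theorem functional_le_of_step (N : ℕ) {M : ℝ} (hM : 0 < M) :
    ∃ K : ℝ, 0 ≤ K ∧ ∀ (G₁ G₂ u : ℂ → ℂ) (δ s : ℝ), DifferentiableOn ℂ G₁ (ball 0 1) →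
      DifferentiableOn ℂ G₂ (ball 0 1) → G₂ 0 = 0 → (∀ z ∈ ball (0 : ℂ) 1, (G₂ z).re ≤ M) →
      DifferentiableOn ℂ u (ball 0 1) → (∀ z ∈ ball (0 : ℂ) 1, 0 ≤ (u z).re) →
      0 ≤ δ → δ ≤ 1 / 3 → u 0 = δ →
      (∀ z ∈ ball (0 : ℂ) 1, G₁ z = G₂ (z * Complex.exp (-u z)) - u z + δ) → 0 < s → s ≤ 1 →
      functional N s G₁ ≤ functional N (s * Real.exp (-δ)) G₂ + K * δ ^ 2 := by
  obtain ⟨T, hT0, hT⟩ := exists_abs_le_of_continuous N fun k => continuous_deBranges N (k + 1)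
  obtain ⟨W, hW0, hW⟩ := exists_abs_le_of_continuous N fun k => continuous_weight N (k + 1)
  obtain ⟨L, hL0, hL⟩ := exists_deBranges_expansion N
  set B : ℝ := 1 + N + 4000 * (M + 1) * 2 ^ N + T + W + L with hB
  have hN0 : (0 : ℝ) ≤ N := N.cast_nonneg
  have hP0 : 0 < 4000 * (M + 1) * 2 ^ N := by positivity
  have hB1 : 1 ≤ B := by linarith
  refine ⟨N * (20 * B ^ 5), by positivity, ?_⟩
  intro G₁ G₂ u δ s hG₁ hG₂ hG₂0 hG₂M hu hre hδ hδ1 hu0 h12 hs0 hs1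
  have hE1 : Real.exp (-δ) ≤ 1 := Real.exp_le_one_iff.2 (by linarith)
  set s' := s * Real.exp (-δ) with hs'
  have hs'0 : 0 < s' := mul_pos hs0 (Real.exp_pos _)
  have hs'1 : s' ≤ 1 := by nlinarith [Real.exp_pos (-δ)]
  have hn0 : ball (0 : ℂ) 1 ∈ 𝓝 0 := ball_mem_nhds _ one_pos
  have hG₂' : DifferentiableOn ℂ (deriv G₂) (ball 0 1) := hG₂.deriv isOpen_ball
  set H : ℂ → ℂ := fun z => z * (u z * deriv G₂ z) + u z with hH
  set R : ℂ → ℂ := fun z => G₁ z - ((G₂ z - H z) + δ) with hR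
  have hid : DifferentiableOn ℂ (fun z : ℂ => z) (ball 0 1) := differentiableOn_id
  have hHd : DifferentiableOn ℂ H (ball 0 1) := (hid.mul (hu.mul hG₂')).add hu
  have hRd : DifferentiableOn ℂ R (ball 0 1) := hG₁.sub ((hG₂.sub hHd).add_const _)
  have hsub : closedBall (0 : ℂ) (1 / 2) ⊆ ball 0 1 := closedBall_subset_ball (by norm_num)
  have hcoef : ∀ {f : ℂ → ℂ} {c : ℝ}, DifferentiableOn ℂ f (ball 0 1) →
      (∀ z ∈ closedBall (0 : ℂ) (1 / 2), ‖f z‖ ≤ c) → 0 ≤ c → ∀ k < N,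
      ‖taylorCoeff f (k + 1)‖ ≤ c * 2 ^ N := by
    intro f c hf hfc hc k hk
    refine (norm_taylorCoeff_le (by norm_num : (0 : ℝ) < 1 / 2) (hf.mono hsub)
      (fun z hz => hfc z (sphere_subset_closedBall hz)) (k + 1)).trans ?_
    rw [one_div, inv_pow, div_inv_eq_mul]
    gcongr
    · norm_num
    · omega
  have hC34 : ∀ z ∈ closedBall (0 : ℂ) (3 / 4), ‖G₂ z‖ ≤ 6 * M := by
    intro z hz
    have hz2 : ‖z‖ ≤ 3 / 4 := by simpa using hz
    refine (Complex.borelCaratheodory_zero hM hG₂ hG₂M one_pos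
      (closedBall_subset_ball (by norm_num) hz) hG₂0).trans ?_
    rw [div_le_iff₀ (by linarith)]
    nlinarith
  have hCb := hcoef hG₂ (fun z hz => hC34 z (closedBall_subset_closedBall (by norm_num) hz))
    (by positivity)
  have hHb := hcoef hHd (c := (36 * M + 3) * δ) (fun z hz => by
    have hz2 : ‖z‖ ≤ 1 / 2 := by simpa using hz
    have hun := norm_le_of_re_nonneg hu hre hδ hu0 hz
    have hd : ‖deriv G₂ z‖ ≤ 24 * M := by
      have := norm_deriv_le_of_norm_le (hG₂.mono (closedBall_subset_ball (by norm_num))) hC34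
        (by norm_num) hz
      norm_num at this ⊢; linarith
    refine (norm_add_le _ _).trans ?_
    rw [norm_mul, norm_mul]
    calc ‖z‖ * (‖u z‖ * ‖deriv G₂ z‖) + ‖u z‖ ≤ 1 / 2 * ((3 * δ) * (24 * M)) + 3 * δ := by gcongr
      _ = _ := by ring) (by positivity)
  have hRb := hcoef hRd (c := 4000 * M * δ ^ 2) (fun z hz => by
    have := norm_linearization_remainder_le hM hG₂ hG₂0 hG₂M hu hre hδ hδ1 hu0 h12 hz
    rwa [sub_sub] at this) (by positivity)
  have aG₁ := hG₁.analyticAt hn0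
  have aG₂ := hG₂.analyticAt hn0
  have aG₂' := hG₂'.analyticAt hn0
  have au := hu.analyticAt hn0
  have aH := hHd.analyticAt hn0
  have hdec : ∀ k, taylorCoeff G₁ (k + 1)
      = taylorCoeff G₂ (k + 1) - taylorCoeff H (k + 1) + taylorCoeff R (k + 1) := by
    intro k
    have h1 := taylorCoeff_sub aG₁ ((aG₂.fun_sub aH).fun_add analyticAt_const (g := fun _ => (δ : ℂ))) (k + 1)
    have h2 := taylorCoeff_add (aG₂.fun_sub aH) (g := fun _ => (δ : ℂ)) analyticAt_const (k + 1)
    rw [h2, taylorCoeff_sub aG₂ aH, taylorCoeff_const, if_neg k.succ_ne_zero] at h1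
    rw [hR, h1]
    ring
  set e : ℕ → ℂ := fun j => if j = 0 then 1 else j * taylorCoeff G₂ j with he
  have hHe : ∀ k, taylorCoeff H (k + 1)
      = ∑ m ∈ range (k + 2), taylorCoeff u m * e (k + 1 - m) := by
    intro k
    have aug : AnalyticAt ℂ (fun z => u z * deriv G₂ z) 0 := au.fun_mul aG₂'
    have azug : AnalyticAt ℂ (fun z : ℂ => z * (u z * deriv G₂ z)) 0 := analyticAt_id.fun_mul aug
    have h1 : taylorCoeff H (k + 1) = taylorCoeff (fun z => u z * deriv G₂ z) k
        + taylorCoeff u (k + 1) := by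
      rw [hH, taylorCoeff_add azug au, taylorCoeff_id_mul aug]
    rw [h1, taylorCoeff_mul au aG₂', sum_range_succ _ (k + 1)]
    congr 1
    · refine sum_congr rfl fun j hj => ?_
      have hj := mem_range.1 hj
      rw [taylorCoeff_deriv, he]
      have : k + 1 - j = k - j + 1 := by omega
      simp only [this, Nat.succ_ne_zero, if_false]
      push_cast
      rfl
    · simp [he]
  have hstep := loewner_step_nonpos N (σ := fun k => weight N k s') (τ := fun k => deBranges N k s')
    (e := e) (fun k => weight_nonneg N (k + 1) hs'0 hs'1)
    (fun k => deBranges_sub N (Nat.le_add_left 1 k) s') (weight_eq_zero N.lt_succ_self s')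
    (deBranges_eq_zero N.lt_succ_self s') (by simp [he]) hu hre hu0
  have hterm : ∀ k ∈ range N, (((k : ℝ) + 1) * ‖taylorCoeff G₁ (k + 1)‖ ^ 2 - 4 / (k + 1)) *
      deBranges N (k + 1) s ≤ (((k : ℝ) + 1) * ‖taylorCoeff G₂ (k + 1)‖ ^ 2 - 4 / (k + 1)) *
      deBranges N (k + 1) s' + (δ * (weight N (k + 1) s' * (‖e (k + 1)‖ ^ 2 - 4))
        - 2 * deBranges N (k + 1) s' *
      (conj (e (k + 1)) * ∑ m ∈ range (k + 2), taylorCoeff u m * e (k + 1 - m)).re)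
        + 20 * B ^ 5 * δ ^ 2 := by
    intro k hk
    have hk := mem_range.1 hk
    have hkN : (k : ℝ) + 1 ≤ N := by exact_mod_cast hk
    have h2N : (0 : ℝ) < 2 ^ N := by positivity
    have hek : e (k + 1) = (((k : ℝ) + 1 : ℝ) : ℂ) * taylorCoeff G₂ (k + 1) := by
      simp [he]
    rw [← hHe, hdec, hek]
    refine functional_term_le hB1 (by linarith [k.cast_nonneg (α := ℝ)]) (by linarith) hδ (by linarith) ?_ ?_ ?_ ?_ ?_ ?_
    · refine (hCb k hk).trans ?_
      nlinarith
    · refine (hHb k hk).trans ?_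
      have : (36 * M + 3) * 2 ^ N ≤ B := by nlinarith
      nlinarith
    · refine (hRb k hk).trans ?_
      have : 4000 * M * 2 ^ N ≤ B := by nlinarith
      nlinarith [sq_nonneg δ]
    · exact (hT k hk s hs0.le hs1).trans (by linarith)
    · exact (hW k hk s' hs'0.le hs'1).trans (by linarith)
    · have := hL (k + 1) (by omega) hk s δ hs0.le hs1 hδ
      push_cast at this
      refine this.trans ?_
      have : L ≤ B := by linarith
      gcongr
  have := sum_le_sum hterm
  rw [sum_add_distrib, sum_add_distrib, sum_const, card_range, nsmul_eq_mul] at this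
  unfold functional
  linarith

end LoewnerMonotone

end Bieberbach

namespace Bieberbach

open Metric Filter Topology Set Function

section Univalent

variable {f : ℂ → ℂ} {U : Set ℂ}

theorem nhds_le_map_of_injOn (hU : IsOpen U) (hf : DifferentiableOn ℂ f U) (hi : InjOn f U) {z : ℂ}
    (hz : z ∈ U) : 𝓝 (f z) ≤ map f (𝓝 z) := by
  refine ((hf.analyticAt (hU.mem_nhds hz)).eventually_constant_or_nhds_le_map_nhds).resolve_left ?_
  intro h
  have h1 : ∀ᶠ w in 𝓝 z, w = z := by
    filter_upwards [h, hU.mem_nhds hz] with w hw hwU using hi hwU hz hw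
  have h2 : ∀ᶠ w in 𝓝[≠] z, False := by
    filter_upwards [h1.filter_mono nhdsWithin_le_nhds, self_mem_nhdsWithin] with w hw hw'
      using hw' hw
  exact h2.exists.elim fun _ => id

theorem isOpen_image_of_injOn (hU : IsOpen U) (hf : DifferentiableOn ℂ f U) (hi : InjOn f U) :
    IsOpen (f '' U) := by
  rw [isOpen_iff_mem_nhds]
  rintro _ ⟨z, hz, rfl⟩
  exact nhds_le_map_of_injOn hU hf hi hz (image_mem_map (hU.mem_nhds hz))

theorem continuousAt_invFunOn (hU : IsOpen U) (hf : DifferentiableOn ℂ f U) (hi : InjOn f U) {z : ℂ}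
    (hz : z ∈ U) : ContinuousAt (invFunOn f U) (f z) := by
  intro V hV
  rw [hi.leftInvOn_invFunOn hz] at hV
  have h := nhds_le_map_of_injOn hU hf hi hz (image_mem_map (inter_mem hV (hU.mem_nhds hz)))
  rw [mem_map]
  refine mem_of_superset h ?_
  rintro _ ⟨w, ⟨hwV, hwU⟩, rfl⟩
  rw [mem_preimage, hi.leftInvOn_invFunOn hwU]
  exact hwV

theorem differentiableAt_invFunOn_of_deriv_ne_zero (hU : IsOpen U) (hf : DifferentiableOn ℂ f U)
    (hi : InjOn f U) {z : ℂ} (hz : z ∈ U) (hd : deriv f z ≠ 0) :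
    DifferentiableAt ℂ (invFunOn f U) (f z) := by
  have h1 : HasDerivAt f (deriv f z) (invFunOn f U (f z)) := by
    rw [hi.leftInvOn_invFunOn hz]
    exact (hf.differentiableAt (hU.mem_nhds hz)).hasDerivAt
  refine (h1.of_local_left_inverse (continuousAt_invFunOn hU hf hi hz) hd ?_).differentiableAt
  filter_upwards [(isOpen_image_of_injOn hU hf hi).mem_nhds (mem_image_of_mem f hz)] with w hw
    using invFunOn_eq hw

theorem differentiableOn_invFunOn (hU : IsOpen U) (hf : DifferentiableOn ℂ f U)
    (hi : InjOn f U) : DifferentiableOn ℂ (invFunOn f U) (f '' U) := by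
  rintro _ ⟨z, hz, rfl⟩
  refine DifferentiableAt.differentiableWithinAt ?_
  have hd : ∀ᶠ w in 𝓝[≠] z, deriv f w ≠ 0 := by
    refine ((hf.analyticAt (hU.mem_nhds hz)).deriv.eventually_eq_zero_or_eventually_ne_zero).resolve_left
      fun h => ?_
    obtain ⟨r, hr, hrb⟩ := Metric.eventually_nhds_iff_ball.1 (h.and (hU.mem_nhds hz))
    have hc : ∀ w ∈ ball z r, f w = f z := fun w hw =>
      (convex_ball z r).is_const_of_fderivWithin_eq_zero (𝕜 := ℂ)
        (hf.mono fun x hx => (hrb x hx).2) (fun x hx => by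
          rw [fderivWithin_of_isOpen isOpen_ball hx]
          ext
          simp [(hrb x hx).1]) hw (mem_ball_self hr)
    have h1 : z + (r / 2 : ℝ) ∈ ball z r := by
      simp [abs_of_pos hr, hr]
    have h2 := hi (hrb _ h1).2 hz (hc _ h1)
    have h3 : ((r / 2 : ℝ) : ℂ) = 0 := by simpa using h2
    have : r / 2 = 0 := by exact_mod_cast h3
    linarith
  have hc := continuousAt_invFunOn hU hf hi hz
  have ht : Tendsto (invFunOn f U) (𝓝[≠] (f z)) (𝓝[≠] z) := by
    refine tendsto_nhdsWithin_iff.2 ⟨?_, ?_⟩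
    · have := hc.tendsto
      rw [hi.leftInvOn_invFunOn hz] at this
      exact this.mono_left nhdsWithin_le_nhds
    · have ho := (isOpen_image_of_injOn hU hf hi).mem_nhds (mem_image_of_mem f hz)
      filter_upwards [nhdsWithin_le_nhds ho, self_mem_nhdsWithin] with w hw hw' h
      apply hw'
      rw [mem_singleton_iff, ← invFunOn_eq hw, h]
  have hev : ∀ᶠ w in 𝓝[≠] (f z), DifferentiableAt ℂ (invFunOn f U) w := by
    have ho := (isOpen_image_of_injOn hU hf hi).mem_nhds (mem_image_of_mem f hz)
    filter_upwards [ht.eventually hd, nhdsWithin_le_nhds ho] with w hw hw'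
    have := differentiableAt_invFunOn_of_deriv_ne_zero hU hf hi (invFunOn_mem hw') hw
    rwa [invFunOn_eq hw'] at this
  exact (Complex.analyticAt_of_differentiable_on_punctured_nhds_of_continuousAt hev hc).differentiableAt

theorem deriv_ne_zero_of_injOn (hU : IsOpen U) (hf : DifferentiableOn ℂ f U) (hi : InjOn f U) {z : ℂ}
    (hz : z ∈ U) : deriv f z ≠ 0 := by
  have h1 := ((differentiableOn_invFunOn hU hf hi).differentiableAt
    ((isOpen_image_of_injOn hU hf hi).mem_nhds (mem_image_of_mem f hz))).hasDerivAt
  have h2 := h1.comp z (hf.differentiableAt (hU.mem_nhds hz)).hasDerivAt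
  have h3 : HasDerivAt (invFunOn f U ∘ f) 1 z := by
    refine (hasDerivAt_id z).congr_of_eventuallyEq ?_
    filter_upwards [hU.mem_nhds hz] with w hw using hi.leftInvOn_invFunOn hw
  have := h2.unique h3
  intro h0
  simp [h0] at this

end Univalent

section Montel

variable {ι : Type*} {F : ι → ℂ → ℂ} {U : Set ℂ}

theorem exists_tendstoLocallyUniformlyOn (l : Ultrafilter ι) (hU : IsOpen U)
    (hF : ∀ i, DifferentiableOn ℂ (F i) U) {C : ℝ} (hC : ∀ i, ∀ z ∈ U, ‖F i z‖ ≤ C) :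
    ∃ g : ℂ → ℂ, TendstoLocallyUniformlyOn F g l U := by
  have hlim : ∀ z ∈ U, ∃ w, Tendsto (fun i => F i z) l (𝓝 w) := by
    intro z hz
    have h1 : (l.map fun i => F i z : Ultrafilter ℂ) ≤ 𝓟 (closedBall (0 : ℂ) C) := by
      rw [le_principal_iff, Ultrafilter.mem_coe, Ultrafilter.mem_map]
      exact Eventually.of_forall fun i => by simpa using hC i z hz
    obtain ⟨w, -, hw⟩ := (isCompact_closedBall (0 : ℂ) C).ultrafilter_le_nhds _ h1
    exact ⟨w, hw⟩
  choose! g hg using hlim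
  refine ⟨g, tendstoLocallyUniformlyOn_of_forall_exists_nhds fun z₀ hz₀ => ?_⟩
  obtain ⟨r, hr, hrU⟩ := Metric.isOpen_iff.1 hU z₀ hz₀
  have hsub : closedBall z₀ (r / 4) ⊆ U := (closedBall_subset_ball (by linarith)).trans hrU
  refine ⟨closedBall z₀ (r / 4), nhdsWithin_le_nhds (closedBall_mem_nhds z₀ (by positivity)), ?_⟩
  have hC0 : 0 ≤ C := by
    obtain ⟨i⟩ := l.nonempty_of_neBot
    exact (norm_nonneg _).trans (hC i z₀ hz₀)
  set L := C / (r / 4) with hL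
  have hL0 : 0 ≤ L := by positivity
  have hlip : ∀ i, ∀ x ∈ closedBall z₀ (r / 4), ∀ y ∈ closedBall z₀ (r / 4),
      ‖F i x - F i y‖ ≤ L * ‖x - y‖ := by
    intro i x hx y hy
    refine (convex_closedBall z₀ (r / 4)).norm_image_sub_le_of_norm_deriv_le (𝕜 := ℂ)
      (fun w hw => (hF i).differentiableAt (hU.mem_nhds (hsub hw))) (fun w hw => ?_) hy hx
    have hs : closedBall w (r / 4) ⊆ U := by
      refine (closedBall_subset_ball' ?_).trans hrU
      have := mem_closedBall.1 hw
      linarith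
    exact Complex.norm_deriv_le_of_forall_mem_sphere_norm_le (by positivity)
      ((hF i).mono (closure_ball_subset_closedBall.trans hs)).diffContOnCl
      fun v hv => hC i v (hs (sphere_subset_closedBall hv))
  have hlipg : ∀ x ∈ closedBall z₀ (r / 4), ∀ y ∈ closedBall z₀ (r / 4),
      ‖g x - g y‖ ≤ L * ‖x - y‖ := fun x hx y hy =>
    le_of_tendsto (((hg x (hsub hx)).sub (hg y (hsub hy))).norm)
      (Eventually.of_forall fun i => hlip i x hx y hy)
  rw [Metric.tendstoUniformlyOn_iff]
  intro ε hε
  set η := ε / (4 * (L + 1)) with hη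
  have hη0 : 0 < η := by positivity
  obtain ⟨t, ht, htf, htc⟩ := (isCompact_closedBall z₀ (r / 4)).finite_cover_balls hη0
  have hev : ∀ᶠ i in (l : Filter ι), ∀ p ∈ t, dist (F i p) (g p) < ε / 4 :=
    (eventually_all_finite htf).2 fun p hp =>
      (Metric.tendsto_nhds.1 (hg p (hsub (ht hp)))) _ (by positivity)
  filter_upwards [hev] with i hi x hx
  obtain ⟨p, hp, hxp⟩ := mem_iUnion₂.1 (htc hx)
  have h1 := hlip i x hx p (ht hp)
  have h2 := hlipg x hx p (ht hp)
  have h3 := hi p hp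
  have h4 : ‖x - p‖ < η := by simpa [dist_eq_norm] using hxp
  have h5 : L * ‖x - p‖ ≤ ε / 4 := by
    have : L * ‖x - p‖ ≤ (L + 1) * η := by gcongr; linarith
    have e : (L + 1) * η = ε / 4 := by rw [hη]; field_simp
    linarith
  rw [dist_eq_norm] at h3 ⊢
  have e : g x - F i x = (g x - g p) - (F i x - F i p) - (F i p - g p) := by ring
  rw [e]
  have := norm_sub_le ((g x - g p) - (F i x - F i p)) (F i p - g p)
  have := norm_sub_le (g x - g p) (F i x - F i p)
  linarith

end Montel

end Bieberbach

namespace Bieberbach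

open Metric Filter Topology Set Function

section Hurwitz

variable {ι : Type*} {F : ι → ℂ → ℂ} {g : ℂ → ℂ} {U : Set ℂ} {l : Filter ι}

theorem eventually_mem_image_of_tendsto (hU : IsOpen U) (hF : ∀ i, DifferentiableOn ℂ (F i) U)
    (hi : ∀ i, InjOn (F i) U) (h : TendstoLocallyUniformlyOn F g l U) [l.NeBot] {z : ℂ} (hz : z ∈ U)
    (hg : ∀ᶠ w in 𝓝[≠] z, g w ≠ g z) {V : Set ℂ} (hV : V ∈ 𝓝 z) :
    ∀ᶠ i in l, g z ∈ F i '' (V ∩ U) := by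
  have hgd : DifferentiableOn ℂ g U := h.differentiableOn (Eventually.of_forall hF) hU
  rw [eventually_nhdsWithin_iff] at hg
  obtain ⟨R, hR, hRb⟩ := Metric.eventually_nhds_iff_ball.1
    (hg.and (Filter.inter_mem hV (hU.mem_nhds hz)))
  set r := R / 2 with hr
  have hr0 : 0 < r := by positivity
  have hsub : closedBall z r ⊆ ball z R := closedBall_subset_ball (by linarith)
  have hsU : closedBall z r ⊆ U := fun w hw => (hRb w (hsub hw)).2.2
  obtain ⟨x, hx, hmin⟩ := (isCompact_sphere z r).exists_isMinOn (NormedSpace.sphere_nonempty.2 hr0.le)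
    (f := fun w => ‖g w - g z‖)
    ((hgd.continuousOn.mono (sphere_subset_closedBall.trans hsU)).sub continuousOn_const).norm
  set m := ‖g x - g z‖ with hm
  have hm0 : 0 < m := by
    rw [hm, norm_sub_pos_iff]
    refine (hRb x (hsub (sphere_subset_closedBall hx))).1 ?_
    rintro rfl
    simp at hx
    exact hr0.ne hx
  have hu := (tendstoLocallyUniformlyOn_iff_forall_isCompact hU).1 h _ hsU (isCompact_closedBall z r)
  rw [Metric.tendstoUniformlyOn_iff] at hu
  filter_upwards [hu (m / 8) (by positivity)] with i hiu
  have hzz : z ∈ closedBall z r := mem_closedBall_self hr0.le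
  have h1 : ∀ w ∈ sphere z r, m / 2 ≤ ‖F i w - F i z‖ := by
    intro w hw
    have a1 := hiu w (sphere_subset_closedBall hw)
    have a2 := hiu z hzz
    have a3 : m ≤ ‖g w - g z‖ := hmin hw
    rw [dist_eq_norm] at a1 a2
    have e : g w - g z = (g w - F i w) + (F i w - F i z) - (g z - F i z) := by ring
    rw [e] at a3
    have := norm_sub_le ((g w - F i w) + (F i w - F i z)) (g z - F i z)
    have := norm_add_le (g w - F i w) (F i w - F i z)
    linarith
  have h2 : ∃ᶠ w in 𝓝 z, F i w ≠ F i z := by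
    intro hc
    have hn := nhds_le_map_of_injOn hU (hF i) (hi i) hz
    have h3 : ∀ᶠ w in map (F i) (𝓝 z), w = F i z := by
      rw [eventually_map]
      filter_upwards [hc] with w hw using not_not.1 hw
    have h4 : ∀ᶠ w in 𝓝[≠] (F i z), False := by
      filter_upwards [nhdsWithin_le_nhds (hn h3), self_mem_nhdsWithin] with w hw hw' using hw' hw
    exact h4.exists.elim fun _ => id
  have h3 := (((hF i).mono (closure_ball_subset_closedBall.trans
    hsU)).diffContOnCl).ball_subset_image_closedBall hr0 h1 h2
  have h4 : g z ∈ ball (F i z) (m / 2 / 2) := by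
    have := hiu z hzz
    rw [mem_ball]
    linarith
  obtain ⟨w, hw, hwe⟩ := h3 h4
  exact ⟨w, (hRb w (hsub hw)).2, hwe⟩

theorem eventually_ne_of_deriv_ne_zero (hU : IsOpen U) (hUc : IsPreconnected U)
    (hg : DifferentiableOn ℂ g U) {p : ℂ} (hp : p ∈ U) (hd : deriv g p ≠ 0) {z : ℂ} (hz : z ∈ U) :
    ∀ᶠ w in 𝓝[≠] z, g w ≠ g z := by
  have ha : AnalyticOnNhd ℂ g U := hg.analyticOnNhd hU
  refine ((ha z hz).eventually_eq_or_eventually_ne analyticAt_const).resolve_left fun hc => hd ?_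
  have h1 := ha.eqOn_of_preconnected_of_eventuallyEq (analyticOnNhd_const (v := g z)) hUc hz hc
  have h2 : g =ᶠ[𝓝 p] fun _ => g z := by
    filter_upwards [hU.mem_nhds hp] with w hw using h1 hw
  rw [h2.deriv_eq, deriv_const]

theorem injOn_of_tendstoLocallyUniformlyOn (hU : IsOpen U) (hF : ∀ i, DifferentiableOn ℂ (F i) U)
    (hi : ∀ i, InjOn (F i) U) (h : TendstoLocallyUniformlyOn F g l U) [l.NeBot]
    (hg : ∀ z ∈ U, ∀ᶠ w in 𝓝[≠] z, g w ≠ g z) : InjOn g U := by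
  intro z hz w hw hzw
  by_contra hne
  obtain ⟨V, W, hV, hW, hzV, hwW, hVW⟩ := t2_separation hne
  obtain ⟨i, ⟨x, hx, hxe⟩, ⟨y, hy, hye⟩⟩ :=
    ((eventually_mem_image_of_tendsto hU hF hi h hz (hg z hz) (hV.mem_nhds hzV)).and
      (eventually_mem_image_of_tendsto hU hF hi h hw (hg w hw) (hW.mem_nhds hwW))).exists
  have : x = y := hi i hx.2 hy.2 (by rw [hxe, hye, hzw])
  subst this
  exact Set.disjoint_left.1 hVW hx.1 hy.1

end Hurwitz

section RiemannMapping

/-- The class of normalized injective holomorphic maps from `U` to the unit disk. -/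
def discMaps (U : Set ℂ) : Set (ℂ → ℂ) :=
  {g | DifferentiableOn ℂ g U ∧ InjOn g U ∧ MapsTo g U (ball 0 1) ∧ g 0 = 0}

variable {U : Set ℂ}

theorem norm_deriv_le_of_mem_discMaps {r : ℝ} (hr : 0 < r) (hrU : ball 0 r ⊆ U) {g : ℂ → ℂ}
    (hg : g ∈ discMaps U) : ‖deriv g 0‖ ≤ 1 / r := by
  obtain ⟨h1, -, h3, h4⟩ := hg
  refine Complex.norm_deriv_le_div_of_mapsTo_ball (h1.mono hrU) (fun z hz => ?_) hr
  rw [h4]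
  exact ball_subset_closedBall (h3 (hrU hz))

theorem exists_discMap_max (hU : IsOpen U) (hUc : IsPreconnected U) (h0 : (0 : ℂ) ∈ U) {R : ℝ}
    (hR : U ⊆ ball 0 R) : ∃ g ∈ discMaps U, deriv g 0 ≠ 0 ∧
      ∀ h ∈ discMaps U, ‖deriv h 0‖ ≤ ‖deriv g 0‖ := by
  obtain ⟨r, hr, hrU⟩ := Metric.isOpen_iff.1 hU 0 h0
  have hR0 : 0 < R := by simpa using hR h0
  set S : Set ℝ := (fun g : ℂ → ℂ => ‖deriv g 0‖) '' discMaps U with hS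
  have hbdd : BddAbove S := ⟨1 / r, by
    rintro _ ⟨g, hg, rfl⟩
    exact norm_deriv_le_of_mem_discMaps hr hrU hg⟩
  have hR0' : (R : ℂ) ≠ 0 := by exact_mod_cast hR0.ne'
  have hlin : (fun z : ℂ => z / R) ∈ discMaps U := by
    refine ⟨by fun_prop, fun z _ w _ h => (div_left_inj' hR0').1 h, fun z hz => ?_, by simp⟩
    have := hR hz
    rw [mem_ball_zero_iff] at this ⊢
    rwa [norm_div, Complex.norm_real, Real.norm_of_nonneg hR0.le, div_lt_one hR0]
  have hpos : 0 < sSup S := by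
    refine lt_of_lt_of_le ?_ (le_csSup hbdd ⟨_, hlin, rfl⟩)
    simp [hR0.ne']
  obtain ⟨v, -, hv, hvS⟩ := exists_seq_tendsto_sSup (S := S) ⟨_, ⟨_, hlin, rfl⟩⟩ hbdd
  choose F hF hFv using hvS
  have hFd : ∀ i, DifferentiableOn ℂ (F i) U := fun i => (hF i).1
  obtain ⟨g, hg⟩ := exists_tendstoLocallyUniformlyOn (hyperfilter ℕ) hU hFd (C := 1)
    fun i z hz => by have := (hF i).2.2.1 hz; rw [mem_ball_zero_iff] at this; exact this.le
  have hgd : DifferentiableOn ℂ g U := hg.differentiableOn (Eventually.of_forall hFd) hU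
  have hle : (hyperfilter ℕ : Filter ℕ) ≤ atTop := by
    rw [← Nat.cofinite_eq_atTop]; exact hyperfilter_le_cofinite
  have hder : ‖deriv g 0‖ = sSup S := by
    have h1 := ((hg.deriv (Eventually.of_forall hFd) hU).tendsto_at h0).norm
    have h2 : Tendsto (fun i => ‖(deriv ∘ F) i 0‖) (hyperfilter ℕ : Filter ℕ) (𝓝 (sSup S)) := by
      refine (hv.mono_left hle).congr fun i => ?_
      exact (hFv i).symm
    exact tendsto_nhds_unique h1 h2
  have hd0 : deriv g 0 ≠ 0 := by
    rw [← norm_pos_iff, hder]; exact hpos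
  have hgne := fun z hz => eventually_ne_of_deriv_ne_zero hU hUc hgd h0 hd0 (z := z) hz
  have hinj : ∀ i, InjOn (F i) U := fun i => (hF i).2.1
  refine ⟨g, ⟨hgd, injOn_of_tendstoLocallyUniformlyOn hU hFd hinj hg hgne, fun z hz => ?_, ?_⟩, hd0,
    fun h hh => hder ▸ le_csSup hbdd ⟨h, hh, rfl⟩⟩
  · obtain ⟨i, x, hx, hxe⟩ :=
      (eventually_mem_image_of_tendsto hU hFd hinj hg hz (hgne z hz) univ_mem).exists
    rw [← hxe]
    exact (hF i).2.2.1 hx.2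
  · have h1 := hg.tendsto_at h0
    simp only [(hF _).2.2.2] at h1
    exact tendsto_nhds_unique h1 tendsto_const_nhds

end RiemannMapping

end Bieberbach

namespace Bieberbach

open Metric Filter Topology Set Function ComplexConjugate

section Mobius

/-- The disk automorphism sending `a` to `0`. -/
noncomputable def diskAut (a w : ℂ) : ℂ := (w - a) / (1 - conj a * w)

variable {a : ℂ}

theorem one_sub_conj_mul_ne_zero (ha : ‖a‖ < 1) {w : ℂ} (hw : ‖w‖ < 1) : 1 - conj a * w ≠ 0 := by
  intro h
  have h1 : ‖conj a * w‖ = 1 := by rw [← sub_eq_zero.1 h, norm_one]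
  rw [norm_mul, Complex.norm_conj] at h1
  nlinarith [norm_nonneg a, norm_nonneg w]

theorem hasDerivAt_diskAut (ha : ‖a‖ < 1) {w : ℂ} (hw : ‖w‖ < 1) :
    HasDerivAt (diskAut a) ((1 - ‖a‖ ^ 2) / (1 - conj a * w) ^ 2) w := by
  have h := ((hasDerivAt_id w).sub_const a).div (((hasDerivAt_id w).const_mul (conj a)).const_sub 1)
    (one_sub_conj_mul_ne_zero ha hw)
  have e : (1 - (‖a‖ : ℂ) ^ 2) = 1 * (1 - conj a * w) - (w - a) * -(conj a * 1) := by
    rw [← Complex.conj_mul' a]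
    ring
  rw [e]
  exact h

theorem norm_diskAut_lt (ha : ‖a‖ < 1) {w : ℂ} (hw : ‖w‖ < 1) : ‖diskAut a w‖ < 1 := by
  have h0 := one_sub_conj_mul_ne_zero ha hw
  rw [diskAut, norm_div, div_lt_one (norm_pos_iff.2 h0)]
  refine lt_of_pow_lt_pow_left₀ 2 (norm_nonneg _) ?_
  have e : ‖1 - conj a * w‖ ^ 2 - ‖w - a‖ ^ 2 = (1 - ‖a‖ ^ 2) * (1 - ‖w‖ ^ 2) := by
    simp only [← Complex.normSq_eq_norm_sq, Complex.normSq_apply]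
    simp
    ring
  have : 0 < (1 - ‖a‖ ^ 2) * (1 - ‖w‖ ^ 2) := by
    apply mul_pos <;> nlinarith [norm_nonneg a, norm_nonneg w]
  linarith

theorem diskAut_injOn (ha : ‖a‖ < 1) : InjOn (diskAut a) (ball 0 1) := by
  intro w hw v hv h
  rw [mem_ball_zero_iff] at hw hv
  rw [diskAut, diskAut, div_eq_div_iff (one_sub_conj_mul_ne_zero ha hw)
    (one_sub_conj_mul_ne_zero ha hv)] at h
  have h1 : (w - v) * (1 - conj a * a) = 0 := by linear_combination h
  rcases mul_eq_zero.1 h1 with h2 | h2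
  · exact sub_eq_zero.1 h2
  · exact absurd h2 (one_sub_conj_mul_ne_zero ha ha)

theorem diskAut_eq_zero_iff (ha : ‖a‖ < 1) {w : ℂ} (hw : ‖w‖ < 1) : diskAut a w = 0 ↔ w = a := by
  rw [diskAut, div_eq_zero_iff, sub_eq_zero]
  simp [one_sub_conj_mul_ne_zero ha hw]

end Mobius

section RiemannMapping

variable {U : Set ℂ}

theorem exists_differentiableOn_sq_eq (hUs : IsSimplyConnected U) (hU : IsOpen U) {h : ℂ → ℂ}
    (hh : DifferentiableOn ℂ h U) (h0 : ∀ z ∈ U, h z ≠ 0) :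
    ∃ k : ℂ → ℂ, DifferentiableOn ℂ k U ∧ ∀ z, k z ^ 2 = h z := by
  obtain ⟨k, hk, hk2⟩ := Complex.exists_continuousOn_pow_eq hUs hU hh.continuousOn
    (by rintro ⟨z, hz, hz0⟩; exact h0 z hz hz0) two_ne_zero
  refine ⟨k, fun z hz => DifferentiableAt.differentiableWithinAt ?_, hk2⟩
  have hkz : k z ≠ 0 := by
    intro hc
    apply h0 z hz
    rw [← hk2, hc]; simp
  have hsq : HasStrictDerivAt (fun w : ℂ => w ^ 2) (2 * k z) (k z) := by
    simpa using hasStrictDerivAt_pow 2 (k z)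
  have hne : 2 * k z ≠ 0 := mul_ne_zero two_ne_zero hkz
  have hc := hk.continuousAt (hU.mem_nhds hz)
  have h1 : k =ᶠ[𝓝 z] fun w => hsq.localInverse _ _ _ hne (h w) := by
    filter_upwards [hc.eventually (hsq.eventually_left_inverse hne)] with w hw
    rw [← hk2, hw]
  have h2 := (hsq.to_localInverse hne).hasDerivAt.differentiableAt
  simp only [hk2] at h2
  exact (h2.comp z (hh.differentiableAt (hU.mem_nhds hz))).congr_of_eventuallyEq h1

theorem surjOn_of_discMap_max (hUs : IsSimplyConnected U) (hU : IsOpen U) (h0 : (0 : ℂ) ∈ U)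
    {g : ℂ → ℂ} (hg : g ∈ discMaps U) (hd : deriv g 0 ≠ 0)
    (hmax : ∀ h ∈ discMaps U, ‖deriv h 0‖ ≤ ‖deriv g 0‖) : SurjOn g U (ball 0 1) := by
  intro a ha
  by_contra hna
  rw [mem_ball_zero_iff] at ha
  obtain ⟨hgd, hgi, hgm, hg0⟩ := hg
  have hgn : ∀ z ∈ U, ‖g z‖ < 1 := fun z hz => mem_ball_zero_iff.1 (hgm hz)
  have ha0 : a ≠ 0 := by
    rintro rfl
    exact hna ⟨0, h0, hg0⟩
  have hhd : DifferentiableOn ℂ (fun z => diskAut a (g z)) U := fun z hz =>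
    (hasDerivAt_diskAut ha (hgn z hz)).differentiableAt.comp_differentiableWithinAt z (hgd z hz)
  obtain ⟨k, hkd, hk2⟩ := exists_differentiableOn_sq_eq hUs hU hhd fun z hz hc =>
    hna ⟨z, hz, (diskAut_eq_zero_iff ha (hgn z hz)).1 hc⟩
  have hkn : ∀ z ∈ U, ‖k z‖ < 1 := fun z hz => by
    have := norm_diskAut_lt ha (hgn z hz)
    rw [← hk2, norm_pow] at this
    exact (pow_lt_one_iff_of_nonneg (norm_nonneg _) two_ne_zero).1 this
  have hki : InjOn k U := fun z hz w hw h => hgi hz hw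
    (diskAut_injOn ha (hgm hz) (hgm hw) (by rw [← hk2, ← hk2, h]))
  have hb := hkn 0 h0
  have hb2 : k 0 ^ 2 = -a := by rw [hk2, hg0]; simp [diskAut]
  have hb2n : ‖k 0‖ ^ 2 = ‖a‖ := by rw [← norm_pow, hb2, norm_neg]
  have hb0 : k 0 ≠ 0 := by
    intro h; rw [h] at hb2; apply ha0; simpa using hb2.symm
  set b := k 0 with hbdef
  have hG : (fun z => diskAut b (k z)) ∈ discMaps U :=
    ⟨fun z hz => (hasDerivAt_diskAut hb (hkn z hz)).differentiableAt.comp_differentiableWithinAt z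
      (hkd z hz), fun z hz w hw h => hki hz hw (diskAut_injOn hb (mem_ball_zero_iff.2 (hkn z hz))
        (mem_ball_zero_iff.2 (hkn w hw)) h),
      fun z hz => mem_ball_zero_iff.2 (norm_diskAut_lt hb (hkn z hz)), by simp [diskAut, hbdef]⟩
  have hkD := (hkd.differentiableAt (hU.mem_nhds h0)).hasDerivAt
  have hgD := (hgd.differentiableAt (hU.mem_nhds h0)).hasDerivAt
  have e1 : 2 * b * deriv k 0 = (1 - ‖a‖ ^ 2) * deriv g 0 := by
    have h1 := (hasDerivAt_diskAut ha (hgn 0 h0)).comp 0 hgD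
    have h2 := hkD.pow 2
    have h3 : HasDerivAt (fun z => k z ^ 2) ((1 - ‖a‖ ^ 2) / (1 - conj a * g 0) ^ 2 * deriv g 0) 0 :=
      h1.congr_of_eventuallyEq (Eventually.of_forall fun z => hk2 z)
    have h4 := h2.unique h3
    simpa [hg0] using h4
  have e2 : deriv (fun z => diskAut b (k z)) 0 = (1 - ‖b‖ ^ 2) / (1 - conj b * b) ^ 2 * deriv k 0 :=
    ((hasDerivAt_diskAut hb hb).comp 0 hkD).deriv
  have hm := hmax _ hG
  have hβ0 : 0 < ‖b‖ := norm_pos_iff.2 hb0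
  have hq : (0 : ℝ) < 1 - ‖b‖ ^ 2 := by nlinarith
  have e3 : ‖deriv (fun z => diskAut b (k z)) 0‖ * (1 - ‖b‖ ^ 2) = ‖deriv k 0‖ := by
    rw [e2, Complex.conj_mul', norm_mul, norm_div, norm_pow]
    have : ‖(1 : ℂ) - (‖b‖ : ℂ) ^ 2‖ = 1 - ‖b‖ ^ 2 := by
      have : (1 : ℂ) - (‖b‖ : ℂ) ^ 2 = ((1 - ‖b‖ ^ 2 : ℝ) : ℂ) := by push_cast; rfl
      rw [this, Complex.norm_real, Real.norm_of_nonneg hq.le]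
    rw [this]
    field_simp
  have e4 : 2 * ‖b‖ * ‖deriv k 0‖ = (1 - ‖b‖ ^ 2) * (1 + ‖b‖ ^ 2) * ‖deriv g 0‖ := by
    have := congrArg norm e1
    rw [norm_mul, norm_mul, norm_mul] at this
    have h5 : ‖(1 : ℂ) - (‖a‖ : ℂ) ^ 2‖ = (1 - ‖b‖ ^ 2) * (1 + ‖b‖ ^ 2) := by
      have : (1 : ℂ) - (‖a‖ : ℂ) ^ 2 = (((1 - ‖b‖ ^ 2) * (1 + ‖b‖ ^ 2) : ℝ) : ℂ) := by
        rw [hb2n]; push_cast; ring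
      rw [this, Complex.norm_real, Real.norm_of_nonneg (by positivity)]
    rw [h5] at this
    simpa using this
  have hs : 0 < ‖deriv g 0‖ := norm_pos_iff.2 hd
  have e5 : ‖deriv k 0‖ ≤ ‖deriv g 0‖ * (1 - ‖b‖ ^ 2) := by rw [← e3]; gcongr
  have e6 : (1 - ‖b‖ ^ 2) * (1 + ‖b‖ ^ 2) * ‖deriv g 0‖
      ≤ 2 * ‖b‖ * (‖deriv g 0‖ * (1 - ‖b‖ ^ 2)) := by rw [← e4]; gcongr
  have e7 : 0 < (1 - ‖b‖ ^ 2) * ‖deriv g 0‖ * (1 - ‖b‖) ^ 2 := by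
    have : 0 < (1 - ‖b‖) ^ 2 := pow_pos (by linarith) 2
    positivity
  nlinarith

/-- The Riemann mapping theorem for bounded simply connected domains containing the origin. -/
theorem exists_riemann_map (hUs : IsSimplyConnected U) (hU : IsOpen U) (h0 : (0 : ℂ) ∈ U) {R : ℝ}
    (hR : U ⊆ ball 0 R) : ∃ F : ℂ → ℂ, ∃ b : ℝ, 0 < b ∧ DifferentiableOn ℂ F (ball 0 1) ∧
      InjOn F (ball 0 1) ∧ F '' ball 0 1 = U ∧ F 0 = 0 ∧ deriv F 0 = b := by
  obtain ⟨g, hg, hd, hmax⟩ := exists_discMap_max hU hUs.isPathConnected.isConnected.isPreconnected h0 hR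
  have hsurj := surjOn_of_discMap_max hUs hU h0 hg hd hmax
  obtain ⟨hgd, hgi, hgm, hg0⟩ := hg
  have himg : g '' U = ball 0 1 := hgm.image_subset.antisymm hsurj
  set k := invFunOn g U with hk
  have hkd : DifferentiableOn ℂ k (ball 0 1) := himg ▸ differentiableOn_invFunOn hU hgd hgi
  have hgk : ∀ w ∈ ball (0 : ℂ) 1, g (k w) = w := fun w hw => invFunOn_eq (hsurj hw)
  have hkU : ∀ w ∈ ball (0 : ℂ) 1, k w ∈ U := fun w hw => invFunOn_mem (hsurj hw)
  have hkg : ∀ z ∈ U, k (g z) = z := fun z hz => hgi.leftInvOn_invFunOn hz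
  have hki : InjOn k (ball 0 1) := fun w hw v hv h => by rw [← hgk w hw, ← hgk v hv, h]
  have hk0 : k 0 = 0 := by have := hkg 0 h0; rwa [hg0] at this
  have h00 : (0 : ℂ) ∈ ball (0 : ℂ) 1 := mem_ball_self one_pos
  have hkd0 : deriv k 0 ≠ 0 := deriv_ne_zero_of_injOn isOpen_ball hkd hki h00
  set c : ℂ := ‖deriv k 0‖ / deriv k 0 with hc
  have hnp : 0 < ‖deriv k 0‖ := norm_pos_iff.2 hkd0
  have hc1 : ‖c‖ = 1 := by
    rw [hc, norm_div, Complex.norm_real, norm_norm, div_self hnp.ne']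
  have hc0 : c ≠ 0 := by rw [← norm_pos_iff, hc1]; exact one_pos
  have hcm : ∀ z ∈ ball (0 : ℂ) 1, c * z ∈ ball (0 : ℂ) 1 := fun z hz => by
    rw [mem_ball_zero_iff] at hz ⊢
    rwa [norm_mul, hc1, one_mul]
  refine ⟨fun z => k (c * z), ‖deriv k 0‖, hnp, hkd.comp (by fun_prop) hcm,
    fun z hz w hw h => mul_left_cancel₀ hc0 (hki (hcm z hz) (hcm w hw) h), ?_, by simp [hk0], ?_⟩
  · ext w
    constructor
    · rintro ⟨z, hz, rfl⟩; exact hkU _ (hcm z hz)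
    · intro hw
      refine ⟨c⁻¹ * g w, ?_, ?_⟩
      · have := hgm hw
        rw [mem_ball_zero_iff] at this ⊢
        rwa [norm_mul, norm_inv, hc1, inv_one, one_mul]
      · show k (c * (c⁻¹ * g w)) = w
        rw [mul_inv_cancel_left₀ hc0, hkg w hw]
  · have h1 : HasDerivAt k (deriv k 0) (c * 0) := by
      rw [mul_zero]
      exact (hkd.differentiableAt (isOpen_ball.mem_nhds h00)).hasDerivAt
    have h2 := h1.comp 0 ((hasDerivAt_id (0 : ℂ)).const_mul c)
    have h3 : deriv (fun z => k (c * z)) 0 = deriv k 0 * (c * 1) := h2.deriv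
    rw [h3, hc]
    field_simp

end RiemannMapping

end Bieberbach

namespace Bieberbach

open Metric Filter Topology Set Function

section Logarithm

variable {f g : ℂ → ℂ}

theorem exists_exp_eq (hf : DifferentiableOn ℂ f (ball 0 1)) (hne : ∀ z ∈ ball (0 : ℂ) 1, f z ≠ 0) :
    ∃ g : ℂ → ℂ, DifferentiableOn ℂ g (ball 0 1) ∧ g 0 = 0 ∧
      ∀ z ∈ ball (0 : ℂ) 1, f z = f 0 * Complex.exp (g z) := by
  have h00 : (0 : ℂ) ∈ ball (0 : ℂ) 1 := mem_ball_self one_pos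
  obtain ⟨k, hk⟩ := ((hf.deriv isOpen_ball).div hf hne).isExactOn_ball
  have hkd : ∀ z ∈ ball (0 : ℂ) 1,
      HasDerivAt (fun z => f z * Complex.exp (-(k z - k 0))) 0 z := fun z hz => by
    have h1 := (hf.differentiableAt (isOpen_ball.mem_nhds hz)).hasDerivAt
    have h2 := (((hk z hz).sub_const (k 0)).neg).cexp
    have h3 : deriv f z * Complex.exp (-(k z - k 0)) +
        f z * (Complex.exp (-(k z - k 0)) * -(deriv f z / f z)) = 0 := by
      have := hne z hz
      field_simp
      ring
    exact (h1.mul h2).congr_deriv h3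
  refine ⟨fun z => k z - k 0, fun z hz => ((hk z hz).differentiableAt.sub_const _).differentiableWithinAt,
    by simp, fun z hz => ?_⟩
  have := isOpen_ball.is_const_of_deriv_eq_zero (convex_ball (0 : ℂ) 1).isPreconnected
    (fun z hz => (hkd z hz).differentiableAt.differentiableWithinAt)
    (fun z hz => (hkd z hz).deriv) h00 hz
  simp only [sub_self, neg_zero, Complex.exp_zero, mul_one] at this
  rw [this, mul_assoc, ← Complex.exp_add]
  simp

theorem eqOn_of_exp_eqOn (hf : DifferentiableOn ℂ f (ball 0 1)) (hg : DifferentiableOn ℂ g (ball 0 1))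
    (h0 : f 0 = g 0) (h : ∀ z ∈ ball (0 : ℂ) 1, z ≠ 0 → Complex.exp (f z) = Complex.exp (g z)) :
    EqOn f g (ball 0 1) := by
  have h00 : (0 : ℂ) ∈ ball (0 : ℂ) 1 := mem_ball_self one_pos
  have hex : ∀ z ∈ ball (0 : ℂ) 1, Complex.exp (f z - g z) = 1 := fun z hz => by
    rcases eq_or_ne z 0 with rfl | hz0
    · simp [h0]
    · rw [Complex.exp_sub, h z hz hz0, div_self (Complex.exp_ne_zero _)]
  have hd : ∀ z ∈ ball (0 : ℂ) 1, deriv (fun z => f z - g z) z = 0 := fun z hz => by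
    have h1 := ((hf.sub hg).differentiableAt (isOpen_ball.mem_nhds hz)).hasDerivAt.cexp
    have h2 : HasDerivAt (fun z => Complex.exp ((f - g) z)) 0 z :=
      (hasDerivAt_const z (1 : ℂ)).congr_of_eventuallyEq
        (eventually_of_mem (isOpen_ball.mem_nhds hz) fun w hw => hex w hw)
    have h3 := h1.unique h2
    exact (mul_eq_zero.1 h3).resolve_left (Complex.exp_ne_zero _)
  intro z hz
  have := isOpen_ball.is_const_of_deriv_eq_zero (convex_ball (0 : ℂ) 1).isPreconnected
    (hf.sub hg) hd h00 hz
  simp only [Pi.sub_apply, h0, sub_self] at this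
  exact (sub_eq_zero.1 this.symm)

end Logarithm

section Univalent

/-- The map with logarithmic part `G` and derivative `b` at the origin. -/
noncomputable def univalentMap (b : ℝ) (G : ℂ → ℂ) (z : ℂ) : ℂ := b * z * Complex.exp (G z)

/-- `univalentMap b G` is univalent on the unit disk, with positive derivative `b` at the origin. -/
structure IsUnivalent (b : ℝ) (G : ℂ → ℂ) : Prop where
  pos : 0 < b
  differentiableOn_log : DifferentiableOn ℂ G (ball 0 1)
  log_zero : G 0 = 0
  injOn : InjOn (univalentMap b G) (ball 0 1)

variable {b b₁ b₂ : ℝ} {G G₁ G₂ F : ℂ → ℂ}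

@[simp]
theorem univalentMap_zero (b : ℝ) (G : ℂ → ℂ) : univalentMap b G 0 = 0 := by simp [univalentMap]

theorem IsUnivalent.differentiableOn (h : IsUnivalent b G) :
    DifferentiableOn ℂ (univalentMap b G) (ball 0 1) :=
  ((differentiableOn_const _).mul differentiableOn_id).mul h.differentiableOn_log.cexp

theorem IsUnivalent.univalentMap_ne_zero (h : IsUnivalent b G) {z : ℂ} (hz : z ≠ 0) :
    univalentMap b G z ≠ 0 :=
  mul_ne_zero (mul_ne_zero (by exact_mod_cast h.pos.ne') hz) (Complex.exp_ne_zero _)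

theorem IsUnivalent.hasDerivAt (h : IsUnivalent b G) : HasDerivAt (univalentMap b G) b 0 := by
  have h1 := (h.differentiableOn_log.differentiableAt
    (isOpen_ball.mem_nhds (mem_ball_self one_pos))).hasDerivAt.cexp
  have h2 := ((hasDerivAt_id (0 : ℂ)).const_mul (b : ℂ)).mul h1
  have h3 : (b : ℂ) * 1 * Complex.exp (G 0) + (b : ℂ) * id 0 * (Complex.exp (G 0) * deriv G 0) = b := by
    simp [h.log_zero]
  rw [h3] at h2
  exact h2

theorem exists_isUnivalent (hb : 0 < b) (hF : DifferentiableOn ℂ F (ball 0 1))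
    (hi : InjOn F (ball 0 1)) (h0 : F 0 = 0) (hd : deriv F 0 = b) :
    ∃ G, IsUnivalent b G ∧ ∀ z ∈ ball (0 : ℂ) 1, F z = univalentMap b G z := by
  have h00 : (0 : ℂ) ∈ ball (0 : ℂ) 1 := mem_ball_self one_pos
  have hds : DifferentiableOn ℂ (dslope F 0) (ball 0 1) :=
    (Complex.differentiableOn_dslope (isOpen_ball.mem_nhds h00)).2 hF
  have hmul : ∀ z, F z = z * dslope F 0 z := fun z => by
    have := sub_smul_dslope F 0 z
    simpa [h0] using this.symm
  have hne : ∀ z ∈ ball (0 : ℂ) 1, dslope F 0 z ≠ 0 := fun z hz h => by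
    rcases eq_or_ne z 0 with rfl | hz0
    · rw [dslope_same, hd] at h
      exact hb.ne' (by exact_mod_cast h)
    · exact hz0 (hi hz h00 (by rw [hmul z, h, mul_zero, h0]))
  obtain ⟨G, hG, hG0, hGe⟩ := exists_exp_eq hds hne
  rw [dslope_same, hd] at hGe
  have hE : ∀ z ∈ ball (0 : ℂ) 1, F z = univalentMap b G z := fun z hz => by
    rw [hmul, hGe z hz, univalentMap]; ring
  exact ⟨G, ⟨hb, hG, hG0, hi.congr hE⟩, hE⟩

theorem IsUnivalent.subordination (h₁ : IsUnivalent b₁ G₁) (h₂ : IsUnivalent b₂ G₂)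
    (h : univalentMap b₁ G₁ '' ball 0 1 ⊆ univalentMap b₂ G₂ '' ball 0 1) :
    ∃ u : ℂ → ℂ, DifferentiableOn ℂ u (ball 0 1) ∧ (∀ z ∈ ball (0 : ℂ) 1, 0 ≤ (u z).re) ∧
      u 0 = Real.log (b₂ / b₁) ∧ ∀ z ∈ ball (0 : ℂ) 1,
        G₁ z = G₂ (z * Complex.exp (-u z)) - u z + Real.log (b₂ / b₁) := by
  have h00 : (0 : ℂ) ∈ ball (0 : ℂ) 1 := mem_ball_self one_pos
  have hb₁ : (b₁ : ℂ) ≠ 0 := by exact_mod_cast h₁.pos.ne'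
  have hb₂ : (b₂ : ℂ) ≠ 0 := by exact_mod_cast h₂.pos.ne'
  set F₁ := univalentMap b₁ G₁ with hF₁
  set F₂ := univalentMap b₂ G₂ with hF₂
  set k : ℂ → ℂ := fun z => invFunOn F₂ (ball 0 1) (F₁ z) with hk
  have hkm : ∀ z ∈ ball (0 : ℂ) 1, k z ∈ ball (0 : ℂ) 1 := fun z hz =>
    invFunOn_mem (h (mem_image_of_mem _ hz))
  have hkF : ∀ z ∈ ball (0 : ℂ) 1, F₂ (k z) = F₁ z := fun z hz =>
    invFunOn_eq (h (mem_image_of_mem _ hz))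
  have hkd : DifferentiableOn ℂ k (ball 0 1) :=
    (differentiableOn_invFunOn isOpen_ball h₂.differentiableOn h₂.injOn).comp h₁.differentiableOn
      fun z hz => h (mem_image_of_mem _ hz)
  have hk0 : k 0 = 0 := h₂.injOn (hkm 0 h00) h00 ((hkF 0 h00).trans (by simp [hF₁]))
  have hk' : deriv k 0 = b₁ / b₂ := by
    have h1 : HasDerivAt F₂ b₂ (k 0) := by rw [hk0]; exact h₂.hasDerivAt
    have h2 := h1.comp 0 (hkd.differentiableAt (isOpen_ball.mem_nhds h00)).hasDerivAt
    have h3 : HasDerivAt (F₂ ∘ k) b₁ 0 := h₁.hasDerivAt.congr_of_eventuallyEq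
      (eventually_of_mem (isOpen_ball.mem_nhds h00) hkF)
    rw [eq_div_iff hb₂, mul_comm]
    exact h2.unique h3
  have hmul : ∀ z, k z = z * dslope k 0 z := fun z => by
    have := sub_smul_dslope k 0 z
    simpa [hk0] using this.symm
  have hds : DifferentiableOn ℂ (dslope k 0) (ball 0 1) :=
    (Complex.differentiableOn_dslope (isOpen_ball.mem_nhds h00)).2 hkd
  have hne : ∀ z ∈ ball (0 : ℂ) 1, dslope k 0 z ≠ 0 := fun z hz hz' => by
    rcases eq_or_ne z 0 with rfl | hz0
    · rw [dslope_same, hk'] at hz'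
      exact div_ne_zero hb₁ hb₂ hz'
    · refine h₁.univalentMap_ne_zero hz0 ?_
      rw [← hF₁, ← hkF z hz, hmul z, hz', mul_zero]; simp [hF₂]
  obtain ⟨v, hv, hv0, hve⟩ := exists_exp_eq hds hne
  rw [dslope_same, hk'] at hve
  have hlog : Complex.exp (-(Real.log (b₂ / b₁) : ℂ)) = b₁ / b₂ := by
    rw [← Complex.ofReal_neg, ← Complex.ofReal_exp, ← Real.log_inv, Real.exp_log (by
      have := h₁.pos; have := h₂.pos; positivity), inv_div]
    push_cast; rfl
  set u : ℂ → ℂ := fun z => Real.log (b₂ / b₁) - v z with hu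
  have hue : ∀ z ∈ ball (0 : ℂ) 1, Complex.exp (-u z) = dslope k 0 z := fun z hz => by
    rw [hve z hz, hu, neg_sub, sub_eq_neg_add, Complex.exp_add, hlog]
  have huk : ∀ z ∈ ball (0 : ℂ) 1, z * Complex.exp (-u z) = k z := fun z hz => by
    rw [hue z hz, ← hmul]
  have hud : DifferentiableOn ℂ u (ball 0 1) := (differentiableOn_const _).sub hv
  refine ⟨u, hud, fun z hz => ?_, by simp [hu, hv0], ?_⟩
  · have h1 : ‖dslope k 0 z‖ ≤ 1 / 1 :=
      Complex.norm_dslope_le_div_of_mapsTo_ball hkd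
        (by rw [hk0]; exact fun z hz => ball_subset_closedBall (hkm z hz)) hz
    rw [← hue z hz, Complex.norm_exp, div_one] at h1
    simpa using h1
  · refine eqOn_of_exp_eqOn h₁.differentiableOn_log ?_ ?_ ?_
    · refine DifferentiableOn.add (DifferentiableOn.sub ?_ hud) (differentiableOn_const _)
      exact (h₂.differentiableOn_log.comp hkd hkm).congr fun z hz => by simp [huk z hz]
    · simp [hu, hv0, h₁.log_zero, h₂.log_zero]
    · intro z hz hz0
      have h1 := hkF z hz
      rw [← huk z hz, hF₁, hF₂, univalentMap, univalentMap] at h1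
      have h2 : Complex.exp (Real.log (b₂ / b₁) : ℂ) = b₂ / b₁ := by
        rw [← inv_inj, ← Complex.exp_neg, hlog, inv_div]
      rw [Complex.exp_add, sub_eq_add_neg, Complex.exp_add, h2]
      field_simp
      refine mul_left_cancel₀ hz0 ?_
      linear_combination -h1

theorem IsUnivalent.le_of_image_subset (h₁ : IsUnivalent b₁ G₁) (h₂ : IsUnivalent b₂ G₂)
    (h : univalentMap b₁ G₁ '' ball 0 1 ⊆ univalentMap b₂ G₂ '' ball 0 1) : b₁ ≤ b₂ := by
  obtain ⟨u, -, hu, hu0, -⟩ := h₁.subordination h₂ h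
  have := hu 0 (mem_ball_self one_pos)
  rw [hu0, Complex.ofReal_re] at this
  by_contra! hlt
  exact absurd this (not_le.2 (Real.log_neg (div_pos h₂.pos h₁.pos) ((div_lt_one h₁.pos).2 hlt)))

theorem functional_le_of_image_subset (N : ℕ) {M : ℝ} (hM : 0 < M) :
    ∃ K, 0 ≤ K ∧ ∀ (b₁ b₂ : ℝ) (G₁ G₂ : ℂ → ℂ) (s : ℝ), IsUnivalent b₁ G₁ → IsUnivalent b₂ G₂ →
      univalentMap b₁ G₁ '' ball 0 1 ⊆ univalentMap b₂ G₂ '' ball 0 1 →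
      (∀ z ∈ ball (0 : ℂ) 1, (G₂ z).re ≤ M) → Real.log (b₂ / b₁) ≤ 1 / 3 → 0 < s → s ≤ 1 →
      functional N s G₁ ≤ functional N (s * (b₁ / b₂)) G₂ + K * Real.log (b₂ / b₁) ^ 2 := by
  obtain ⟨K, hK, hstep⟩ := functional_le_of_step N hM
  refine ⟨K, hK, fun b₁ b₂ G₁ G₂ s h₁ h₂ h hG hlog hs hs1 => ?_⟩
  obtain ⟨u, hud, hu, hu0, hue⟩ := h₁.subordination h₂ h
  have hd : 0 ≤ Real.log (b₂ / b₁) :=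
    Real.log_nonneg ((one_le_div h₁.pos).2 (h₁.le_of_image_subset h₂ h))
  have := hstep G₁ G₂ u _ s h₁.differentiableOn_log h₂.differentiableOn_log h₂.log_zero hG hud hu hd
    hlog hu0 hue hs hs1
  rwa [← Real.log_inv, Real.exp_log (inv_pos.2 (div_pos h₂.pos h₁.pos)), inv_div] at this

end Univalent

end Bieberbach

namespace Bieberbach

open Metric Filter Topology Set Function

section Partition

theorem le_of_forall_le_add_sq {φ β : ℝ → ℝ} {a b K κ : ℝ} (hab : a ≤ b) (hK : 0 ≤ K) (hκ : 0 < κ)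
    (hβ : ContinuousOn β (Icc a b))
    (h : ∀ s ∈ Icc a b, ∀ t ∈ Icc a b, s ≤ t → β t - β s ≤ κ →
      0 ≤ β t - β s ∧ φ s ≤ φ t + K * (β t - β s) ^ 2) : φ a ≤ φ b := by
  have key : ∀ η, 0 < η → η ≤ κ → φ a ≤ φ b + K * η * (β b - β a) := fun η hη hηκ => by
    have hc : Continuous fun x : Icc a b => β x := hβ.domRestrict
    obtain ⟨t, ht0, htm, ⟨m, hm⟩, hti⟩ := exists_monotone_Icc_subset_open_cover_Icc hab
      (c := fun x : Icc a b => {y : Icc a b | dist (β y) (β x) < η / 2})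
      (fun x => isOpen_lt (hc.dist continuous_const) continuous_const)
      (fun x _ => mem_iUnion.2 ⟨x, by simpa using half_pos hη⟩)
    have hstep : ∀ n, φ a ≤ φ (t n) + K * η * (β (t n) - β a) := fun n => by
      induction n with
      | zero => simp [ht0]
      | succ n ih =>
        obtain ⟨x, hx⟩ := hti n
        have hle : t n ≤ t (n + 1) := htm n.le_succ
        have h1 : dist (β (t n)) (β x) < η / 2 := hx ⟨le_rfl, hle⟩
        have h2 : dist (β (t (n + 1))) (β x) < η / 2 := hx ⟨hle, le_rfl⟩
        have h3 : β (t (n + 1)) - β (t n) ≤ η := by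
          rw [Real.dist_eq, abs_lt] at h1 h2
          linarith
        obtain ⟨h4, h5⟩ := h _ (t n).2 _ (t (n + 1)).2 hle (h3.trans hηκ)
        have h6 : K * (β (t (n + 1)) - β (t n)) ^ 2 ≤ K * (η * (β (t (n + 1)) - β (t n))) := by
          rw [sq]; gcongr
        linarith
    simpa [hm m le_rfl] using hstep m
  refine le_of_forall_pos_le_add fun e he => ?_
  have hD : 0 < K * |β b - β a| + 1 := by positivity
  refine (key (min κ (e / (K * |β b - β a| + 1))) (lt_min hκ (by positivity)) (min_le_left _ _)).trans ?_
  gcongr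
  calc K * min κ (e / (K * |β b - β a| + 1)) * (β b - β a)
      ≤ K * (e / (K * |β b - β a| + 1)) * |β b - β a| := by
        have h0 : 0 ≤ min κ (e / (K * |β b - β a| + 1)) := (lt_min hκ (by positivity)).le
        exact (mul_le_mul_of_nonneg_left (le_abs_self _) (by positivity)).trans (by
          gcongr; exact min_le_right _ _)
    _ = e * ((K * |β b - β a|) / (K * |β b - β a| + 1)) := by ring
    _ ≤ e * 1 := by
        gcongr
        rw [div_le_one hD]; linarith
    _ = e := mul_one e

end Partition

section Family

variable {b : ℝ → ℝ} {G : ℝ → ℂ → ℂ} {H : ℂ ≃ₜ ℂ}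

theorem exists_isUnivalent_homeomorph_image (hH : H 0 = 0) {t : ℝ} (ht : 0 < t) :
    ∃ b : ℝ, ∃ G : ℂ → ℂ, IsUnivalent b G ∧ univalentMap b G '' ball 0 1 = H '' ball 0 t := by
  have hsc : IsSimplyConnected (H '' ball 0 t) := by
    rw [H.isSimplyConnected_image]
    have : ContractibleSpace (ball (0 : ℂ) t) :=
      (convex_ball (0 : ℂ) t).contractibleSpace ⟨0, mem_ball_self ht⟩
    exact (inferInstance : SimplyConnectedSpace (ball (0 : ℂ) t))
  obtain ⟨R, hR⟩ : ∃ R, H '' ball 0 t ⊆ ball 0 R := by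
    obtain ⟨R, hR⟩ := ((isCompact_closedBall (0 : ℂ) t).image H.continuous).isBounded.subset_ball 0
    exact ⟨R, (image_mono ball_subset_closedBall).trans hR⟩
  obtain ⟨F, b, hb, hF, hi, him, h0, hd⟩ := exists_riemann_map hsc
    (H.isOpenMap _ isOpen_ball) ⟨0, mem_ball_self ht, hH⟩ hR
  obtain ⟨G, hG, hE⟩ := exists_isUnivalent hb hF hi h0 hd
  exact ⟨b, G, hG, by rw [← him]; exact (image_congr hE).symm⟩

theorem IsUnivalent.dilate {b : ℝ} {G : ℂ → ℂ} (h : IsUnivalent b G) {c : ℝ} (hc : 0 < c) (hc1 : c ≤ 1) :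
    IsUnivalent (c * b) (fun z => G (c * z)) ∧
      ∀ z, univalentMap (c * b) (fun z => G (c * z)) z = univalentMap b G (c * z) := by
  have hE : ∀ z, univalentMap (c * b) (fun z => G (c * z)) z = univalentMap b G (c * z) := fun z => by
    simp only [univalentMap]; push_cast; ring
  have hm : ∀ z ∈ ball (0 : ℂ) 1, (c : ℂ) * z ∈ ball (0 : ℂ) 1 := fun z hz => by
    rw [mem_ball_zero_iff] at hz ⊢
    rw [norm_mul, Complex.norm_real, Real.norm_of_nonneg hc.le]
    nlinarith [norm_nonneg z]
  refine ⟨⟨mul_pos hc h.pos, h.differentiableOn_log.comp (by fun_prop) hm, by simp [h.log_zero],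
    fun z hz w hw hzw => ?_⟩, hE⟩
  rw [hE, hE] at hzw
  exact mul_left_cancel₀ (by exact_mod_cast hc.ne') (h.injOn (hm z hz) (hm w hw) hzw)

theorem derivative_mono
    (hG : ∀ t, 0 < t →
      IsUnivalent (b t) (G t) ∧ univalentMap (b t) (G t) '' ball 0 1 = H '' ball 0 t)
    {s t : ℝ} (hs : 0 < s) (hst : s ≤ t) : b s ≤ b t := by
  refine (hG s hs).1.le_of_image_subset (hG t (hs.trans_le hst)).1 ?_
  rw [(hG s hs).2, (hG t (hs.trans_le hst)).2]
  exact image_mono (ball_subset_ball hst)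

theorem exists_lt_derivative
    (hG : ∀ t, 0 < t →
      IsUnivalent (b t) (G t) ∧ univalentMap (b t) (G t) '' ball 0 1 = H '' ball 0 t)
    {t c : ℝ} (ht : 0 < t) (hc : 0 < c) (hc1 : c < 1) :
    ∃ s, 0 < s ∧ s < t ∧ c * b t ≤ b s := by
  obtain ⟨hu, him⟩ := hG t ht
  have hcb : closedBall (0 : ℂ) c ⊆ ball 0 1 := closedBall_subset_ball hc1
  have hK : IsCompact (H.symm '' (univalentMap (b t) (G t) '' closedBall 0 c)) :=
    ((isCompact_closedBall (0 : ℂ) c).image_of_continuousOn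
      (hu.differentiableOn.continuousOn.mono hcb)).image H.symm.continuous
  have hKt : H.symm '' (univalentMap (b t) (G t) '' closedBall 0 c) ⊆ ball 0 t := by
    rintro _ ⟨w, hw, rfl⟩
    have : w ∈ H '' ball 0 t := him ▸ image_mono hcb hw
    obtain ⟨y, hy, rfl⟩ := this
    simpa using hy
  obtain ⟨s, hs, hKs⟩ := exists_pos_lt_subset_ball ht hK.isClosed hKt
  refine ⟨s, hs.1, hs.2, ?_⟩
  obtain ⟨hd, hE⟩ := hu.dilate hc hc1.le
  refine hd.le_of_image_subset (hG s hs.1).1 ?_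
  rw [(hG s hs.1).2]
  rintro _ ⟨z, hz, rfl⟩
  rw [hE]
  refine ⟨H.symm (univalentMap (b t) (G t) (c * z)), hKs (mem_image_of_mem _ (mem_image_of_mem _ ?_)), by simp⟩
  rw [mem_closedBall_zero_iff, norm_mul, Complex.norm_real, Real.norm_of_nonneg hc.le]
  exact mul_le_of_le_one_right hc.le (mem_ball_zero_iff.1 hz).le

theorem exists_gt_derivative
    (hG : ∀ t, 0 < t →
      IsUnivalent (b t) (G t) ∧ univalentMap (b t) (G t) '' ball 0 1 = H '' ball 0 t)
    {t e : ℝ} (ht : 0 < t) (he : b t < e) : ∃ s, t < s ∧ b s < e := by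
  by_contra! hcon
  set F : ℕ → ℂ → ℂ := fun n : ℕ => univalentMap (b (t + 1 / (n + 1))) (G (t + 1 / (n + 1))) with hF
  have hpos : ∀ n : ℕ, t < t + 1 / ((n : ℝ) + 1) := fun n => by
    have : 0 < 1 / ((n : ℝ) + 1) := by positivity
    linarith
  have hle : ∀ n : ℕ, t + 1 / ((n : ℝ) + 1) ≤ t + 1 := fun n => by
    have : 1 / ((n : ℝ) + 1) ≤ 1 := by rw [div_le_one (by positivity)]; linarith [Nat.cast_nonneg (α := ℝ) n]
    linarith
  have hu : ∀ n : ℕ, IsUnivalent (b (t + 1 / (n + 1))) (G (t + 1 / (n + 1))) := fun n =>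
    (hG _ (ht.trans (hpos n))).1
  have him : ∀ n : ℕ, F n '' ball 0 1 = H '' ball 0 (t + 1 / (n + 1)) := fun n =>
    (hG _ (ht.trans (hpos n))).2
  have hd : ∀ n, DifferentiableOn ℂ (F n) (ball 0 1) := fun n => (hu n).differentiableOn
  have hi : ∀ n, InjOn (F n) (ball 0 1) := fun n => (hu n).injOn
  obtain ⟨C, hC⟩ := ((isCompact_closedBall (0 : ℂ) (t + 1)).image H.continuous).isBounded.exists_norm_le
  obtain ⟨g, hg⟩ := exists_tendstoLocallyUniformlyOn (hyperfilter ℕ) isOpen_ball hd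
    (C := C) (fun n z hz => hC _ (by
      have : F n z ∈ H '' ball 0 (t + 1 / (n + 1)) := him n ▸ mem_image_of_mem _ hz
      exact image_mono ((ball_subset_ball (hle n)).trans ball_subset_closedBall) this))
  have h00 : (0 : ℂ) ∈ ball (0 : ℂ) 1 := mem_ball_self one_pos
  have hgd : DifferentiableOn ℂ g (ball 0 1) := hg.differentiableOn (Eventually.of_forall hd) isOpen_ball
  have hg0 : g 0 = 0 := tendsto_nhds_unique (hg.tendsto_at h00) (by simp [hF])
  have hderiv : Tendsto (fun n : ℕ => (b (t + 1 / (n + 1)) : ℂ)) (hyperfilter ℕ) (𝓝 (deriv g 0)) := by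
    have := (hg.deriv (Eventually.of_forall hd) isOpen_ball).tendsto_at h00
    exact this.congr fun n => (hu n).hasDerivAt.deriv
  have hre : Tendsto (fun n : ℕ => b (t + 1 / (n + 1))) (hyperfilter ℕ) (𝓝 (deriv g 0).re) :=
    (Complex.continuous_re.tendsto _).comp hderiv
  have hder : deriv g 0 = ((deriv g 0).re : ℂ) :=
    tendsto_nhds_unique hderiv ((Complex.continuous_ofReal.tendsto _).comp hre)
  have hee : e ≤ (deriv g 0).re := ge_of_tendsto' hre fun n => hcon _ (hpos n)
  have hp : 0 < (deriv g 0).re := ((hG t ht).1.pos.trans he).trans_le hee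
  have hne : deriv g 0 ≠ 0 := fun h => by simp [h] at hp
  have hev : ∀ z ∈ ball (0 : ℂ) 1, ∀ᶠ w in 𝓝[≠] z, g w ≠ g z := fun z hz =>
    eventually_ne_of_deriv_ne_zero isOpen_ball (convex_ball (0 : ℂ) 1).isPreconnected hgd h00 hne hz
  have hgi : InjOn g (ball 0 1) := injOn_of_tendstoLocallyUniformlyOn isOpen_ball hd hi hg hev
  have hsub : H.symm '' (g '' ball 0 1) ⊆ ball 0 t := by
    have ho : IsOpen (H.symm '' (g '' ball 0 1)) :=
      H.symm.isOpenMap _ (isOpen_image_of_injOn isOpen_ball hgd hgi)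
    rw [← interior_closedBall (0 : ℂ) ht.ne']
    refine interior_maximal ?_ ho
    rintro _ ⟨_, ⟨z, hz, rfl⟩, rfl⟩
    rw [mem_closedBall_zero_iff]
    have hlim : Tendsto (fun n : ℕ => t + 1 / ((n : ℝ) + 1)) (hyperfilter ℕ) (𝓝 (t + 0)) :=
      (tendsto_one_div_add_atTop_nhds_zero_nat.const_add t).mono_left
        (Nat.hyperfilter_le_atTop)
    rw [add_zero] at hlim
    refine ge_of_tendsto hlim ?_
    filter_upwards [eventually_mem_image_of_tendsto isOpen_ball hd hi hg hz (hev z hz)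
      (isOpen_ball.mem_nhds hz)] with n hn
    rw [inter_self, him n] at hn
    obtain ⟨y, hy, hyz⟩ := hn
    rw [← hyz, H.symm_apply_apply]
    exact (mem_ball_zero_iff.1 hy).le
  obtain ⟨G', hG', hE⟩ := exists_isUnivalent hp hgd hgi hg0 hder
  have := hG'.le_of_image_subset (hG t ht).1 (by
    rw [(hG t ht).2, ← image_congr hE]
    intro w hw
    exact ⟨H.symm w, hsub (mem_image_of_mem _ hw), by simp⟩)
  linarith

theorem continuousAt_derivative
    (hG : ∀ t, 0 < t →
      IsUnivalent (b t) (G t) ∧ univalentMap (b t) (G t) '' ball 0 1 = H '' ball 0 t)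
    {t : ℝ} (ht : 0 < t) : ContinuousAt b t := by
  refine tendsto_order.2 ⟨fun e he => ?_, fun e he => ?_⟩
  · have hb := (hG t ht).1.pos
    obtain ⟨c, hc, hc1⟩ := exists_between (max_lt one_pos ((div_lt_one hb).2 he) : max 0 (e / b t) < 1)
    obtain ⟨s, hs, hst, hle⟩ := exists_lt_derivative hG ht ((le_max_left _ _).trans_lt hc) hc1
    filter_upwards [lt_mem_nhds hst] with x hx
    refine ((div_lt_iff₀ hb).1 ((le_max_right _ _).trans_lt hc)).trans_le (hle.trans ?_)
    exact derivative_mono hG hs hx.le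
  · obtain ⟨s, hs, hse⟩ := exists_gt_derivative hG ht he
    filter_upwards [gt_mem_nhds hs, lt_mem_nhds ht] with x hx hx0
    exact (derivative_mono hG hx0 hx.le).trans_lt hse

end Family

end Bieberbach

namespace Bieberbach

open Metric Filter Topology Set Function

section Chain

variable {b R : ℝ} {G : ℂ → ℂ}

theorem isUnivalent_zero (hR : 0 < R) : IsUnivalent R 0 :=
  ⟨hR, differentiableOn_const _, rfl, fun z _ w _ h => by
    have : (R : ℂ) ≠ 0 := by exact_mod_cast hR.ne'
    simpa [univalentMap, this] using h⟩

theorem univalentMap_zero_image_ball (hR : 0 < R) : univalentMap R 0 '' ball 0 1 = ball 0 R := by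
  have hR' : (R : ℂ) ≠ 0 := by exact_mod_cast hR.ne'
  ext w
  constructor
  · rintro ⟨z, hz, rfl⟩
    rw [mem_ball_zero_iff] at hz ⊢
    simpa [univalentMap, abs_of_pos hR] using mul_lt_mul_of_pos_left hz hR
  · intro hw
    refine ⟨w / R, ?_, by simp [univalentMap, mul_div_cancel₀, hR']⟩
    rw [mem_ball_zero_iff] at hw ⊢
    rw [norm_div, Complex.norm_real, Real.norm_of_nonneg hR.le]
    exact (div_lt_one hR).2 hw

theorem IsUnivalent.re_log_le (h : IsUnivalent b G) (hR : 0 < R)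
    (hsub : univalentMap b G '' ball 0 1 ⊆ ball 0 R) {z : ℂ} (hz : z ∈ ball (0 : ℂ) 1) :
    (G z).re ≤ Real.log (R / b) := by
  obtain ⟨u, -, hu, -, hue⟩ := h.subordination (isUnivalent_zero hR)
    (by rwa [univalentMap_zero_image_ball hR])
  rw [hue z hz]
  have := hu z hz
  simp only [Pi.zero_apply, zero_sub, Complex.add_re, Complex.neg_re, Complex.ofReal_re]
  linarith

theorem functional_le_of_homeomorph (N : ℕ) (hR : 0 < R) (h₀ : IsUnivalent b G) :
    ∃ K, 0 ≤ K ∧ ∀ (H : ℂ ≃ₜ ℂ) (ε d b' : ℝ) (G' : ℂ → ℂ), H 0 = 0 → H '' ball 0 R = ball 0 R →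
      0 < ε → ε ≤ R → IsUnivalent b' G' → univalentMap b G '' ball 0 1 ⊆ H '' ball 0 ε →
      H '' ball 0 ε ⊆ univalentMap b' G' '' ball 0 1 → Real.log (b' / b) ≤ d → d ≤ 1 / 3 →
      functional N 1 G ≤ K * d ^ 2 := by
  have hM : 0 < |Real.log (R / b)| + 1 := by positivity
  obtain ⟨K, hK, hstep⟩ := functional_le_of_image_subset N hM
  refine ⟨K, hK, fun H ε d b' G' hH hHR hε hεR h' hsub hsub' hlog hd => ?_⟩
  have hex : ∀ t : ℝ, ∃ b : ℝ, ∃ G : ℂ → ℂ, 0 < t →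
      IsUnivalent b G ∧ univalentMap b G '' ball 0 1 = H '' ball 0 t := fun t => by
    by_cases ht : 0 < t
    · obtain ⟨b, G, h⟩ := exists_isUnivalent_homeomorph_image hH ht
      exact ⟨b, G, fun _ => h⟩
    · exact ⟨0, 0, fun h => absurd h ht⟩
  choose β Γ hΓ using hex
  have hb : ∀ {t}, ε ≤ t → b ≤ β t := fun {t} ht =>
    (h₀.le_of_image_subset (hΓ ε hε).1 (by rwa [(hΓ ε hε).2])).trans (derivative_mono hΓ hε ht)
  have hβ : ∀ {t}, ε ≤ t → 0 < β t := fun ht => h₀.pos.trans_le (hb ht)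
  have hre : ∀ {t}, ε ≤ t → t ≤ R → ∀ z ∈ ball (0 : ℂ) 1, (Γ t z).re ≤ |Real.log (R / b)| + 1 :=
    fun {t} ht htR z hz => by
      have h1 : (Γ t z).re ≤ Real.log (R / β t) := (hΓ t (hε.trans_le ht)).1.re_log_le hR (by
        rw [(hΓ t (hε.trans_le ht)).2, ← hHR]
        exact image_mono (ball_subset_ball htR)) hz
      have h2 : Real.log (R / β t) ≤ Real.log (R / b) :=
        Real.log_le_log (div_pos hR (hβ ht)) (div_le_div_of_nonneg_left hR.le h₀.pos (hb ht))
      linarith [le_abs_self (Real.log (R / b))]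
  have hfirst : functional N 1 G ≤ functional N (b / β ε) (Γ ε) + K * d ^ 2 := by
    have h1 : β ε ≤ b' := (hΓ ε hε).1.le_of_image_subset h' (by rwa [(hΓ ε hε).2])
    have h2 : Real.log (β ε / b) ≤ d := (Real.log_le_log (div_pos (hβ le_rfl) h₀.pos)
      (div_le_div_of_nonneg_right h1 h₀.pos.le)).trans hlog
    have h3 : 0 ≤ Real.log (β ε / b) := Real.log_nonneg ((one_le_div h₀.pos).2 (hb le_rfl))
    have h4 := hstep b (β ε) G (Γ ε) 1 h₀ (hΓ ε hε).1 (by rwa [(hΓ ε hε).2]) (hre le_rfl hεR)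
      (h2.trans hd) one_pos le_rfl
    rw [one_mul] at h4
    refine h4.trans ?_
    gcongr
  have hmid : functional N (b / β ε) (Γ ε) ≤ functional N (b / β R) (Γ R) := by
    refine le_of_forall_le_add_sq (φ := fun t => functional N (b / β t) (Γ t))
      (β := fun t => Real.log (β t)) hεR hK (κ := 1 / 3) (by norm_num)
      (fun t ht => (ContinuousAt.log (continuousAt_derivative hΓ (hε.trans_le ht.1))
        (hβ ht.1).ne').continuousWithinAt) fun s hs t ht hst hδ => ?_
    have hs0 := hε.trans_le hs.1
    have ht0 := hε.trans_le ht.1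
    rw [← Real.log_div (hβ ht.1).ne' (hβ hs.1).ne'] at hδ ⊢
    refine ⟨Real.log_nonneg ((one_le_div (hβ hs.1)).2 (derivative_mono hΓ hs0 hst)), ?_⟩
    have h1 := hstep (β s) (β t) (Γ s) (Γ t) (b / β s) (hΓ s hs0).1 (hΓ t ht0).1 (by
      rw [(hΓ s hs0).2, (hΓ t ht0).2]
      exact image_mono (ball_subset_ball hst)) (hre ht.1 ht.2) hδ (div_pos h₀.pos (hβ hs.1))
      ((div_le_one (hβ hs.1)).2 (hb hs.1))
    rwa [div_mul_div_cancel₀ (hβ hs.1).ne'] at h1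
  have hlast : functional N (b / β R) (Γ R) ≤ 0 := by
    have h1 : univalentMap (β R) (Γ R) '' ball 0 1 = univalentMap R 0 '' ball 0 1 := by
      rw [(hΓ R hR).2, hHR, univalentMap_zero_image_ball hR]
    have hu := isUnivalent_zero hR
    have h2 : β R = R := ((hΓ R hR).1.le_of_image_subset hu h1.subset).antisymm
      (hu.le_of_image_subset (hΓ R hR).1 h1.superset)
    have hs : 0 < b / β R := div_pos h₀.pos (hβ hεR)
    have hs1 : b / β R ≤ 1 := (div_le_one (hβ hεR)).2 (hb hεR)
    have h3 := hstep (β R) R (Γ R) 0 (b / β R) (hΓ R hR).1 hu h1.subset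
      (fun z _ => by simpa using hM.le) (by rw [h2, div_self hR.ne', Real.log_one]; norm_num) hs hs1
    have h4 : functional N (b / β R) 0 ≤ 0 := functional_zero_le N hs hs1 fun k =>
      (taylorCoeff_const 0 (k + 1)).trans (by simp)
    rw [h2, div_self hR.ne', Real.log_one, mul_one] at h3
    rw [h2] at h4 ⊢
    linarith
  linarith

end Chain

end Bieberbach

namespace Bieberbach

open Metric Filter Topology Set Function

section RadialHomeomorph

/-- The radial map with modulus `‖z‖ ^ p` inside the unit disk, and the identity outside. -/
noncomputable def radialMap (p : ℝ) (z : ℂ) : ℂ := z * ((min ‖z‖ 1 ^ (p - 1) : ℝ) : ℂ)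

variable {p q : ℝ}

theorem radialMap_of_one_le {z : ℂ} (hz : 1 ≤ ‖z‖) : radialMap p z = z := by
  simp [radialMap, min_eq_right hz]

theorem norm_radialMap (hp : 0 < p) {z : ℂ} (hz : ‖z‖ ≤ 1) : ‖radialMap p z‖ = ‖z‖ ^ p := by
  rcases eq_or_ne z 0 with rfl | h0
  · simp [radialMap, Real.zero_rpow hp.ne']
  · have h : 0 < ‖z‖ := norm_pos_iff.2 h0
    rw [radialMap, norm_mul, min_eq_left hz, Complex.norm_real,
      Real.norm_of_nonneg (Real.rpow_nonneg h.le _), Real.rpow_sub_one h.ne']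
    field_simp

theorem continuous_radialMap (hp : 0 < p) : Continuous (radialMap p) := by
  refine continuous_iff_continuousAt.2 fun z => ?_
  rcases eq_or_ne z 0 with rfl | h0
  · have h1 : Tendsto (fun z : ℂ => ‖z‖ ^ p) (𝓝 0) (𝓝 0) := by
      have := (continuous_norm (E := ℂ)).rpow_const (fun _ => Or.inr hp.le)
      simpa [Real.zero_rpow hp.ne'] using this.tendsto 0
    have h2 : radialMap p 0 = 0 := by simp [radialMap]
    rw [ContinuousAt, h2]
    refine squeeze_zero_norm' ?_ h1
    filter_upwards [closedBall_mem_nhds (0 : ℂ) one_pos] with w hw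
    exact (norm_radialMap hp (mem_closedBall_zero_iff.1 hw)).le
  · refine continuousAt_id.mul (Complex.continuous_ofReal.continuousAt.comp ?_)
    exact (continuous_norm.min continuous_const).continuousAt.rpow_const
      (Or.inl (lt_min (norm_pos_iff.2 h0) one_pos).ne')

theorem radialMap_radialMap (hp : 0 < p) (hpq : p * q = 1) (z : ℂ) :
    radialMap q (radialMap p z) = z := by
  rcases le_total 1 ‖z‖ with hz | hz
  · rw [radialMap_of_one_le hz, radialMap_of_one_le hz]
  rcases eq_or_ne z 0 with rfl | h0
  · simp [radialMap]
  have h : 0 < ‖z‖ := norm_pos_iff.2 h0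
  have h1 : ‖radialMap p z‖ ≤ 1 := (norm_radialMap hp hz).le.trans (Real.rpow_le_one h.le hz hp.le)
  rw [radialMap, min_eq_left h1, norm_radialMap hp hz, radialMap, min_eq_left hz, mul_assoc,
    ← Complex.ofReal_mul, ← Real.rpow_mul h.le, ← Real.rpow_add h,
    show p - 1 + p * (q - 1) = 0 by linear_combination hpq]
  simp

theorem exists_radial_homeomorph {n : ℕ} (hn : n ≠ 0) :
    ∃ σ : ℂ ≃ₜ ℂ, (∀ z, 1 ≤ ‖z‖ → σ z = z) ∧ ∀ z, ‖z‖ ≤ 1 → ‖σ.symm z‖ = ‖z‖ ^ n := by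
  have hn' : (0 : ℝ) < n := by positivity
  have hq : (0 : ℝ) < (n : ℝ)⁻¹ := inv_pos.2 hn'
  refine ⟨⟨⟨radialMap (n : ℝ)⁻¹, radialMap n,
    radialMap_radialMap hq (inv_mul_cancel₀ hn'.ne'),
    radialMap_radialMap hn' (mul_inv_cancel₀ hn'.ne')⟩, continuous_radialMap hq,
    continuous_radialMap hn'⟩, fun z hz => radialMap_of_one_le hz, fun z hz => ?_⟩
  rw [← Real.rpow_natCast]
  exact norm_radialMap hn' hz

end RadialHomeomorph

section Transplant

variable {f : ℂ → ℂ} {ρ : ℝ}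

/-- The map conjugating `σ` by `f` on `f '' ball 0 ρ`, and the identity elsewhere. -/
noncomputable def transplant (f : ℂ → ℂ) (ρ : ℝ) (σ : ℂ → ℂ) (w : ℂ) : ℂ :=
  open Classical in
  if w ∈ f '' ball 0 ρ then f (σ (invFunOn f (ball 0 ρ) w)) else w

theorem transplant_apply (hi : InjOn f (ball 0 ρ)) (σ : ℂ → ℂ) {z : ℂ} (hz : z ∈ ball (0 : ℂ) ρ) :
    transplant f ρ σ (f z) = f (σ z) := by
  rw [transplant, if_pos (mem_image_of_mem _ hz), hi.leftInvOn_invFunOn hz]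

theorem continuous_transplant (hf : DifferentiableOn ℂ f (ball 0 ρ)) (hi : InjOn f (ball 0 ρ))
    (hρ : 1 < ρ) {σ : ℂ → ℂ} (hσ : Continuous σ) (hσ1 : ∀ z, 1 ≤ ‖z‖ → σ z = z)
    (hσρ : MapsTo σ (ball 0 ρ) (ball 0 ρ)) : Continuous (transplant f ρ σ) := by
  have ho : IsOpen (f '' ball 0 ρ) := isOpen_image_of_injOn isOpen_ball hf hi
  have hcl : IsClosed (f '' closedBall 0 1) := ((isCompact_closedBall (0 : ℂ) 1).image_of_continuousOn
    (hf.continuousOn.mono (closedBall_subset_ball hρ))).isClosed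
  refine continuous_iff_continuousAt.2 fun w => ?_
  by_cases hw : w ∈ f '' ball 0 ρ
  · have h1 : ContinuousOn (fun w => f (σ (invFunOn f (ball 0 ρ) w))) (f '' ball 0 ρ) :=
      hf.continuousOn.comp (hσ.comp_continuousOn
        (differentiableOn_invFunOn isOpen_ball hf hi).continuousOn)
        fun w hw => hσρ (invFunOn_mem hw)
    refine (h1.continuousAt (ho.mem_nhds hw)).congr ?_
    filter_upwards [ho.mem_nhds hw] with x hx
    rw [transplant, if_pos hx]
  · have h1 : w ∈ (f '' closedBall 0 1)ᶜ := fun h =>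
      hw (image_mono (closedBall_subset_ball hρ) h)
    refine continuousAt_id.congr ?_
    filter_upwards [hcl.isOpen_compl.mem_nhds h1] with x hx
    by_cases hxρ : x ∈ f '' ball 0 ρ
    · obtain ⟨z, hz, rfl⟩ := hxρ
      rw [transplant_apply hi σ hz, hσ1 z, id]
      by_contra! hlt
      exact hx ⟨z, mem_closedBall_zero_iff.2 hlt.le, rfl⟩
    · rw [transplant, if_neg hxρ, id]

theorem exists_transplant_homeomorph (hf : DifferentiableOn ℂ f (ball 0 ρ))
    (hi : InjOn f (ball 0 ρ)) (hρ : 1 < ρ) (σ : ℂ ≃ₜ ℂ) (hσ : ∀ z, 1 ≤ ‖z‖ → σ z = z) :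
    ∃ H : ℂ ≃ₜ ℂ, (∀ z ∈ ball (0 : ℂ) ρ, H (f z) = f (σ z)) ∧
      ∀ R, f '' ball 0 1 ⊆ ball 0 R → H '' ball 0 R = ball 0 R := by
  have hσ' : ∀ z, 1 ≤ ‖z‖ → σ.symm z = z := fun z hz =>
    σ.injective (by rw [σ.apply_symm_apply, hσ z hz])
  have hσ1 : ∀ z, ‖z‖ < 1 → ‖σ z‖ < 1 := fun z hz => by
    by_contra! h
    rw [σ.injective (hσ _ h)] at h
    exact h.not_gt hz
  have hσ1' : ∀ z, ‖z‖ < 1 → ‖σ.symm z‖ < 1 := fun z hz => by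
    by_contra! h
    rw [σ.symm.injective (hσ' _ h)] at h
    exact h.not_gt hz
  have hm : MapsTo σ (ball 0 ρ) (ball 0 ρ) := fun z hz => by
    rcases le_or_gt 1 ‖z‖ with h | h
    · rwa [hσ z h]
    · exact mem_ball_zero_iff.2 ((hσ1 z h).trans hρ)
  have hm' : MapsTo σ.symm (ball 0 ρ) (ball 0 ρ) := fun z hz => by
    rcases le_or_gt 1 ‖z‖ with h | h
    · rwa [hσ' z h]
    · exact mem_ball_zero_iff.2 ((hσ1' z h).trans hρ)
  have hinv : ∀ (τ υ : ℂ → ℂ), MapsTo τ (ball 0 ρ) (ball 0 ρ) → LeftInverse υ τ →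
      LeftInverse (transplant f ρ υ) (transplant f ρ τ) := fun τ υ hτ h w => by
    by_cases hw : w ∈ f '' ball 0 ρ
    · obtain ⟨z, hz, rfl⟩ := hw
      rw [transplant_apply hi τ hz, transplant_apply hi υ (hτ hz), h]
    · have : transplant f ρ τ w = w := by rw [transplant, if_neg hw]
      rw [this, transplant, if_neg hw]
  let H : ℂ ≃ₜ ℂ := ⟨⟨transplant f ρ σ, transplant f ρ σ.symm, hinv _ _ hm σ.left_inv,
    hinv _ _ hm' σ.right_inv⟩, continuous_transplant hf hi hρ σ.continuous hσ hm,
    continuous_transplant hf hi hρ σ.symm.continuous hσ' hm'⟩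
  have hmap : ∀ (τ : ℂ → ℂ) (R : ℝ), (∀ z, 1 ≤ ‖z‖ → τ z = z) → (∀ z, ‖z‖ < 1 → ‖τ z‖ < 1) →
      f '' ball 0 1 ⊆ ball 0 R → MapsTo (transplant f ρ τ) (ball 0 R) (ball 0 R) :=
    fun τ R hτ hτ1 hR w hw => by
      by_cases hwρ : w ∈ f '' ball 0 ρ
      · obtain ⟨z, hz, rfl⟩ := hwρ
        rw [transplant_apply hi τ hz]
        rcases le_or_gt 1 ‖z‖ with h | h
        · rwa [hτ z h]
        · exact hR ⟨τ z, mem_ball_zero_iff.2 (hτ1 z h), rfl⟩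
      · rwa [transplant, if_neg hwρ]
  refine ⟨H, fun z hz => transplant_apply hi σ hz, fun R hR => Subset.antisymm
    (hmap σ R hσ hσ1 hR).image_subset fun w hw => ?_⟩
  exact ⟨H.symm w, hmap σ.symm R hσ' hσ1' hR hw, H.apply_symm_apply w⟩

end Transplant

end Bieberbach

namespace Bieberbach

open Metric Filter Topology Set Function

section MilinInequality

variable {f G : ℂ → ℂ} {b ρ r : ℝ}

theorem IsUnivalent.exists_norm_bounds (h : IsUnivalent b G) :
    ∃ κ, 0 < κ ∧ κ ≤ 1 ∧ ∀ z ∈ ball (0 : ℂ) κ,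
      b * ‖z‖ ≤ 2 * ‖univalentMap b G z‖ ∧ ‖univalentMap b G z‖ ≤ 2 * b * ‖z‖ := by
  have hc : ContinuousAt (fun z => ‖Complex.exp (G z)‖) 0 :=
    (h.differentiableOn_log.differentiableAt
      (isOpen_ball.mem_nhds (mem_ball_self one_pos))).continuousAt.cexp.norm
  have h1 : ∀ᶠ z in 𝓝 (0 : ℂ), ‖Complex.exp (G z)‖ ∈ Ioo (1 / 2 : ℝ) 2 :=
    hc.eventually_mem (isOpen_Ioo.mem_nhds (by simp [h.log_zero]; norm_num))
  obtain ⟨κ, hκ, hsub⟩ := Metric.eventually_nhds_iff_ball.1 h1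
  refine ⟨min κ 1, lt_min hκ one_pos, min_le_right _ _, fun z hz => ?_⟩
  obtain ⟨h2, h3⟩ := hsub z (ball_subset_ball (min_le_left _ _) hz)
  rw [univalentMap, norm_mul, norm_mul, Complex.norm_real, Real.norm_of_nonneg h.pos.le]
  have := mul_nonneg h.pos.le (norm_nonneg z)
  constructor <;> nlinarith

theorem IsUnivalent.functional_dilate_nonpos_of_extends (N : ℕ) (h : IsUnivalent b G) (hρ : 1 < ρ)
    (hf : DifferentiableOn ℂ f (ball 0 ρ)) (hi : InjOn f (ball 0 ρ))
    (hE : ∀ z ∈ ball (0 : ℂ) 1, f z = univalentMap b G z) (hr : 0 < r) (hr1 : r < 1) :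
    functional N 1 (fun z => G (r * z)) ≤ 0 := by
  obtain ⟨R, hR, hfR⟩ : ∃ R, 0 < R ∧ f '' ball 0 1 ⊆ ball 0 R := by
    obtain ⟨R, hR, hR'⟩ := ((isCompact_closedBall (0 : ℂ) 1).image_of_continuousOn
      (hf.continuousOn.mono (closedBall_subset_ball hρ))).isBounded.subset_ball_lt 0 0
    exact ⟨R, hR, (image_mono ball_subset_closedBall).trans hR'⟩
  obtain ⟨h₀, hE₀⟩ := h.dilate hr hr1.le
  obtain ⟨K, hK, hle⟩ := functional_le_of_homeomorph N hR h₀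
  obtain ⟨κ, hκ, hκ1, hκb⟩ := h.exists_norm_bounds
  have h1ρ : ball (0 : ℂ) 1 ⊆ ball 0 ρ := ball_subset_ball hρ.le
  have hκball : ball (0 : ℂ) κ ⊆ ball 0 1 := ball_subset_ball hκ1
  have hf0 : f 0 = 0 := by rw [hE 0 (mem_ball_self one_pos), univalentMap_zero]
  obtain ⟨κ', hκ', hsub⟩ : ∃ κ', 0 < κ' ∧ ball (0 : ℂ) κ' ⊆ f '' ball 0 κ :=
    Metric.isOpen_iff.1 (isOpen_image_of_injOn isOpen_ball (hf.mono (hκball.trans h1ρ))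
      (hi.mono (hκball.trans h1ρ))) 0 ⟨0, mem_ball_self hκ, hf0⟩
  have hmain : ∀ d, 0 < d → d ≤ 1 / 3 → r * Real.exp d ≤ 1 →
      functional N 1 (fun z => G (r * z)) ≤ K * d ^ 2 := fun d hd hd3 hrd => by
    have hpow : Tendsto (fun n : ℕ => r ^ n) atTop (𝓝 0) := tendsto_pow_atTop_nhds_zero_of_lt_one hr.le hr1
    have hpow' : Tendsto (fun n : ℕ => 2 * b * r ^ n) atTop (𝓝 0) := by simpa using hpow.const_mul (2 * b)
    obtain ⟨n, hn0, hn4, hnκ, hnR, hnκ'⟩ := ((eventually_ne_atTop 0).and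
      (((tendsto_pow_atTop_atTop_of_one_lt (Real.one_lt_exp_iff.2 hd)).eventually_ge_atTop 4).and
      ((hpow.eventually_lt_const hκ).and ((hpow'.eventually_lt_const hR).and
        (hpow'.eventually_lt_const hκ'))))).exists
    obtain ⟨σ, hσ, hσn⟩ := exists_radial_homeomorph hn0
    obtain ⟨H, hH, hHR⟩ := exists_transplant_homeomorph hf hi hρ σ hσ
    have hr' : 0 < r * Real.exp d := mul_pos hr (Real.exp_pos d)
    obtain ⟨h', hE'⟩ := h.dilate hr' hrd
    have hσ0 : σ 0 = 0 := by
      have : ‖σ.symm 0‖ = 0 := by rw [hσn 0 (by simp), norm_zero, zero_pow hn0]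
      rw [norm_eq_zero] at this
      rw [← this, σ.apply_symm_apply, this]
    refine hle H (2 * b * r ^ n) d _ _ ?_ (hHR R hfR) (by have := h.pos; positivity) hnR.le h' ?_ ?_ ?_ hd3
    · have := hH 0 (mem_ball_self (one_pos.trans hρ))
      rwa [hσ0, hf0] at this
    · rintro _ ⟨z, hz, rfl⟩
      rw [mem_ball_zero_iff] at hz
      have hz' : ‖(r : ℂ) * z‖ < r := by
        rw [norm_mul, Complex.norm_real, Real.norm_of_nonneg hr.le]
        exact mul_lt_of_lt_one_right hr hz
      have hs : ‖σ.symm (r * z)‖ < r ^ n := by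
        rw [hσn _ (hz'.trans hr1).le]
        exact pow_lt_pow_left₀ hz' (norm_nonneg _) hn0
      have hsκ : σ.symm (r * z) ∈ ball (0 : ℂ) κ := mem_ball_zero_iff.2 (hs.trans hnκ)
      refine ⟨f (σ.symm (r * z)), ?_, ?_⟩
      · rw [mem_ball_zero_iff, hE _ (hκball hsκ)]
        refine (hκb _ hsκ).2.trans_lt ?_
        have := h.pos
        gcongr
      · rw [hH _ (h1ρ (hκball hsκ)), σ.apply_symm_apply, hE₀,
          hE _ (mem_ball_zero_iff.2 (hz'.trans hr1))]
    · rintro _ ⟨w, hw, rfl⟩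
      rw [mem_ball_zero_iff] at hw
      obtain ⟨z, hz, rfl⟩ := hsub (mem_ball_zero_iff.2 (hw.trans hnκ'))
      rw [hE z (hκball hz)] at hw
      have hzn : ‖z‖ < 4 * r ^ n := by
        have := (hκb z hz).1
        have hb := h.pos
        refine lt_of_mul_lt_mul_left ?_ hb.le
        linarith
      have hσ1 : ‖σ z‖ ≤ 1 := by
        by_contra! hlt
        rw [σ.injective (hσ _ hlt.le)] at hlt
        exact (mem_ball_zero_iff.1 (hκball hz)).not_gt hlt
      have hσr : ‖σ z‖ < r * Real.exp d := by
        refine lt_of_pow_lt_pow_left₀ n hr'.le ?_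
        rw [← hσn _ hσ1, σ.symm_apply_apply, mul_pow]
        refine hzn.trans_le ?_
        rw [mul_comm]
        gcongr
      have hc : ((r * Real.exp d : ℝ) : ℂ) ≠ 0 := by exact_mod_cast hr'.ne'
      refine ⟨σ z / (r * Real.exp d : ℝ), ?_, ?_⟩
      · rw [mem_ball_zero_iff, norm_div, Complex.norm_real, Real.norm_of_nonneg hr'.le]
        exact (div_lt_one hr').2 hσr
      · rw [hE', mul_div_cancel₀ _ hc, hH z (h1ρ (hκball hz)),
          hE _ (mem_ball_zero_iff.2 (hσr.trans_le hrd))]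
    · have := h.pos
      rw [show r * Real.exp d * b / (r * b) = Real.exp d by field_simp, Real.log_exp]
  have hlim : Tendsto (fun d : ℝ => K * d ^ 2) (𝓝[>] 0) (𝓝 0) := by
    have : Continuous fun d : ℝ => K * d ^ 2 := by fun_prop
    simpa using (this.tendsto 0).mono_left nhdsWithin_le_nhds
  have hexp : ∀ᶠ d in 𝓝[>] (0 : ℝ), r * Real.exp d < 1 := by
    have : Continuous fun d : ℝ => r * Real.exp d := by fun_prop
    refine ((this.tendsto 0).mono_left nhdsWithin_le_nhds).eventually_lt_const ?_
    simpa using hr1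
  refine ge_of_tendsto hlim ?_
  filter_upwards [hexp, Ioc_mem_nhdsGT (show (0 : ℝ) < 1 / 3 by norm_num)] with d h1 h2
  exact hmain d h2.1 h2.2 h1.le

theorem IsUnivalent.functional_dilate_nonpos (N : ℕ) (h : IsUnivalent 1 G) (hr : 0 < r) (hr1 : r < 1) :
    functional N 1 (fun z => G (r * z)) ≤ 0 := by
  set s := √r with hs
  have hs0 : 0 < s := Real.sqrt_pos.2 hr
  have hs1 : s < 1 := (Real.sqrt_lt' one_pos).2 (by simpa using hr1)
  have hsc : (s : ℂ) ≠ 0 := by exact_mod_cast hs0.ne'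
  obtain ⟨hd, hE⟩ := h.dilate hs0 hs1.le
  have hm : ∀ z ∈ ball (0 : ℂ) s⁻¹, (s : ℂ) * z ∈ ball (0 : ℂ) 1 := fun z hz => by
    rw [mem_ball_zero_iff] at hz ⊢
    rw [norm_mul, Complex.norm_real, Real.norm_of_nonneg hs0.le, mul_comm]
    exact (lt_inv_mul_iff₀' hs0).1 (by simpa using hz)
  have := hd.functional_dilate_nonpos_of_extends N (f := fun z => univalentMap 1 G (s * z))
    ((one_lt_inv₀ hs0).2 hs1) (h.differentiableOn.comp (by fun_prop) hm)
    (fun z hz w hw hzw => mul_left_cancel₀ hsc (h.injOn (hm z hz) (hm w hw) hzw))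
    (fun z _ => (hE z).symm) hs0 hs1
  have hss : ∀ z : ℂ, (s : ℂ) * (s * z) = r * z := fun z => by
    rw [← mul_assoc, ← Complex.ofReal_mul, Real.mul_self_sqrt hr.le]
  simpa only [hss] using this

end MilinInequality

end Bieberbach

namespace Bieberbach

open Metric Filter Topology

/-- The coefficient estimate of **de Branges**, for the coefficient of `z ^ (N + 1)`. -/
theorem norm_coeff_le {f : ℂ → ℂ} {a : ℕ → ℂ} (hf : DifferentiableOn ℂ f (ball 0 1))
    (hi : Set.InjOn f (ball 0 1)) (hf0 : f 0 = 0) (hf'0 : deriv f 0 = 1)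
    (ha : ∀ z ∈ ball (0 : ℂ) 1, HasSum (fun n : ℕ => a n * z ^ n) (f z)) (N : ℕ) :
    ‖a (N + 1)‖ ≤ N + 1 := by
  obtain ⟨G, hG, hE⟩ := exists_isUnivalent one_pos hf hi hf0
    (by simpa using hf'0)
  have key : ∀ r : ℝ, 0 < r → r < 1 → ‖a (N + 1)‖ * r ^ N ≤ N + 1 := fun r hr hr1 => by
    have hrc : (r : ℂ) ≠ 0 := by exact_mod_cast hr.ne'
    have hm : ∀ z ∈ ball (0 : ℂ) 1, (r : ℂ) * z ∈ ball (0 : ℂ) 1 := fun z hz => by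
      rw [mem_ball_zero_iff] at hz ⊢
      rw [norm_mul, Complex.norm_real, Real.norm_of_nonneg hr.le]
      nlinarith [norm_nonneg z]
    have h1 := taylorCoeff_eq_of_hasSum (f := fun z => f (r * z) / r)
      (a := fun k => a k * r ^ k / r) one_pos (fun z hz => by
        simpa [mul_pow, mul_div_right_comm, mul_assoc] using (ha _ (hm z hz)).div_const (r : ℂ)) (N + 1)
    have h2 := norm_taylorCoeff_le_of_milin (G := fun z => G (r * z))
      (F := fun z => f (r * z) / r) one_pos (hG.differentiableOn_log.comp (by fun_prop) hm)
      (by simp [hG.log_zero]) (fun z hz => by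
        rw [hE _ (hm z hz), univalentMap]
        push_cast
        field_simp) N
      ((functional_one N _).ge.trans (hG.functional_dilate_nonpos N hr hr1))
    rw [h1, pow_succ, ← mul_assoc, mul_div_cancel_right₀ _ hrc, norm_mul, norm_pow, Complex.norm_real,
      Real.norm_of_nonneg hr.le] at h2
    exact h2
  have hlim : Tendsto (fun r : ℝ => ‖a (N + 1)‖ * r ^ N) (𝓝[<] 1) (𝓝 ‖a (N + 1)‖) := by
    have : Continuous fun r : ℝ => ‖a (N + 1)‖ * r ^ N := by fun_prop
    simpa using (this.tendsto 1).mono_left nhdsWithin_le_nhds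
  refine le_of_tendsto hlim ?_
  filter_upwards [Ioo_mem_nhdsLT (zero_lt_one' ℝ)] with r hr
  exact key r hr.1 hr.2

end Bieberbach

/-- **The Bieberbach conjecture / de Branges' theorem.**
If `f` is analytic and injective on the open unit disk of `ℂ`, with `f 0 = 0` and
`deriv f 0 = 1`, and `a` is its sequence of Taylor coefficients at `0`, so that
`f z = ∑ n, a n * z ^ n` on the disk (with `a 1 = 1`), then `‖a n‖ ≤ n` for all `n ≥ 1`. -/
theorem bieberbach_conjecture (f : ℂ → ℂ) (a : ℕ → ℂ)
    (hf_an : AnalyticOn ℂ f (Metric.ball (0 : ℂ) 1))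
    (hf_inj : Set.InjOn f (Metric.ball (0 : ℂ) 1))
    (hf0 : f 0 = 0) (hf'0 : deriv f 0 = 1)
    (ha : ∀ z ∈ Metric.ball (0 : ℂ) 1, HasSum (fun n : ℕ => a n * z ^ n) (f z))
    (ha1 : a 1 = 1) :
    ∀ n : ℕ, 1 ≤ n → ‖a n‖ ≤ (n : ℝ) := by
  intro n hn
  obtain ⟨N, rfl⟩ : ∃ N, n = N + 1 := ⟨n - 1, by omega⟩
  exact_mod_cast Bieberbach.norm_coeff_le hf_an.differentiableOn hf_inj hf0 hf'0 ha N
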